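/- Let K/F be a CM quadratic extension of a totally real field and let (V_1,h_1), (V_2,h_2) be nondegenerate K-Hermitian spaces of odd dimension m. If sgn_σ(h_1) = ± sgn_σ(h_2) for every real embedding σ of F, then (V_1,h_1) and (V_2,h_2) are F-conformal, i.e., there exist a K-linear isomorphism f: V_1 → V_2 and λ ∈ F^× with h_1 = λ · f^*(h_2). -/

import Mathlib

open Matrix

/-- `HermSig m A p q` : the complex matrix `A` is Hermitian with signature `(p,q)`
    (p positive eigenvalues, q negative eigenvalues). -/
def HermSig (m : ℕ) (A : Matrix (Fin m) (Fin m) ℂ) (p q : ℕ) : Prop :=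
  ∃ hA : A.IsHermitian,
    p = Fintype.card {i // 0 < hA.eigenvalues i} ∧
    q = Fintype.card {i // hA.eigenvalues i < 0}

namespace HL
open NumberField NumberField.mixedEmbedding NumberField.Units NumberField.InfinitePlace

noncomputable section

/-- tent function -/
def tent (t : ℝ) : ℝ := max 0 (1 - |t|)

lemma tent_nonneg (t : ℝ) : 0 ≤ tent t := le_max_left _ _
lemma tent_le_one (t : ℝ) : tent t ≤ 1 := max_le zero_le_one (by linarith [abs_nonneg t])
lemma tent_lip (a b : ℝ) : |tent a - tent b| ≤ |a - b| := by
  unfold tent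
  refine (abs_max_sub_max_le_max _ _ _ _).trans ?_
  simp only [sub_self, abs_zero]
  refine max_le (abs_nonneg _) ?_
  have := abs_abs_sub_abs_le a b
  rw [abs_sub_comm] at this
  calc _ = |(|b| - |a|)| := by congr 1; ring
    _ ≤ _ := this
lemma tent_eq_zero {t : ℝ} (h : 1 ≤ |t|) : tent t = 0 := max_eq_left (by linarith)
lemma abs_lt_of_tent_ne_zero {t : ℝ} (h : tent t ≠ 0) : |t| < 1 := by
  by_contra h'; exact h (tent_eq_zero (not_lt.mp h'))

lemma tent_sum (t : ℝ) : ∑ k ∈ ({-⌊t⌋, -⌊t⌋ - 1} : Finset ℤ), tent (k + t) = 1 := by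
  rw [Finset.sum_pair (by omega)]
  have h0 := Int.fract_nonneg t
  have h1 := Int.fract_lt_one t
  have e : ((-⌊t⌋ : ℤ) : ℝ) + t = Int.fract t := by push_cast; unfold Int.fract; ring
  have e' : ((-⌊t⌋ - 1 : ℤ) : ℝ) + t = Int.fract t - 1 := by push_cast; unfold Int.fract; ring
  rw [e, e']
  unfold tent
  rw [abs_of_nonneg h0, abs_of_nonpos (by linarith), max_eq_right (by linarith), max_eq_right (by linarith)]
  ring

lemma tent_zero_of_notMem (t : ℝ) {k : ℤ} (h : k ∉ ({-⌊t⌋, -⌊t⌋ - 1} : Finset ℤ)) : tent (k + t) = 0 := by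
  apply tent_eq_zero
  by_contra h'
  rw [not_le, abs_lt] at h'
  simp only [Finset.mem_insert, Finset.mem_singleton, not_or] at h
  have h3 := Int.floor_le t
  have h4 := Int.lt_floor_add_one t
  have a1 : (k : ℝ) + ⌊t⌋ < 1 := by linarith
  have a2 : -2 < (k : ℝ) + ⌊t⌋ := by linarith
  have a1' : k + ⌊t⌋ < 1 := by exact_mod_cast a1
  have a2' : -2 < k + ⌊t⌋ := by exact_mod_cast a2
  omega

lemma hasSum_tent {r : ℕ} (t : Fin r → ℝ) :
    HasSum (fun k : Fin r → ℤ => ∏ i, tent (k i + t i)) 1 := by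
  have h1 : (1 : ℝ) = ∑ k ∈ Fintype.piFinset (fun i => ({-⌊t i⌋, -⌊t i⌋ - 1} : Finset ℤ)),
      ∏ i, tent (k i + t i) := by
    rw [← Finset.prod_univ_sum (fun i => ({-⌊t i⌋, -⌊t i⌋ - 1} : Finset ℤ)) (fun i k => tent (k + t i))]
    rw [Finset.prod_congr rfl (fun i _ => tent_sum (t i))]; simp
  conv => arg 2; rw [h1]
  apply hasSum_sum_of_ne_finset_zero
  intro k hk
  rw [Fintype.mem_piFinset] at hk
  push Not at hk
  obtain ⟨i, hi⟩ := hk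
  exact Finset.prod_eq_zero (Finset.mem_univ i) (tent_zero_of_notMem (t i) hi)

lemma prod_lip {ι : Type*} (s : Finset ι) (f g : ι → ℝ) (hf : ∀ i, 0 ≤ f i ∧ f i ≤ 1)
    (hg : ∀ i, 0 ≤ g i ∧ g i ≤ 1) : |∏ i ∈ s, f i - ∏ i ∈ s, g i| ≤ ∑ i ∈ s, |f i - g i| := by
  classical
  induction s using Finset.induction_on with
  | empty => simp
  | insert a s ha ih =>
    rw [Finset.prod_insert ha, Finset.prod_insert ha, Finset.sum_insert ha]
    have e : f a * ∏ i ∈ s, f i - g a * ∏ i ∈ s, g i =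
      (f a - g a) * ∏ i ∈ s, f i + g a * (∏ i ∈ s, f i - ∏ i ∈ s, g i) := by ring
    rw [e]
    refine (abs_add_le _ _).trans ?_
    rw [abs_mul, abs_mul]
    have p1 : |∏ i ∈ s, f i| ≤ 1 := by
      rw [abs_of_nonneg (Finset.prod_nonneg fun i _ => (hf i).1)]
      exact Finset.prod_le_one (fun i _ => (hf i).1) (fun i _ => (hf i).2)
    have p2 : |g a| ≤ 1 := by rw [abs_of_nonneg (hg a).1]; exact (hg a).2
    have := abs_nonneg (f a - g a)
    have := abs_nonneg (∏ i ∈ s, f i - ∏ i ∈ s, g i)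
    nlinarith

variable (K : Type*) [Field K] [NumberField K]

open scoped Classical in
/-- real basis of log space from units -/
def uB : Module.Basis (Fin (rank K)) ℝ (dirichletUnitTheorem.logSpace K) :=
  (basisUnitLattice K).ofZLatticeBasis ℝ (unitLattice K)

variable {K}

/-- weight -/
def Wt (x : mixedSpace K) : ℝ := ∏ i, tent ((uB K).repr (logMap x) i)

lemma Wt_nonneg (x : mixedSpace K) : 0 ≤ Wt x := Finset.prod_nonneg fun _ _ => tent_nonneg _
lemma Wt_le_one (x : mixedSpace K) : Wt x ≤ 1 :=
  Finset.prod_le_one (fun _ _ => tent_nonneg _) fun _ _ => tent_le_one _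

lemma uB_apply (i) : uB K i = logEmbedding K (Additive.ofMul (fundSystem K i)) := by
  classical
  rw [logEmbedding_fundSystem]
  unfold uB
  rw [Module.Basis.ofZLatticeBasis_apply]

lemma uB_repr_log {ζ : (𝓞 K)ˣ} (hζ : ζ ∈ torsion K) (f : Fin (rank K) → ℤ) (i) :
    ((uB K).repr (logEmbedding K (Additive.ofMul (ζ * ∏ i, (fundSystem K i) ^ (f i)))) i) = f i := by
  have : logEmbedding K (Additive.ofMul (ζ * ∏ i, (fundSystem K i) ^ (f i)))
     = ∑ i, (f i : ℝ) • uB K i := by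
    rw [ofMul_mul, map_add, dirichletUnitTheorem.logEmbedding_eq_zero_iff.mpr hζ, zero_add, ofMul_prod, map_sum]
    refine Finset.sum_congr rfl fun i _ => ?_
    rw [ofMul_zpow, map_zsmul, uB_apply, Int.cast_smul_eq_zsmul]
  rw [this, Module.Basis.repr_sum_self]

/-- unit group as product -/
lemma exists_unit_equiv : ∃ e : (torsion K × (Fin (rank K) → ℤ)) ≃ (𝓞 K)ˣ,
    ∀ p i, (uB K).repr (logEmbedding K (Additive.ofMul (e p))) i = (p.2 i : ℝ) := by
  have key : Function.Bijective (fun p : torsion K × (Fin (rank K) → ℤ) =>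
      (p.1 : (𝓞 K)ˣ) * ∏ i, (fundSystem K i) ^ (p.2 i)) := by
    rw [Function.bijective_iff_existsUnique]
    intro x
    obtain ⟨p, hp, hu⟩ := exist_unique_eq_mul_prod K x
    exact ⟨p, hp.symm, fun y hy => hu y hy.symm⟩
  refine ⟨Equiv.ofBijective _ key, ?_⟩
  rintro ⟨ζ, f⟩ i
  exact uB_repr_log ζ.2 f i

lemma hasSum_aux {α β : Type*} [Finite α] (g : β → ℝ) (hg : ∀ b, 0 ≤ g b) (h : HasSum g 1) :
    HasSum (fun p : α × β => g p.2) (Nat.card α) := by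
  have h3 : HasSum (fun _ : α => (1 : ℝ)) (Nat.card α) := by
    have : Fintype α := Fintype.ofFinite _
    have := hasSum_fintype (fun _ : α => (1 : ℝ))
    simpa using this
  have h4 := h3.mul h (h3.summable.mul_of_nonneg h.summable (fun _ => zero_le_one) hg)
  simpa only [one_mul, mul_one] using h4

lemma hasSum_Wt (x : mixedSpace K) (hx : mixedEmbedding.norm x ≠ 0) :
    HasSum (fun u : (𝓞 K)ˣ => Wt (u • x)) (torsionOrder K) := by
  obtain ⟨e, he⟩ := exists_unit_equiv (K := K)
  have h1 : ∀ p : torsion K × (Fin (rank K) → ℤ), Wt (e p • x) =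
      ∏ i, tent (p.2 i + (uB K).repr (logMap x) i) := by
    intro p
    unfold Wt
    refine Finset.prod_congr rfl fun i _ => ?_
    rw [logMap_unit_smul _ hx, map_add, Finsupp.add_apply, he]
  have h2 := hasSum_aux (α := torsion K) _ (fun k => Finset.prod_nonneg fun _ _ => tent_nonneg _)
    (hasSum_tent (fun i => (uB K).repr (logMap x) i))
  rw [← e.hasSum_iff]
  have : ((fun u => Wt (u • x)) ∘ ⇑e) = fun p => ∏ i, tent (p.2 i + (uB K).repr (logMap x) i) := funext h1
  rw [this]
  exact h2

end
end HL

namespace HL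
open NumberField NumberField.mixedEmbedding NumberField.Units NumberField.InfinitePlace Module

noncomputable section
open scoped Classical
set_option linter.unusedSectionVars false
variable {K : Type*} [Field K] [NumberField K]

lemma nap_le_norm (w : InfinitePlace K) (x : mixedSpace K) : normAtPlace w x ≤ ‖x‖ := by
  rw [norm_eq_sup'_normAtPlace]
  exact Finset.le_sup' (fun w => normAtPlace w x) (Finset.mem_univ w)

lemma exists_nap_eq_norm (x : mixedSpace K) : ∃ w : InfinitePlace K, normAtPlace w x = ‖x‖ := by
  obtain ⟨w, -, hw⟩ := Finset.exists_mem_eq_sup' (Finset.univ_nonempty) (fun w : InfinitePlace K => normAtPlace w x)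
  exact ⟨w, by rw [norm_eq_sup'_normAtPlace, hw]⟩

lemma abs_nap_sub (w : InfinitePlace K) (x y : mixedSpace K) :
    |normAtPlace w x - normAtPlace w y| ≤ ‖x - y‖ := by
  have h1 := normAtPlace_add_le w (x - y) y
  have h2 := normAtPlace_add_le w (y - x) x
  have h3 : normAtPlace w (y - x) = normAtPlace w (x - y) := by rw [← neg_sub, normAtPlace_neg]
  rw [sub_add_cancel] at h1 h2
  have := nap_le_norm w (x - y)
  rw [abs_le]; constructor <;> linarith

lemma log_norm_eq (x : mixedSpace K) (hx : mixedEmbedding.norm x ≠ 0) :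
    Real.log (mixedEmbedding.norm x) = ∑ w : InfinitePlace K, (mult w : ℝ) * Real.log (normAtPlace w x) := by
  rw [mixedEmbedding.norm_apply, Real.log_prod]
  · simp [Real.log_pow]
  · intro w _
    exact pow_ne_zero _ (mixedEmbedding.norm_ne_zero_iff.mp hx w)

lemma sum_mult_real : ∑ w : InfinitePlace K, (mult w : ℝ) = finrank ℚ K := by
  rw [← sum_mult_eq (K := K)]; push_cast; rfl

lemma fr_pos : (0 : ℝ) < finrank ℚ K := by exact_mod_cast finrank_pos

lemma mult_bd (w : InfinitePlace K) : (1 : ℝ) ≤ mult w ∧ (mult w : ℝ) ≤ 2 := by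
  unfold mult; split_ifs <;> norm_num

/-- log coordinates of x are bounded on the support -/
lemma logbd : ∃ B : ℝ, 0 ≤ B ∧ ∀ x : mixedSpace K, mixedEmbedding.norm x ≠ 0 → Wt x ≠ 0 →
    ∀ w, |Real.log (normAtPlace w x) - Real.log (mixedEmbedding.norm x) * (finrank ℚ K : ℝ)⁻¹| ≤ B := by
  classical
  set T := LinearMap.toContinuousLinearMap (uB K).equivFun.symm.toLinearMap with hT
  have hbase : ∀ x : mixedSpace K, Wt x ≠ 0 → ∀ w : {w : InfinitePlace K // w ≠ dirichletUnitTheorem.w₀},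
      |logMap x w| ≤ ‖T‖ := by
    intro x hW w
    have h1 : logMap x = T ((uB K).equivFun (logMap x)) := by simp [hT]
    have h2 : ‖(uB K).equivFun (logMap x)‖ ≤ 1 := by
      rw [pi_norm_le_iff_of_nonneg zero_le_one]
      intro i
      rw [Real.norm_eq_abs]
      exact (abs_lt_of_tent_ne_zero (Finset.prod_ne_zero_iff.mp hW i (Finset.mem_univ i))).le
    calc |logMap x w| ≤ ‖logMap x‖ := norm_le_pi_norm (logMap x) w
      _ = ‖T ((uB K).equivFun (logMap x))‖ := by rw [← h1]
      _ ≤ ‖T‖ * ‖(uB K).equivFun (logMap x)‖ := T.le_opNorm _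
      _ ≤ ‖T‖ * 1 := by gcongr
      _ = ‖T‖ := mul_one _
  refine ⟨Fintype.card (InfinitePlace K) * ‖T‖ + ‖T‖, by positivity, ?_⟩
  intro x hx hW w
  set y : InfinitePlace K → ℝ := fun w => (mult w : ℝ) * (Real.log (normAtPlace w x) - Real.log (mixedEmbedding.norm x) * (finrank ℚ K : ℝ)⁻¹) with hy
  have hsum : ∑ w, y w = 0 := by
    simp only [hy, mul_sub, Finset.sum_sub_distrib]
    rw [← log_norm_eq x hx, ← Finset.sum_mul, sum_mult_real]
    have := fr_pos (K := K)
    field_simp; ring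
  have hne : ∀ w, w ≠ dirichletUnitTheorem.w₀ → |y w| ≤ ‖T‖ := fun w hw => by
    have := hbase x hW ⟨w, hw⟩
    rwa [logMap_apply] at this
  have hb : |y w| ≤ Fintype.card (InfinitePlace K) * ‖T‖ + ‖T‖ := by
    by_cases hw : w = dirichletUnitTheorem.w₀
    · subst hw
      have : y dirichletUnitTheorem.w₀ = - ∑ w ∈ Finset.univ.erase dirichletUnitTheorem.w₀, y w := by
        rw [eq_neg_iff_add_eq_zero, Finset.add_sum_erase _ _ (Finset.mem_univ _), hsum]
      rw [this, abs_neg]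
      refine (Finset.abs_sum_le_sum_abs _ _).trans ?_
      refine (Finset.sum_le_card_nsmul _ _ ‖T‖ (fun w hw => hne w (Finset.ne_of_mem_erase hw))).trans ?_
      rw [nsmul_eq_mul]
      have : ((Finset.univ.erase (dirichletUnitTheorem.w₀ : InfinitePlace K)).card : ℝ) ≤ Fintype.card (InfinitePlace K) := by
        exact_mod_cast Finset.card_le_univ _
      nlinarith [norm_nonneg T]
    · have := hne w hw
      have : (0:ℝ) ≤ Fintype.card (InfinitePlace K) * ‖T‖ := by positivity
      linarith
  refine le_trans ?_ hb
  rw [hy, abs_mul, abs_of_nonneg (by linarith [(mult_bd w).1] : (0:ℝ) ≤ mult w)]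
  nlinarith [(mult_bd w).1, abs_nonneg (Real.log (normAtPlace w x) - Real.log (mixedEmbedding.norm x) * (finrank ℚ K : ℝ)⁻¹)]

lemma nap_pos (x : mixedSpace K) (hx : mixedEmbedding.norm x ≠ 0) (w) : 0 < normAtPlace w x :=
  lt_of_le_of_ne (normAtPlace_nonneg w x) (Ne.symm (mixedEmbedding.norm_ne_zero_iff.mp hx w))

lemma supp_bd : ∃ c : ℝ, 0 < c ∧ c ≤ 1 ∧ ∀ x : mixedSpace K, mixedEmbedding.norm x ≠ 0 → Wt x ≠ 0 →
    ∀ w, c * ‖x‖ ≤ normAtPlace w x := by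
  obtain ⟨B, hB, h⟩ := logbd (K := K)
  refine ⟨Real.exp (-(2 * B)), Real.exp_pos _, Real.exp_le_one_iff.mpr (by linarith), ?_⟩
  intro x hx hW w
  obtain ⟨w', hw'⟩ := exists_nap_eq_norm x
  have h1 := abs_le.mp (h x hx hW w)
  have h2 := abs_le.mp (h x hx hW w')
  rw [← hw', ← Real.exp_log (nap_pos x hx w), ← Real.exp_log (nap_pos x hx w'), ← Real.exp_add]
  apply Real.exp_le_exp.mpr
  linarith [h1.1, h2.2]

lemma log_norm_lip (x y : mixedSpace K) (hx : mixedEmbedding.norm x ≠ 0) (hy : mixedEmbedding.norm y ≠ 0)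
    (η : ℝ) (h : ∀ w, |Real.log (normAtPlace w x) - Real.log (normAtPlace w y)| ≤ η) :
    |Real.log (mixedEmbedding.norm x) - Real.log (mixedEmbedding.norm y)| ≤ finrank ℚ K * η := by
  rw [log_norm_eq x hx, log_norm_eq y hy, ← Finset.sum_sub_distrib, ← sum_mult_real, Finset.sum_mul]
  refine (Finset.abs_sum_le_sum_abs _ _).trans (Finset.sum_le_sum fun w _ => ?_)
  rw [← mul_sub, abs_mul, abs_of_nonneg (by linarith [(mult_bd w).1] : (0:ℝ) ≤ mult w)]
  exact mul_le_mul_of_nonneg_left (h w) (by linarith [(mult_bd w).1])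

lemma Wt_lip : ∃ A : ℝ, 0 ≤ A ∧ ∀ x y : mixedSpace K, mixedEmbedding.norm x ≠ 0 → mixedEmbedding.norm y ≠ 0 →
    ∀ η : ℝ, (∀ w, |Real.log (normAtPlace w x) - Real.log (normAtPlace w y)| ≤ η) →
    |Wt x - Wt y| ≤ A * η := by
  classical
  set T := LinearMap.toContinuousLinearMap (uB K).equivFun.toLinearMap with hT
  refine ⟨(rank K) * (‖T‖ * 4), by positivity, ?_⟩
  intro x y hx hy η h
  have hη : 0 ≤ η := (abs_nonneg _).trans (h dirichletUnitTheorem.w₀)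
  have h1 : ‖logMap x - logMap y‖ ≤ 4 * η := by
    rw [pi_norm_le_iff_of_nonneg (by linarith)]
    intro w
    rw [Real.norm_eq_abs, Pi.sub_apply, logMap_apply, logMap_apply, ← mul_sub, abs_mul,
      abs_of_nonneg (by linarith [(mult_bd w.1).1] : (0:ℝ) ≤ mult w.1)]
    have a1 := h w.1
    have a2 := log_norm_lip x y hx hy η h
    have a3 : |(Real.log (mixedEmbedding.norm x) - Real.log (mixedEmbedding.norm y)) * (finrank ℚ K : ℝ)⁻¹| ≤ η := by
      rw [abs_mul, abs_of_pos (inv_pos.mpr fr_pos), mul_inv_le_iff₀ fr_pos]; linarith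
    have a4 : |Real.log (normAtPlace w.1 x) - Real.log (mixedEmbedding.norm x) * (finrank ℚ K : ℝ)⁻¹ -
      (Real.log (normAtPlace w.1 y) - Real.log (mixedEmbedding.norm y) * (finrank ℚ K : ℝ)⁻¹)| ≤ 2 * η := by
      rw [abs_le] at *; constructor <;> nlinarith
    nlinarith [(mult_bd w.1).2, abs_nonneg (Real.log (normAtPlace w.1 x) - Real.log (mixedEmbedding.norm x) * (finrank ℚ K : ℝ)⁻¹ -
      (Real.log (normAtPlace w.1 y) - Real.log (mixedEmbedding.norm y) * (finrank ℚ K : ℝ)⁻¹))]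
  have h2 : ∀ i, |(uB K).repr (logMap x) i - (uB K).repr (logMap y) i| ≤ ‖T‖ * (4 * η) := by
    intro i
    calc _ = |(T (logMap x - logMap y)) i| := by simp [hT]
      _ ≤ ‖T (logMap x - logMap y)‖ := norm_le_pi_norm (T (logMap x - logMap y)) i
      _ ≤ ‖T‖ * ‖logMap x - logMap y‖ := T.le_opNorm _
      _ ≤ _ := by gcongr
  unfold Wt
  refine (prod_lip _ _ _ (fun i => ⟨tent_nonneg _, tent_le_one _⟩) (fun i => ⟨tent_nonneg _, tent_le_one _⟩)).trans ?_
  refine (Finset.sum_le_card_nsmul _ _ (‖T‖ * (4 * η)) (fun i _ => (tent_lip _ _).trans (h2 i))).trans ?_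
  rw [nsmul_eq_mul, Finset.card_univ, Fintype.card_fin]
  apply le_of_eq; ring

end
end HL

namespace HL
open NumberField NumberField.mixedEmbedding NumberField.Units NumberField.InfinitePlace Module

noncomputable section
open scoped Classical
set_option linter.unusedSectionVars false
variable {K : Type*} [Field K] [NumberField K]

/-- weighted norm power -/
def fs (s : ℝ) (x : mixedSpace K) : ℝ := Wt x * (mixedEmbedding.norm x) ^ (-s)

lemma fs_nonneg (s : ℝ) (x : mixedSpace K) : 0 ≤ fs s x :=
  mul_nonneg (Wt_nonneg x) (Real.rpow_nonneg (mixedEmbedding.norm_nonneg x) _)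

lemma norm_ge_pow (x : mixedSpace K) (q : ℝ) (hq : 0 ≤ q) (h : ∀ w, q ≤ normAtPlace w x) :
    q ^ (finrank ℚ K) ≤ mixedEmbedding.norm x := by
  rw [mixedEmbedding.norm_apply, ← sum_mult_eq (K := K), ← Finset.prod_pow_eq_pow_sum]
  exact Finset.prod_le_prod (fun w _ => pow_nonneg hq _) (fun w _ => pow_le_pow_left₀ hq (h w) _)

lemma fs_bd : ∃ C : ℝ, 0 ≤ C ∧ ∀ s : ℝ, 1 < s → s ≤ 2 → ∀ x : mixedSpace K,
    fs s x ≤ C * ‖x‖ ^ (-(finrank ℚ K * s : ℝ)) := by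
  obtain ⟨c, hc0, hc1, hc⟩ := supp_bd (K := K)
  refine ⟨c ^ (-(finrank ℚ K * 2 : ℝ)), Real.rpow_nonneg hc0.le _, ?_⟩
  intro s hs1 hs2 x
  have hR : 0 ≤ c ^ (-(finrank ℚ K * 2 : ℝ)) * ‖x‖ ^ (-(finrank ℚ K * s : ℝ)) :=
    mul_nonneg (Real.rpow_nonneg hc0.le _) (Real.rpow_nonneg (norm_nonneg _) _)
  by_cases h0 : mixedEmbedding.norm x = 0
  · unfold fs; rw [h0, Real.zero_rpow (by linarith), mul_zero]; exact hR
  by_cases hW : Wt x = 0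
  · unfold fs; rw [hW, zero_mul]; exact hR
  have hx : 0 < ‖x‖ := by
    rw [norm_pos_iff]; rintro rfl
    obtain ⟨w, hw⟩ := exists_nap_eq_norm (0 : mixedSpace K)
    have := nap_pos 0 h0 w
    simp at this
  have h1 := norm_ge_pow x (c * ‖x‖) (by positivity) (hc x h0 hW)
  calc fs s x ≤ 1 * (mixedEmbedding.norm x) ^ (-s) :=
        mul_le_mul_of_nonneg_right (Wt_le_one x) (Real.rpow_nonneg (mixedEmbedding.norm_nonneg x) _)
    _ ≤ ((c * ‖x‖) ^ (finrank ℚ K)) ^ (-s) := by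
        rw [one_mul]; exact Real.rpow_le_rpow_of_nonpos (by positivity) h1 (by linarith)
    _ = c ^ (-(finrank ℚ K * s : ℝ)) * ‖x‖ ^ (-(finrank ℚ K * s : ℝ)) := by
        rw [← Real.rpow_natCast, ← Real.rpow_mul (by positivity), Real.mul_rpow hc0.le hx.le, mul_neg]
    _ ≤ _ := by
        gcongr ?_ * _
        apply Real.rpow_le_rpow_of_exponent_ge hc0 hc1
        have := fr_pos (K := K)
        nlinarith

lemma log_diff {u v q : ℝ} (hq : 0 < q) (hu : q ≤ u) (hv : q ≤ v) : |Real.log u - Real.log v| ≤ |u - v| / q := by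
  wlog h : v ≤ u generalizing u v
  · rw [abs_sub_comm, abs_sub_comm u]; exact this hv hu (le_of_lt (not_le.mp h))
  have hv0 : 0 < v := by linarith
  rw [abs_of_nonneg (sub_nonneg.mpr (Real.log_le_log hv0 h)), abs_of_nonneg (by linarith),
    ← Real.log_div (by linarith) hv0.ne']
  have := Real.log_le_sub_one_of_pos (div_pos (by linarith : 0 < u) hv0)
  calc _ ≤ u / v - 1 := this
    _ = (u - v) / v := by field_simp
    _ ≤ _ := by gcongr

lemma exp_diff {p p' m : ℝ} (hp : m ≤ p) (hp' : m ≤ p') : |Real.exp (-p) - Real.exp (-p')| ≤ |p - p'| * Real.exp (-m) := by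
  wlog h : p ≤ p' generalizing p p'
  · rw [abs_sub_comm, abs_sub_comm p]; exact this hp' hp (le_of_lt (not_le.mp h))
  rw [abs_of_nonneg (sub_nonneg.mpr (Real.exp_le_exp.mpr (by linarith))), abs_of_nonpos (by linarith)]
  have h1 : Real.exp (-p') = Real.exp (-p) * Real.exp (p - p') := by rw [← Real.exp_add]; ring_nf
  have h2 := Real.add_one_le_exp (p - p')
  have h3 : Real.exp (-p) ≤ Real.exp (-m) := Real.exp_le_exp.mpr (by linarith)
  rw [h1]
  have h4 := Real.exp_pos (-p)
  nlinarith

lemma fs_core (a : ℝ) (ha : 0 ≤ a) : ∃ C R : ℝ, 0 ≤ C ∧ 1 ≤ R ∧ ∀ s : ℝ, 1 < s → s ≤ 2 →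
    ∀ z z' : mixedSpace K, mixedEmbedding.norm z ≠ 0 → Wt z ≠ 0 → ‖z - z'‖ ≤ a → R ≤ ‖z‖ →
      |fs s z - fs s z'| ≤ C / ‖z‖ ^ (finrank ℚ K + 1) := by
  obtain ⟨c, hc0, hc1, hc⟩ := supp_bd (K := K)
  obtain ⟨A, hA, hW⟩ := Wt_lip (K := K)
  set n := finrank ℚ K with hn
  refine ⟨a * (A + 2 * n) * (2 / c) ^ (n + 1), 2 * (a + 1) / c, by positivity, ?_, ?_⟩
  · rw [le_div_iff₀ hc0]; linarith
  intro s hs1 hs2 z z' hz hWz hzz hR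
  rw [div_le_iff₀ hc0] at hR
  set q := c * ‖z‖ / 2 with hq
  have hq1 : a + 1 ≤ q := by rw [hq]; linarith
  have hz2 : ∀ w, q ≤ normAtPlace w z := fun w => by have := hc z hz hWz w; linarith
  have hz3 : ∀ w, q ≤ normAtPlace w z' := fun w => by
    have := hc z hz hWz w
    have h2 := (abs_le.mp ((abs_nap_sub w z z').trans hzz)).2
    linarith
  have hq0 : 0 < q := by linarith
  have hqn : 1 ≤ q ^ n := one_le_pow₀ (by linarith)
  have hN := norm_ge_pow z q hq0.le hz2
  have hN' := norm_ge_pow z' q hq0.le hz3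
  rw [← hn] at hN hN'
  have hz' : mixedEmbedding.norm z' ≠ 0 :=
    ne_of_gt (lt_of_lt_of_le (pow_pos hq0 n) hN')
  have hlog : ∀ w, |Real.log (normAtPlace w z) - Real.log (normAtPlace w z')| ≤ a / q := fun w =>
    (log_diff hq0 (hz2 w) (hz3 w)).trans (by gcongr; exact (abs_nap_sub w z z').trans hzz)
  have e1 := hW z z' hz hz' _ hlog
  have e2 := log_norm_lip z z' hz hz' _ hlog
  rw [← hn] at e2
  have r1 : ∀ y : mixedSpace K, q ^ n ≤ mixedEmbedding.norm y → (mixedEmbedding.norm y) ^ (-s) = Real.exp (-(s * Real.log (mixedEmbedding.norm y))) := by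
    intro y hy
    rw [Real.rpow_def_of_pos (by linarith)]; ring_nf
  have hm : ∀ y : mixedSpace K, q ^ n ≤ mixedEmbedding.norm y → Real.log (q ^ n) ≤ s * Real.log (mixedEmbedding.norm y) := by
    intro y hy
    have h1 : Real.log (q ^ n) ≤ Real.log (mixedEmbedding.norm y) := Real.log_le_log (by linarith) hy
    have h2 : 0 ≤ Real.log (q ^ n) := Real.log_nonneg hqn
    nlinarith
  have hexp : Real.exp (-Real.log (q ^ n)) = (q ^ n)⁻¹ := by rw [Real.exp_neg, Real.exp_log (by linarith)]
  have e3 := exp_diff (hm z hN) (hm z' hN')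
  rw [← r1 z hN, ← r1 z' hN', hexp, ← mul_sub, abs_mul, abs_of_pos (by linarith : 0 < s)] at e3
  have e4 : (mixedEmbedding.norm z) ^ (-s) ≤ (q ^ n)⁻¹ := by
    rw [r1 z hN, ← hexp]; exact Real.exp_le_exp.mpr (by linarith [hm z hN])
  have e5 : 0 ≤ (mixedEmbedding.norm z) ^ (-s) := Real.rpow_nonneg (mixedEmbedding.norm_nonneg z) _
  have key : |fs s z - fs s z'| ≤ A * (a / q) * (q ^ n)⁻¹ + 2 * (n * (a / q)) * (q ^ n)⁻¹ := by
    have : fs s z - fs s z' = (Wt z - Wt z') * (mixedEmbedding.norm z) ^ (-s) + Wt z' * ((mixedEmbedding.norm z) ^ (-s) - (mixedEmbedding.norm z') ^ (-s)) := by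
      unfold fs; ring
    rw [this]
    refine (abs_add_le _ _).trans (add_le_add ?_ ?_)
    · rw [abs_mul, abs_of_nonneg e5]
      exact mul_le_mul e1 e4 e5 (by positivity)
    · rw [abs_mul, abs_of_nonneg (Wt_nonneg z')]
      calc _ ≤ 1 * |(mixedEmbedding.norm z) ^ (-s) - (mixedEmbedding.norm z') ^ (-s)| :=
            mul_le_mul_of_nonneg_right (Wt_le_one _) (abs_nonneg _)
        _ ≤ s * |Real.log (mixedEmbedding.norm z) - Real.log (mixedEmbedding.norm z')| * (q ^ n)⁻¹ := by
            rw [one_mul]; exact e3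
        _ ≤ _ := by gcongr
  refine key.trans (le_of_eq ?_)
  have hz0 : 0 < ‖z‖ := by
    by_contra h; push Not at h; rw [hq] at hq0; nlinarith
  rw [hq, pow_succ, pow_succ, div_pow, div_pow, mul_pow]
  field_simp

lemma fs_diff (a : ℝ) (ha : 0 ≤ a) : ∃ C R : ℝ, 0 ≤ C ∧ 1 ≤ R ∧ ∀ s : ℝ, 1 < s → s ≤ 2 →
    ∀ z z' : mixedSpace K, ‖z - z'‖ ≤ a → R ≤ ‖z‖ →
      |fs s z - fs s z'| ≤ C / ‖z‖ ^ (finrank ℚ K + 1) := by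
  obtain ⟨C, R, hC, hR, h⟩ := fs_core (K := K) a ha
  refine ⟨C * 2 ^ (finrank ℚ K + 1), 2 * R + 2 * a, by positivity, by linarith, ?_⟩
  intro s hs1 hs2 z z' hzz hz
  have hz0 : 0 < ‖z‖ := by linarith
  have hzero : ∀ y : mixedSpace K, ¬ (mixedEmbedding.norm y ≠ 0 ∧ Wt y ≠ 0) → fs s y = 0 := by
    intro y hy
    unfold fs
    by_cases h0 : mixedEmbedding.norm y = 0
    · rw [h0, Real.zero_rpow (by linarith), mul_zero]
    · have : Wt y = 0 := by by_contra h'; exact hy ⟨h0, h'⟩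
      rw [this, zero_mul]
  have hpow : (1 : ℝ) ≤ 2 ^ (finrank ℚ K + 1) := one_le_pow₀ (by norm_num)
  by_cases c1 : mixedEmbedding.norm z ≠ 0 ∧ Wt z ≠ 0
  · refine (h s hs1 hs2 z z' c1.1 c1.2 hzz (by linarith)).trans ?_
    gcongr; nlinarith
  by_cases c2 : mixedEmbedding.norm z' ≠ 0 ∧ Wt z' ≠ 0
  · have hn : ‖z‖ ≤ ‖z'‖ + a := by
      have := norm_sub_norm_le z z'; linarith
    rw [abs_sub_comm]
    refine (h s hs1 hs2 z' z c2.1 c2.2 (by rwa [norm_sub_rev]) (by linarith)).trans ?_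
    have h2 : ‖z‖ / 2 ≤ ‖z'‖ := by linarith
    calc C / ‖z'‖ ^ (finrank ℚ K + 1) ≤ C / (‖z‖ / 2) ^ (finrank ℚ K + 1) := by gcongr
      _ = _ := by rw [div_pow]; field_simp
  · rw [hzero z c1, hzero z' c2]; simp; positivity

/-- embedding of integers -/
abbrev em (y : 𝓞 K) : mixedSpace K := mixedEmbedding K (y : K)

lemma summable_gen {E : Type*} [NormedAddCommGroup E] [NormedSpace ℝ E] [FiniteDimensional ℝ E]
    (L : Submodule ℤ E) [DiscreteTopology L] [IsZLattice ℝ L] {I : Type*} (f : I → E)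
    (hf : Function.Injective f) (hL : ∀ i, f i ∈ L) (r : ℝ) (hr : r < -(finrank ℝ E : ℝ)) :
    Summable fun i => ‖f i‖ ^ r := by
  have hfr : finrank ℤ L = finrank ℝ E := ZLattice.rank ℝ L
  have h := ZLattice.summable_norm_rpow L r (by rw [hfr]; exact hr)
  have hinj : Function.Injective (fun y => (⟨f y, hL y⟩ : L)) := by
    intro y y' h
    exact hf (congrArg Subtype.val h)
  have h2 : Summable (fun i => ‖(⟨f i, hL i⟩ : L)‖ ^ r) := h.comp_injective hinj
  refine h2.congr fun i => ?_
  rw [Submodule.coe_norm]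

lemma em_mem (y : 𝓞 K) : em y ∈ mixedEmbedding.integerLattice K := by
  rw [mixedEmbedding.integerLattice, LinearMap.mem_range]
  exact ⟨y, rfl⟩

lemma em_inj : Function.Injective (em (K := K)) := fun _ _ h =>
  RingOfIntegers.coe_injective (mixedEmbedding_injective K h)

lemma summable_em (r : ℝ) (hr : r < -(finrank ℚ K : ℝ)) : Summable fun y : 𝓞 K => ‖em y‖ ^ r :=
  summable_gen (mixedEmbedding.integerLattice K) em em_inj em_mem r
    (by rw [mixedEmbedding.finrank]; exact hr)

lemma finite_em (R : ℝ) : {y : 𝓞 K | ‖em y‖ < R}.Finite := by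
  by_cases hR : R ≤ 0
  · convert Set.finite_empty
    ext y; simp; exact hR.trans (norm_nonneg _)
  push Not at hR
  have h := (summable_em (K := K) (-(finrank ℚ K : ℝ) - 1) (by linarith)).tendsto_cofinite_zero
  have := (h.eventually (gt_mem_nhds (Real.rpow_pos_of_pos hR (-(finrank ℚ K : ℝ) - 1))))
  rw [Filter.eventually_cofinite] at this
  refine (this.union (Set.finite_singleton 0)).subset ?_
  intro y hy
  by_cases h0 : y = 0
  · right; exact h0
  · left
    have hpos : 0 < ‖em y‖ := by
      rw [norm_pos_iff]; intro h; apply h0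
      have : (y : K) = 0 := by simpa [em] using h
      exact_mod_cast this
    simp only [Set.mem_ofPred_eq, not_lt] at hy ⊢
    exact Real.rpow_le_rpow_of_nonpos hpos hy.le (by linarith [fr_pos (K := K)])

lemma norm_em (y : 𝓞 K) : mixedEmbedding.norm (em y) = ((Algebra.norm ℤ y).natAbs : ℝ) := by
  rw [em, norm_eq_norm, Nat.cast_natAbs, ← Algebra.coe_norm_int]; push_cast; rfl

lemma fs_em_le_one (s : ℝ) (hs : 1 < s) (y : 𝓞 K) : fs s (em y) ≤ 1 := by
  unfold fs
  refine mul_le_one₀ (Wt_le_one _) (Real.rpow_nonneg (mixedEmbedding.norm_nonneg _) _) ?_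
  rw [norm_em]
  rcases Nat.eq_zero_or_pos (Algebra.norm ℤ y).natAbs with h | h
  · rw [h]; simp; rw [Real.zero_rpow (by linarith)]; norm_num
  · exact Real.rpow_le_one_of_one_le_of_nonpos (by exact_mod_cast h) (by linarith)

lemma summable_fs (s : ℝ) (hs1 : 1 < s) (hs2 : s ≤ 2) : Summable fun y : 𝓞 K => fs s (em y) := by
  obtain ⟨C, hC, h⟩ := fs_bd (K := K)
  refine Summable.of_nonneg_of_le (fun y => fs_nonneg _ _) (fun y => h s hs1 hs2 (em y)) ?_
  apply Summable.mul_left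
  apply summable_em
  have := fr_pos (K := K)
  nlinarith

lemma fs_translate (α : 𝓞 K) : ∃ g : 𝓞 K → ℝ, Summable g ∧ ∀ s : ℝ, 1 < s → s ≤ 2 →
    ∀ y, |fs s (em (α + y)) - fs s (em y)| ≤ g y := by
  obtain ⟨C, R, hC, hR, h⟩ := fs_diff (K := K) ‖em α‖ (norm_nonneg _)
  refine ⟨fun y => C * ‖em y‖ ^ (-(finrank ℚ K + 1 : ℝ)) + (if ‖em y‖ < R then 1 else 0), ?_, ?_⟩
  · apply Summable.add
    · exact (summable_em _ (by linarith)).mul_left _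
    · apply summable_of_hasFiniteSupport
      refine (finite_em (K := K) R).subset ?_
      intro y hy
      simp only [Function.mem_support, ne_eq, ite_eq_right_iff, one_ne_zero, imp_false, not_not] at hy
      exact hy
  · intro s hs1 hs2 y
    have hpos : 0 ≤ C * ‖em y‖ ^ (-(finrank ℚ K + 1 : ℝ)) := mul_nonneg hC (Real.rpow_nonneg (norm_nonneg _) _)
    beta_reduce
    split_ifs with hy
    · have a1 := fs_em_le_one s hs1 y
      have a2 := fs_em_le_one s hs1 (α + y)
      have a3 := fs_nonneg s (em y)
      have a4 := fs_nonneg s (em (α + y))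
      rw [abs_le]; constructor <;> linarith
    · push Not at hy
      rw [add_zero, abs_sub_comm]
      refine (h s hs1 hs2 (em y) (em (α + y)) ?_ hy).trans (le_of_eq ?_)
      · have : em y - em (α + y) = - em α := by simp [em]
        rw [this, norm_neg]
      · rw [Real.rpow_neg (norm_nonneg _), div_eq_mul_inv]
        congr 2
        rw [← Real.rpow_natCast]; push_cast; rfl

lemma coset_sum_gen {R : Type*} [CommRing R] (J : Ideal R) [Fintype (R ⧸ J)] (f : R → ℝ) (hs : Summable f)
    (g : R → R → ℝ) (hg : ∀ α, Summable (g α)) (hgb : ∀ α y, |f (α + y) - f y| ≤ g α y) :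
    |∑' y : R, f y - (Fintype.card (R ⧸ J) : ℝ) * ∑' y : J, f (y : R)| ≤
      ∑ q : R ⧸ J, ∑' y : J, g q.out y := by
  set rep : R ⧸ J → R := Quotient.out with hrep
  have hmk : ∀ q, Ideal.Quotient.mk J (rep q) = q := fun q => Quotient.out_eq q
  have hbij : Function.Bijective (fun p : (R ⧸ J) × J => rep p.1 + (p.2 : R)) := by
    constructor
    · rintro ⟨q, y⟩ ⟨q', y'⟩ h
      simp only at h
      have h2 := congrArg (Ideal.Quotient.mk J) h
      rw [map_add, map_add, hmk, hmk, Ideal.Quotient.eq_zero_iff_mem.mpr y.2, Ideal.Quotient.eq_zero_iff_mem.mpr y'.2, add_zero, add_zero] at h2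
      subst h2
      simpa using h
    · intro x
      refine ⟨(Ideal.Quotient.mk J x, ⟨x - rep (Ideal.Quotient.mk J x), ?_⟩), by simp⟩
      rw [← Ideal.Quotient.eq_zero_iff_mem, map_sub, hmk, sub_self]
  have hs' : Summable (fun p : (R ⧸ J) × J => f (rep p.1 + (p.2 : R))) :=
    (Equiv.ofBijective _ hbij).summable_iff.mpr hs
  have e1 : ∑' y : R, f y = ∑ q : R ⧸ J, ∑' y : J, f (rep q + (y : R)) := by
    have h1 : ∑' p : (R ⧸ J) × J, f (rep p.1 + (p.2 : R)) = ∑' y : R, f y :=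
      (Equiv.ofBijective _ hbij).tsum_eq f
    rw [← h1, Summable.tsum_prod hs', tsum_fintype]
  have hsJ : Summable fun y : J => f (y : R) := hs.comp_injective Subtype.val_injective
  have hsq : ∀ q, Summable fun y : J => f (rep q + (y : R)) := fun q =>
    hs'.comp_injective (i := fun y : J => (q, y)) (Prod.mk_right_injective q)
  rw [e1]
  have e2 : (Fintype.card (R ⧸ J) : ℝ) * ∑' y : J, f (y : R) = ∑ q : R ⧸ J, ∑' y : J, f (y : R) := by
    rw [Finset.sum_const, nsmul_eq_mul, Finset.card_univ]
  rw [e2, ← Finset.sum_sub_distrib]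
  refine (Finset.abs_sum_le_sum_abs _ _).trans (Finset.sum_le_sum fun q _ => ?_)
  rw [← (hsq q).tsum_sub hsJ]
  have hgs : Summable fun y : J => g (rep q) (y : R) := (hg (rep q)).comp_injective Subtype.val_injective
  have hb : ∀ y : J, ‖f (rep q + (y : R)) - f (y : R)‖ ≤ g (rep q) y := fun y => hgb (rep q) y
  exact tsum_of_norm_bounded hgs.hasSum hb

/-- comparison of the sum over `𝓞 K` with the sum over an ideal -/
lemma coset_sum (J : Ideal (𝓞 K)) (hJ : J ≠ ⊥) : ∃ C : ℝ, ∀ s : ℝ, 1 < s → s ≤ 2 →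
    |∑' y : 𝓞 K, fs s (em y) - (Ideal.absNorm J : ℝ) * ∑' y : J, fs s (em (y : 𝓞 K))| ≤ C := by
  choose g hg hgb using fs_translate (K := K)
  have : Finite (𝓞 K ⧸ J) := Ideal.finiteQuotientOfFreeOfNeBot J hJ
  have : Fintype (𝓞 K ⧸ J) := Fintype.ofFinite _
  have hcard : Ideal.absNorm J = Fintype.card (𝓞 K ⧸ J) := by
    rw [Ideal.absNorm_apply, Submodule.cardQuot_apply, Nat.card_eq_fintype_card]
  refine ⟨∑ q : 𝓞 K ⧸ J, ∑' y : J, g q.out y, ?_⟩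
  intro s hs1 hs2
  rw [hcard]
  exact coset_sum_gen J (fun y => fs s (em y)) (summable_fs s hs1 hs2) g hg (fun α y => hgb α s hs1 hs2 y)

end
end HL

namespace HL
open NumberField NumberField.mixedEmbedding NumberField.Units NumberField.InfinitePlace Module
open scoped nonZeroDivisors

noncomputable section
open scoped Classical
set_option linter.unusedSectionVars false
variable {K : Type*} [Field K] [NumberField K]

/-- nonzero ideals -/
abbrev Idl (K : Type*) [Field K] [NumberField K] : Type _ := ↥((Ideal (𝓞 K))⁰)

/-- the term `N(I)^(-s)` -/
def nt (s : ℝ) (I : Idl K) : ℝ := (Ideal.absNorm (I : Ideal (𝓞 K)) : ℝ) ^ (-s)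

lemma idl_ne (I : Idl K) : (I : Ideal (𝓞 K)) ≠ ⊥ := mem_nonZeroDivisors_iff_ne_zero.mp I.2

lemma absNorm_pos (I : Idl K) : 0 < Ideal.absNorm (I : Ideal (𝓞 K)) := by
  rw [Nat.pos_iff_ne_zero, ne_eq, Ideal.absNorm_eq_zero_iff]; exact idl_ne I

lemma em_unit_mul (u : (𝓞 K)ˣ) (x : 𝓞 K) : em ((u : 𝓞 K) * x) = u • em x := by
  rw [unitSMul_smul, em, em]; simp

lemma hasSum_units (s : ℝ) (x : 𝓞 K) (hx : x ≠ 0) :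
    HasSum (fun u : (𝓞 K)ˣ => fs s (em ((u : 𝓞 K) * x))) (torsionOrder K * ((Algebra.norm ℤ x).natAbs : ℝ) ^ (-s)) := by
  have h0 : mixedEmbedding.norm (em x) ≠ 0 := by
    rw [norm_em]; simp [hx]
  have h := (hasSum_Wt (em x) h0).mul_right (((Algebra.norm ℤ x).natAbs : ℝ) ^ (-s))
  refine h.congr_fun ?_ |> fun h => h
  intro u
  rw [em_unit_mul, fs, norm_unit_smul, norm_em]

lemma fs_zero (s : ℝ) (hs : 1 < s) : fs s (em (0 : 𝓞 K)) = 0 := by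
  rw [fs, norm_em]; simp; right; exact Real.zero_rpow (by linarith)

lemma exists_gen {R : Type*} [CommRing R] [IsDedekindDomain R] (J : (Ideal R)⁰) (I : (Ideal R)⁰)
    (hI : ClassGroup.mk0 I = (ClassGroup.mk0 J)⁻¹) :
    ∃ x : R, x ≠ 0 ∧ (I : Ideal R) * (J : Ideal R) = Ideal.span {x} := by
  have h : ClassGroup.mk0 (I * J) = 1 := by rw [map_mul, hI, inv_mul_cancel]
  rw [ClassGroup.mk0_eq_one_iff] at h
  obtain ⟨x, hx⟩ := h
  refine ⟨x, ?_, hx⟩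
  rintro rfl
  apply mem_nonZeroDivisors_iff_ne_zero.mp (I * J).2
  rw [hx]; simp

lemma class_inj {R : Type*} [CommRing R] [IsDedekindDomain R] (J I I' : (Ideal R)⁰) (x x' : R)
    (hx : (I : Ideal R) * (J : Ideal R) = Ideal.span {x}) (hx' : (I' : Ideal R) * (J : Ideal R) = Ideal.span {x'})
    (u u' : Rˣ) (h1 : (u : R) * x = u' * x') : I = I' := by
  have h2 : Ideal.span {x} = Ideal.span {x'} := by
    rw [Ideal.span_singleton_eq_span_singleton]
    refine ⟨u * u'⁻¹, ?_⟩
    have : x * (u * ↑u'⁻¹) = (↑u'⁻¹ * u' : R) * x' := by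
      rw [mul_assoc (↑u'⁻¹ : R), ← h1]; ring
    rw [Units.val_mul, this]; simp
  rw [← hx, ← hx'] at h2
  exact Subtype.ext (mul_right_cancel₀ (mem_nonZeroDivisors_iff_ne_zero.mp J.2) h2)

lemma class_surj {R : Type*} [CommRing R] [IsDedekindDomain R] (J : (Ideal R)⁰) (y : R) (hy : y ∈ (J : Ideal R))
    (hy0 : y ≠ 0) : ∃ I : (Ideal R)⁰, ClassGroup.mk0 I = (ClassGroup.mk0 J)⁻¹ ∧
      (I : Ideal R) * (J : Ideal R) = Ideal.span {y} := by
  have hd : (J : Ideal R) ∣ Ideal.span {y} := by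
    rw [Ideal.dvd_span_singleton]; exact hy
  obtain ⟨I, hI⟩ := hd
  have hI0 : I ≠ 0 := by
    rintro rfl
    rw [mul_zero, Ideal.zero_eq_bot, Ideal.span_singleton_eq_bot] at hI
    exact hy0 hI
  refine ⟨⟨I, mem_nonZeroDivisors_iff_ne_zero.mpr hI0⟩, ?_, by rw [hI, mul_comm]⟩
  rw [eq_inv_iff_mul_eq_one, ← map_mul, ClassGroup.mk0_eq_one_iff]
  refine ⟨y, ?_⟩
  rw [Submonoid.coe_mul, mul_comm]; exact hI.symm

lemma class_bij {R : Type*} [CommRing R] [IsDedekindDomain R] (J : (Ideal R)⁰) :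
    ∃ x : {I : (Ideal R)⁰ // ClassGroup.mk0 I = (ClassGroup.mk0 J)⁻¹} → R, (∀ I, x I ≠ 0) ∧
     (∀ I, (I.1 : Ideal R) * (J : Ideal R) = Ideal.span {x I}) ∧
     ∃ Φ : {I : (Ideal R)⁰ // ClassGroup.mk0 I = (ClassGroup.mk0 J)⁻¹} × Rˣ → (J : Ideal R),
      (∀ p, (Φ p : R) = (p.2 : R) * x p.1) ∧ Function.Injective Φ ∧
      ∀ y : (J : Ideal R), (y : R) ≠ 0 → y ∈ Set.range Φ := by
  have H := fun I : {I : (Ideal R)⁰ // ClassGroup.mk0 I = (ClassGroup.mk0 J)⁻¹} => exists_gen J I.1 I.2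
  choose x hx0 hx using H
  have hmem : ∀ I, x I ∈ (J : Ideal R) := fun I => by
    have : x I ∈ Ideal.span {x I} := Ideal.mem_span_singleton_self _
    rw [← hx I] at this
    have hle : (I.1 : Ideal R) * (J : Ideal R) ≤ (J : Ideal R) := Ideal.mul_le_right
    exact hle this
  refine ⟨x, hx0, hx, fun p => ⟨(p.2 : R) * x p.1, Ideal.mul_mem_left _ _ (hmem _)⟩, fun p => rfl, ?_, ?_⟩
  · rintro ⟨I, u⟩ ⟨I', u'⟩ h
    have h1 := congrArg Subtype.val h
    simp only at h1
    have h4 : I = I' := Subtype.ext (class_inj J I.1 I'.1 _ _ (hx I) (hx I') u u' h1)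
    subst h4
    rw [Units.ext (mul_right_cancel₀ (hx0 I) h1)]
  · intro y hy0
    obtain ⟨I, hI, hI2⟩ := class_surj J y y.2 hy0
    have h2 := hx ⟨I, hI⟩
    rw [hI2, Ideal.span_singleton_eq_span_singleton] at h2
    obtain ⟨u, hu⟩ := h2.symm
    exact ⟨(⟨I, hI⟩, u), Subtype.ext (by rw [← hu]; exact mul_comm _ _)⟩

lemma summable_J (J : Ideal (𝓞 K)) (s : ℝ) (hs1 : 1 < s) (hs2 : s ≤ 2) :
    Summable fun y : J => fs s (em (y : 𝓞 K)) :=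
  Summable.comp_injective (i := fun y : J => (y : 𝓞 K)) (summable_fs (K := K) s hs1 hs2) Subtype.val_injective

lemma hasSum_class (J : Idl K) (s : ℝ) (hs1 : 1 < s) (hs2 : s ≤ 2) :
    HasSum (fun I : {I : Idl K // ClassGroup.mk0 I = (ClassGroup.mk0 J)⁻¹} => 
      (torsionOrder K : ℝ) * (nt s (I : Idl K) * nt s J)) (∑' y : (J : Ideal (𝓞 K)), fs s (em (y : 𝓞 K))) := by
  obtain ⟨x, hx0, hx, Φ, hΦ, hinj, hsurj'⟩ := class_bij J
  have hsurj : ∀ y : (J : Ideal (𝓞 K)), y ∉ Set.range Φ → fs s (em (y : 𝓞 K)) = 0 := by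
    intro y hy
    by_cases hy0 : (y : 𝓞 K) = 0
    · rw [hy0]; exact fs_zero s hs1
    exact absurd (hsurj' y hy0) hy
  have hsJ := summable_J (J : Ideal (𝓞 K)) s hs1 hs2
  have hH := (hinj.hasSum_iff hsurj).mpr hsJ.hasSum
  have hH2 : HasSum (fun p : {I : Idl K // ClassGroup.mk0 I = (ClassGroup.mk0 J)⁻¹} × (𝓞 K)ˣ =>
      fs s (em ((p.2 : 𝓞 K) * x p.1))) (∑' y : (J : Ideal (𝓞 K)), fs s (em (y : 𝓞 K))) := by
    refine hH.congr_fun ?_ |> fun h => h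
    intro p
    rw [Function.comp_apply, hΦ]
  refine HasSum.prod_fiberwise hH2 (fun I => ?_)
  have hN : (torsionOrder K : ℝ) * (nt s (I : Idl K) * nt s J) = torsionOrder K * ((Algebra.norm ℤ (x I)).natAbs : ℝ) ^ (-s) := by
    rw [← Ideal.absNorm_span_singleton, ← hx I, map_mul, Nat.cast_mul, Real.mul_rpow (by positivity) (by positivity)]
    rfl
  rw [hN]
  exact hasSum_units s (x I) (hx0 I)

lemma nt_pos (s : ℝ) (I : Idl K) : 0 < nt s I := Real.rpow_pos_of_pos (by exact_mod_cast absNorm_pos I) _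

lemma tors_pos : (0 : ℝ) < torsionOrder K := by exact_mod_cast torsionOrder_pos K

lemma hasSum_class' (J : Idl K) (s : ℝ) (hs1 : 1 < s) (hs2 : s ≤ 2) :
    HasSum (fun I : {I : Idl K // ClassGroup.mk0 I = (ClassGroup.mk0 J)⁻¹} => nt s (I : Idl K)) 
     ((torsionOrder K : ℝ)⁻¹ * (nt s J)⁻¹ * ∑' y : (J : Ideal (𝓞 K)), fs s (em (y : 𝓞 K))) := by
  have h := (hasSum_class J s hs1 hs2).mul_left ((torsionOrder K : ℝ)⁻¹ * (nt s J)⁻¹)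
  refine h.congr_fun ?_ |> fun h => h
  intro I
  have := (nt_pos s J).ne'
  have := (tors_pos (K := K)).ne'
  field_simp

/-- class partial zeta -/
def Zc (s : ℝ) (C : ClassGroup (𝓞 K)) : ℝ := ∑' I : {I : Idl K // ClassGroup.mk0 I = C}, nt s (I : Idl K)

lemma summable_Zc (s : ℝ) (hs1 : 1 < s) (hs2 : s ≤ 2) (C : ClassGroup (𝓞 K)) :
    Summable fun I : {I : Idl K // ClassGroup.mk0 I = C} => nt s (I : Idl K) := by
  obtain ⟨J, hJ⟩ := ClassGroup.mk0_surjective C⁻¹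
  have := (hasSum_class' J s hs1 hs2).summable
  rwa [hJ, inv_inv] at this

lemma summable_nt (s : ℝ) (hs1 : 1 < s) (hs2 : s ≤ 2) : Summable fun I : Idl K => nt s I := by
  rw [← (Equiv.sigmaFiberEquiv (fun I : Idl K => ClassGroup.mk0 I)).summable_iff]
  refine (summable_sigma_of_nonneg (fun p => (nt_pos s _).le)).mpr ?_
  exact ⟨fun C => summable_Zc s hs1 hs2 C, Summable.of_finite⟩

/-- zeta function as sum over nonzero ideals -/
def Zt (K : Type*) [Field K] [NumberField K] (s : ℝ) : ℝ := ∑' I : Idl K, nt s I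

lemma tsum_chi (s : ℝ) (hs1 : 1 < s) (hs2 : s ≤ 2) (χ : ClassGroup (𝓞 K) →* ℤˣ) : 
    Summable (fun I : Idl K => ((χ (ClassGroup.mk0 I) : ℤ) : ℝ) * nt s I) ∧ 
    ∑' I : Idl K, ((χ (ClassGroup.mk0 I) : ℤ) : ℝ) * nt s I = ∑ C, ((χ C : ℤ) : ℝ) * Zc s C := by
  have hs : Summable (fun I : Idl K => ((χ (ClassGroup.mk0 I) : ℤ) : ℝ) * nt s I) := by
    refine Summable.of_norm_bounded (summable_nt s hs1 hs2) (fun I => ?_)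
    rw [norm_mul, Real.norm_of_nonneg (nt_pos s I).le]
    rcases Int.units_eq_one_or (χ (ClassGroup.mk0 I)) with h | h <;> rw [h] <;> simp
  refine ⟨hs, ?_⟩
  have e := (Equiv.sigmaFiberEquiv (fun I : Idl K => ClassGroup.mk0 I))
  have hs2 : Summable (fun p : (Σ C, {I : Idl K // ClassGroup.mk0 I = C}) => ((χ (ClassGroup.mk0 (p.2 : Idl K)) : ℤ) : ℝ) * nt s (p.2 : Idl K)) := 
   (Equiv.sigmaFiberEquiv (fun I : Idl K => ClassGroup.mk0 I)).summable_iff.mpr hs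
  have h1 : ∑' p : (Σ C, {I : Idl K // ClassGroup.mk0 I = C}), ((χ (ClassGroup.mk0 (p.2 : Idl K)) : ℤ) : ℝ) * nt s (p.2 : Idl K) = ∑' I : Idl K, ((χ (ClassGroup.mk0 I) : ℤ) : ℝ) * nt s I :=
   (Equiv.sigmaFiberEquiv (fun I : Idl K => ClassGroup.mk0 I)).tsum_eq (fun I => ((χ (ClassGroup.mk0 I) : ℤ) : ℝ) * nt s I)
  rw [← h1, hs2.tsum_sigma, tsum_fintype]
  refine Finset.sum_congr rfl fun C _ => ?_
  rw [Zc, ← tsum_mul_left]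
  exact tsum_congr fun I => by rw [I.2]

lemma Zc_le (s : ℝ) (hs1 : 1 < s) (hs2 : s ≤ 2) (C : ClassGroup (𝓞 K)) : Zc s C ≤ Zt K s :=
  (summable_nt s hs1 hs2).tsum_subtype_le _ {I | ClassGroup.mk0 I = C} (fun I => (nt_pos s I).le)

end
end HL

namespace HL
open NumberField NumberField.mixedEmbedding NumberField.Units NumberField.InfinitePlace Module
open scoped nonZeroDivisors Topology

noncomputable section
open scoped Classical
set_option linter.unusedSectionVars false
variable {K : Type*} [Field K] [NumberField K]

lemma Zt_eq (s : ℝ) (hs1 : 1 < s) (hs2 : s ≤ 2) : ((Zt K s : ℝ) : ℂ) = dedekindZeta K s := by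
  have hs := summable_nt (K := K) s hs1 hs2
  set e := Equiv.sigmaFiberEquiv (fun I : Idl K => Ideal.absNorm (I : Ideal (𝓞 K))) with he
  have hsg : Summable (fun p : (Σ n, {I : Idl K // Ideal.absNorm (I : Ideal (𝓞 K)) = n}) => nt s (p.2 : Idl K)) :=
    e.summable_iff.mpr hs
  have h1 : ∑' p : (Σ n, {I : Idl K // Ideal.absNorm (I : Ideal (𝓞 K)) = n}), nt s (p.2 : Idl K) = Zt K s :=
    e.tsum_eq (fun I : Idl K => nt s I)
  rw [← h1, hsg.tsum_sigma, dedekindZeta, LSeries, Complex.ofReal_tsum]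
  refine tsum_congr fun n => ?_
  have h2 : ∑' I : {I : Idl K // Ideal.absNorm (I : Ideal (𝓞 K)) = n}, nt s (I : Idl K) =
      Nat.card {I : Idl K // Ideal.absNorm (I : Ideal (𝓞 K)) = n} * (n : ℝ) ^ (-s) := by
    rw [tsum_congr (g := fun _ => (n : ℝ) ^ (-s)) (fun I => by rw [nt, I.2]), tsum_const, nsmul_eq_mul]
  rw [h2]
  rcases Nat.eq_zero_or_pos n with h0 | h0
  · subst h0
    have : IsEmpty {I : Idl K // Ideal.absNorm (I : Ideal (𝓞 K)) = 0} :=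
      ⟨fun I => (absNorm_pos (I : Idl K)).ne' I.2⟩
    rw [LSeries.term_zero]; simp
  · rw [LSeries.term_of_ne_zero h0.ne']
    have hc : Nat.card {I : Idl K // Ideal.absNorm (I : Ideal (𝓞 K)) = n} =
        Nat.card {I : Ideal (𝓞 K) // Ideal.absNorm I = n} := by
      refine Nat.card_congr ⟨fun I => ⟨I.1.1, I.2⟩, fun I => ⟨⟨I.1, ?_⟩, I.2⟩, fun I => rfl, fun I => rfl⟩
      rw [mem_nonZeroDivisors_iff_ne_zero]
      intro h
      have h3 := I.2
      rw [h, Ideal.zero_eq_bot, Ideal.absNorm_bot] at h3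
      omega
    rw [hc, Complex.ofReal_mul, Complex.ofReal_cpow (by positivity)]
    push_cast
    rw [Complex.cpow_neg, div_eq_mul_inv]

lemma near_one : ∀ᶠ s : ℝ in 𝓝[>] 1, 1 < s ∧ s ≤ 2 := by
  have h1 : ∀ᶠ s : ℝ in 𝓝[>] 1, s ∈ Set.Ioo (1 : ℝ) 2 := Ioo_mem_nhdsGT (by norm_num)
  filter_upwards [h1] with s hs using ⟨hs.1, hs.2.le⟩

lemma Zt_tendsto : Filter.Tendsto (fun s : ℝ => (s - 1) * Zt K s) (𝓝[>] 1) (𝓝 (dedekindZeta_residue K)) := by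
  have h := (Complex.continuous_re.tendsto _).comp (tendsto_sub_one_mul_dedekindZeta_nhdsGT K)
  rw [Complex.ofReal_re] at h
  refine h.congr' ?_
  filter_upwards [near_one] with s hs
  rw [Function.comp_apply, ← Zt_eq s hs.1 hs.2]
  norm_cast

lemma Zt_bd : ∃ D : ℝ, 0 ≤ D ∧ ∀ᶠ s : ℝ in 𝓝[>] 1, (s - 1) * Zt K s ≤ D := by
  refine ⟨dedekindZeta_residue K + 1, by linarith [dedekindZeta_residue_pos K], ?_⟩
  filter_upwards [(Zt_tendsto (K := K)).eventually (gt_mem_nhds (lt_add_one _))] with s hs using hs.le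

lemma Zc_nonneg (s : ℝ) (C : ClassGroup (𝓞 K)) : 0 ≤ Zc s C := tsum_nonneg fun _ => (nt_pos s _).le

lemma S_eq (J : Idl K) (s : ℝ) (hs1 : 1 < s) (hs2 : s ≤ 2) :
    ∑' y : (J : Ideal (𝓞 K)), fs s (em (y : 𝓞 K)) = torsionOrder K * (nt s J * Zc s (ClassGroup.mk0 J)⁻¹) := by
  rw [Zc, (hasSum_class' J s hs1 hs2).tsum_eq]
  have := (nt_pos s J).ne'
  have := (tors_pos (K := K)).ne'
  field_simp

lemma S_top (s : ℝ) (hs1 : 1 < s) (hs2 : s ≤ 2) :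
    ∑' y : 𝓞 K, fs s (em y) = torsionOrder K * Zc s (1 : ClassGroup (𝓞 K)) := by
  have h := S_eq (1 : Idl K) s hs1 hs2
  have h1 : nt s (1 : Idl K) = 1 := by rw [nt]; simp
  rw [map_one, inv_one, h1, one_mul] at h
  rw [← h]
  have h2 : ∀ y : 𝓞 K, y ∈ ((1 : Idl K) : Ideal (𝓞 K)) := fun y => by simp
  exact (Equiv.tsum_eq (Equiv.subtypeUnivEquiv h2) (fun y : 𝓞 K => fs s (em y))).symm

lemma Zc_diff (C : ClassGroup (𝓞 K)) : ∃ B : ℝ, ∀ᶠ s : ℝ in 𝓝[>] 1, |Zc s C - Zc s (1 : ClassGroup (𝓞 K))| ≤ B := by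
  obtain ⟨J, hJ⟩ := ClassGroup.mk0_surjective C⁻¹
  obtain ⟨B, hB⟩ := coset_sum (J : Ideal (𝓞 K)) (idl_ne J)
  obtain ⟨D, hD0, hD⟩ := Zt_bd (K := K)
  set n : ℝ := (Ideal.absNorm (J : Ideal (𝓞 K)) : ℝ) with hn
  have hn1 : 1 ≤ n := by rw [hn]; exact_mod_cast absNorm_pos J
  refine ⟨B / torsionOrder K + Real.log n * D, ?_⟩
  filter_upwards [near_one, hD] with s hs hDs
  have h := hB s hs.1 hs.2
  rw [S_top s hs.1 hs.2, S_eq J s hs.1 hs.2, hJ, inv_inv] at h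
  have h1 : n * nt s J = n ^ (1 - s) := by
    rw [nt, ← hn, sub_eq_add_neg, Real.rpow_add (by linarith), Real.rpow_one]
  have ht := tors_pos (K := K)
  have h2 : |Zc s (1 : ClassGroup (𝓞 K)) - n ^ (1 - s) * Zc s C| ≤ B / torsionOrder K := by
    rw [le_div_iff₀ ht, ← abs_of_pos ht, ← abs_mul]
    refine le_trans (le_of_eq ?_) h
    congr 1
    rw [← h1]; ring
  have h3 : |Zc s C - n ^ (1 - s) * Zc s C| ≤ Real.log n * D := by
    have e1 : n ^ (1 - s) ≤ 1 := Real.rpow_le_one_of_one_le_of_nonpos hn1 (by linarith [hs.1])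
    have e2 : 1 - n ^ (1 - s) ≤ (s - 1) * Real.log n := by
      rw [Real.rpow_def_of_pos (by linarith)]
      have := Real.add_one_le_exp (Real.log n * (1 - s))
      linarith
    have e3 := Zc_nonneg s C
    have e4 := Zc_le s hs.1 hs.2 C
    have e5 := Real.log_nonneg hn1
    have e6 : 0 ≤ s - 1 := by linarith [hs.1]
    rw [abs_of_nonneg (by nlinarith)]
    calc Zc s C - n ^ (1 - s) * Zc s C = (1 - n ^ (1 - s)) * Zc s C := by ring
      _ ≤ ((s - 1) * Real.log n) * Zt K s := mul_le_mul e2 e4 e3 (by positivity)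
      _ = Real.log n * ((s - 1) * Zt K s) := by ring
      _ ≤ _ := by gcongr
  calc |Zc s C - Zc s (1 : ClassGroup (𝓞 K))| = |(Zc s C - n ^ (1 - s) * Zc s C) - (Zc s (1 : ClassGroup (𝓞 K)) - n ^ (1 - s) * Zc s C)| := by ring_nf
    _ ≤ _ := (abs_sub _ _).trans (by linarith)

/-- the L-function of a quadratic class group character -/
def Lc (χ : ClassGroup (𝓞 K) →* ℤˣ) (s : ℝ) : ℝ := ∑' I : Idl K, ((χ (ClassGroup.mk0 I) : ℤ) : ℝ) * nt s I

lemma sum_chi (χ : ClassGroup (𝓞 K) →* ℤˣ) (hχ : χ ≠ 1) : ∑ C, ((χ C : ℤ) : ℝ) = 0 := by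
  obtain ⟨c, hc⟩ : ∃ c, χ c ≠ 1 := by
    by_contra h; push Not at h; exact hχ (MonoidHom.ext h)
  have hc2 : χ c = -1 := (Int.units_eq_one_or _).resolve_left hc
  have h := Fintype.sum_equiv (Equiv.mulLeft c) (fun C => ((χ (c * C) : ℤ) : ℝ)) (fun C => ((χ C : ℤ) : ℝ)) (fun C => rfl)
  have h2 : ∑ C, ((χ (c * C) : ℤ) : ℝ) = - ∑ C, ((χ C : ℤ) : ℝ) := by
    rw [← Finset.sum_neg_distrib]
    refine Finset.sum_congr rfl fun C _ => ?_
    rw [map_mul, hc2]; simp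
  linarith

theorem Lc_bd (χ : ClassGroup (𝓞 K) →* ℤˣ) (hχ : χ ≠ 1) : ∃ B : ℝ, ∀ᶠ s : ℝ in 𝓝[>] 1, |Lc χ s| ≤ B := by
  choose B hB using Zc_diff (K := K)
  refine ⟨∑ C, B C, ?_⟩
  have h : ∀ᶠ s : ℝ in 𝓝[>] 1, ∀ C, |Zc s C - Zc s (1 : ClassGroup (𝓞 K))| ≤ B C := Filter.eventually_all.mpr hB
  filter_upwards [near_one, h] with s hs h
  rw [Lc, (tsum_chi s hs.1 hs.2 χ).2]
  have : ∑ C, ((χ C : ℤ) : ℝ) * Zc s C = ∑ C, ((χ C : ℤ) : ℝ) * (Zc s C - Zc s (1 : ClassGroup (𝓞 K))) := by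
    simp_rw [mul_sub]
    rw [Finset.sum_sub_distrib, ← Finset.sum_mul, sum_chi χ hχ, zero_mul, sub_zero]
  rw [this]
  refine (Finset.abs_sum_le_sum_abs _ _).trans (Finset.sum_le_sum fun C _ => ?_)
  rw [abs_mul]
  have h1 : |((χ C : ℤ) : ℝ)| = 1 := by
    rcases Int.units_eq_one_or (χ C) with h | h <;> rw [h] <;> simp
  rw [h1, one_mul]; exact h C

end
end HL

namespace HL
open NumberField Module IsDedekindDomain
open scoped nonZeroDivisors Topology

noncomputable section
open scoped Classical
set_option linter.unusedSectionVars false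
variable {R : Type*} [CommRing R] [IsDedekindDomain R]

/-- a prime as nonzero ideal -/
def pI (P : HeightOneSpectrum R) : (Ideal R)⁰ := ⟨P.asIdeal, mem_nonZeroDivisors_iff_ne_zero.mpr P.ne_bot⟩

lemma pI_val (P : HeightOneSpectrum R) : ((pI P : (Ideal R)⁰) : Ideal R) = P.asIdeal := rfl

/-- ideals coprime to T -/
def cop (T : Finset (HeightOneSpectrum R)) (I : (Ideal R)⁰) : Prop := ∀ P ∈ T, ¬ P.asIdeal ∣ (I : Ideal R)

lemma exists_prime_dvd (I : (Ideal R)⁰) (hI : I ≠ 1) : ∃ P : HeightOneSpectrum R, P.asIdeal ∣ (I : Ideal R) := by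
  have h1 : (I : Ideal R) ≠ ⊤ := fun h => hI (Subtype.ext (by rw [h]; simp))
  obtain ⟨m, hm, hle⟩ := Ideal.exists_le_maximal _ h1
  have hm0 : m ≠ ⊥ := by
    rintro rfl
    exact mem_nonZeroDivisors_iff_ne_zero.mp I.2 (le_bot_iff.mp hle)
  exact ⟨⟨m, hm.isPrime, hm0⟩, Ideal.dvd_iff_le.mpr hle⟩

lemma cop_mul (T : Finset (HeightOneSpectrum R)) (P : HeightOneSpectrum R) (hP : P ∉ T) (I : (Ideal R)⁰) :
    cop T (pI P * I) ↔ cop T I := by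
  refine forall₂_congr fun Q hQ => ?_
  rw [Submonoid.coe_mul, Q.prime.dvd_mul]
  have : ¬ Q.asIdeal ∣ ((pI P : (Ideal R)⁰) : Ideal R) := by
    intro h
    rw [pI_val, Ideal.dvd_iff_le] at h
    apply hP
    have := (P.isMaximal).eq_of_le Q.isMaximal.ne_top h
    rwa [HeightOneSpectrum.ext this]
  tauto

/-- partial sum -/
def cS (f : (Ideal R)⁰ →* ℝ) (T : Finset (HeightOneSpectrum R)) : ℝ := ∑' I, if cop T I then f I else 0

lemma cS_insert (f : (Ideal R)⁰ →* ℝ) (hf : Summable fun I => f I) (T : Finset (HeightOneSpectrum R))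
    (P : HeightOneSpectrum R) (hP : P ∉ T) : cS f (insert P T) = (1 - f (pI P)) * cS f T := by
  have hsum : ∀ p : (Ideal R)⁰ → Prop, Summable (fun I => if p I then f I else 0) := fun p =>
    Summable.of_norm_bounded hf.norm (fun I => by split_ifs <;> simp)
  have h1 : cS f T - cS f (insert P T) = ∑' I, if (cop T I ∧ P.asIdeal ∣ (I : Ideal R)) then f I else 0 := by
    rw [cS, cS, ← (hsum _).tsum_sub (hsum _)]
    refine tsum_congr fun I => ?_
    have : cop (insert P T) I ↔ (¬ P.asIdeal ∣ (I : Ideal R)) ∧ cop T I := by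
      simp [cop]
    by_cases h1 : cop T I <;> by_cases h2 : P.asIdeal ∣ (I : Ideal R) <;> simp [this, h1, h2]
  have hinj : Function.Injective (fun I : (Ideal R)⁰ => pI P * I) := by
    intro I I' h
    have h := congrArg Subtype.val h
    exact Subtype.ext (mul_left_cancel₀ P.ne_bot h)
  have h2 : ∑' I, (if (cop T I ∧ P.asIdeal ∣ (I : Ideal R)) then f I else 0) = f (pI P) * cS f T := by
    rw [← hinj.tsum_eq, cS, ← tsum_mul_left]
    · refine tsum_congr fun I => ?_
      have hd : P.asIdeal ∣ ((pI P * I : (Ideal R)⁰) : Ideal R) := ⟨I, rfl⟩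
      rw [cop_mul T P hP, map_mul]
      by_cases h1 : cop T I
      · rw [if_pos ⟨h1, hd⟩, if_pos h1]
      · rw [if_neg (fun h => h1 h.1), if_neg h1, mul_zero]
    · intro I hI
      rw [Function.mem_support] at hI
      have hd : P.asIdeal ∣ (I : Ideal R) := by
        by_contra h; apply hI; simp [h]
      obtain ⟨J, hJ⟩ := hd
      refine ⟨⟨J, mem_nonZeroDivisors_iff_ne_zero.mpr ?_⟩, Subtype.ext hJ.symm⟩
      rintro rfl
      rw [mul_zero] at hJ
      exact mem_nonZeroDivisors_iff_ne_zero.mp I.2 hJ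
  linarith

lemma cS_eq (f : (Ideal R)⁰ →* ℝ) (hf : Summable fun I => f I) (T : Finset (HeightOneSpectrum R)) :
    cS f T = (∏ P ∈ T, (1 - f (pI P))) * ∑' I, f I := by
  induction T using Finset.induction_on with
  | empty => rw [Finset.prod_empty, one_mul]; exact tsum_congr fun I => by simp [cop]
  | insert P T hP ih => rw [cS_insert f hf T P hP, ih, Finset.prod_insert hP, mul_assoc]

theorem euler (f : (Ideal R)⁰ →* ℝ) (hf : Summable fun I => f I) :
    Filter.Tendsto (fun T : Finset (HeightOneSpectrum R) => (∏ P ∈ T, (1 - f (pI P))) * ∑' I, f I) Filter.atTop (𝓝 1) := by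
  have h1 : ∑' I : (Ideal R)⁰, (if I = 1 then f I else 0) = 1 := by
    rw [tsum_ite_eq, map_one]
  refine Filter.Tendsto.congr (fun T => cS_eq f hf T) ?_
  refine h1 ▸ (?_ : Filter.Tendsto (fun T => cS f T) Filter.atTop (𝓝 (∑' I : (Ideal R)⁰, (if I = 1 then f I else 0))))
  refine tendsto_tsum_of_dominated_convergence hf.norm (fun I => ?_) ?_
  · by_cases hI : I = 1
    · subst hI
      refine tendsto_const_nhds.congr fun T => ?_
      have : cop T (1 : (Ideal R)⁰) := by
        intro P _ hd
        rw [Ideal.dvd_iff_le] at hd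
        exact P.isMaximal.ne_top (top_le_iff.mp (by simpa using hd))
      simp [this]
    · obtain ⟨P, hP⟩ := exists_prime_dvd I hI
      rw [if_neg hI]
      refine tendsto_const_nhds.congr' ?_
      filter_upwards [Filter.eventually_ge_atTop {P}] with T hT
      have : ¬ cop T I := fun h => h P (hT (Finset.mem_singleton_self P)) hP
      rw [if_neg this]
  · exact Filter.Eventually.of_forall fun T I => by split_ifs <;> simp

end
end HL

namespace HL
open NumberField Module IsDedekindDomain
open scoped nonZeroDivisors Topology

noncomputable section
open scoped Classical
set_option linter.unusedSectionVars false

variable {K : Type*} [Field K] [NumberField K]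

/-- multiplicative function attached to a character -/
def chiF (χ : ClassGroup (𝓞 K) →* ℤˣ) (s : ℝ) : (Ideal (𝓞 K))⁰ →* ℝ where
  toFun I := ((χ (ClassGroup.mk0 I) : ℤ) : ℝ) * nt s I
  map_one' := by simp [nt]
  map_mul' I J := by
    have : nt s (I * J) = nt s I * nt s J := by
      rw [nt, nt, nt, Submonoid.coe_mul, map_mul, Nat.cast_mul, Real.mul_rpow (by positivity) (by positivity)]
    rw [this, map_mul, map_mul]; push_cast; ring

lemma chiF_apply (χ : ClassGroup (𝓞 K) →* ℤˣ) (s : ℝ) (I : (Ideal (𝓞 K))⁰) :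
    chiF χ s I = ((χ (ClassGroup.mk0 I) : ℤ) : ℝ) * nt s I := rfl

lemma Lc_one (s : ℝ) : Lc (1 : ClassGroup (𝓞 K) →* ℤˣ) s = Zt K s := by
  simp [Lc, Zt]

lemma chiF_sum (χ : ClassGroup (𝓞 K) →* ℤˣ) (s : ℝ) : ∑' I, chiF χ s I = Lc χ s := rfl

lemma euler_chi (χ : ClassGroup (𝓞 K) →* ℤˣ) (s : ℝ) (hs1 : 1 < s) (hs2 : s ≤ 2) :
    Filter.Tendsto (fun T : Finset (HeightOneSpectrum (𝓞 K)) => (∏ P ∈ T, (1 - ((χ (ClassGroup.mk0 (pI P)) : ℤ) : ℝ) * nt s (pI P))) * Lc χ s)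
      Filter.atTop (𝓝 1) := euler (chiF χ s) (tsum_chi s hs1 hs2 χ).1

lemma nt_lt_one (s : ℝ) (hs1 : 1 < s) (P : HeightOneSpectrum (𝓞 K)) : nt s (pI P) < 1 := by
  rw [nt]
  refine Real.rpow_lt_one_of_one_lt_of_neg ?_ (by linarith)
  have h1 := absNorm_pos (pI P)
  have h2 : Ideal.absNorm ((pI P : (Ideal (𝓞 K))⁰) : Ideal (𝓞 K)) ≠ 1 := by
    rw [ne_eq, Ideal.absNorm_eq_one_iff]; exact P.isMaximal.ne_top
  exact_mod_cast (by omega : 1 < Ideal.absNorm ((pI P : (Ideal (𝓞 K))⁰) : Ideal (𝓞 K)))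

lemma local_ineq (x a b : ℝ) (hx0 : 0 < x) (hx1 : x < 1) (ha : a = 1 ∨ a = -1) (hb : b = 1 ∨ b = -1) :
    (1 - 1 * x) * (1 - a * x) * (1 - b * x) * (1 - a * b * x) ≤ (1 - x ^ 2) ^ 2 := by
  have key : (1 - x) * (1 - x) * ((1 - x) * (1 - x)) ≤ (1 - x ^ 2) ^ 2 := by
    have e : (1 - x ^ 2) ^ 2 = (1 - x) * (1 - x) * ((1 + x) * (1 + x)) := by ring
    rw [e]
    have : 0 ≤ 1 - x := by linarith
    gcongr <;> linarith
  rcases ha with rfl | rfl <;> rcases hb with rfl | rfl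
  · refine le_trans (le_of_eq ?_) key; ring
  · apply le_of_eq; ring
  · apply le_of_eq; ring
  · apply le_of_eq; ring

variable {E M : Type*} [Field E] [NumberField E] [Field M] [NumberField M]

/-- splitting behaviour hypothesis -/
def SplitHyp (u : HeightOneSpectrum (𝓞 M) → HeightOneSpectrum (𝓞 E)) (χ₁ χ₂ : ClassGroup (𝓞 E) →* ℤˣ) : Prop :=
  ∀ p, (χ₁ (ClassGroup.mk0 (pI p)) = 1 ∧ χ₂ (ClassGroup.mk0 (pI p)) = 1 ∧
    ∃ P P', P ≠ P' ∧ (∀ Q, u Q = p ↔ Q = P ∨ Q = P') ∧ Ideal.absNorm P.asIdeal = Ideal.absNorm p.asIdeal ∧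
      Ideal.absNorm P'.asIdeal = Ideal.absNorm p.asIdeal) ∨
    (∃ P, (∀ Q, u Q = p ↔ Q = P) ∧ Ideal.absNorm P.asIdeal = Ideal.absNorm p.asIdeal ^ 2)

lemma zeta_ineq (u : HeightOneSpectrum (𝓞 M) → HeightOneSpectrum (𝓞 E)) (χ₁ χ₂ : ClassGroup (𝓞 E) →* ℤˣ)
    (H : SplitHyp u χ₁ χ₂) (s : ℝ) (hs1 : 1 < s) (hs2 : s ≤ 2) :
    Zt M s ^ 2 ≤ Zt E s * Lc χ₁ s * Lc χ₂ s * Lc (χ₁ * χ₂) s := by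
  have hfin : ∀ p, {Q | u Q = p}.Finite := by
    intro p
    rcases H p with ⟨_, _, P, P', _, h, _⟩ | ⟨P, h, _⟩
    · exact (Set.toFinite {P, P'}).subset fun Q hQ => by simpa using (h Q).mp hQ
    · exact (Set.toFinite {P}).subset fun Q hQ => by simpa using (h Q).mp hQ
  set fib : HeightOneSpectrum (𝓞 E) → Finset (HeightOneSpectrum (𝓞 M)) := fun p => (hfin p).toFinset with hfib
  have hmem : ∀ p Q, Q ∈ fib p ↔ u Q = p := fun p Q => by simp [hfib]
  set T' : Finset (HeightOneSpectrum (𝓞 E)) → Finset (HeightOneSpectrum (𝓞 M)) := fun T => T.biUnion fib with hT'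
  have hT'mem : ∀ T Q, Q ∈ T' T ↔ u Q ∈ T := fun T Q => by simp [hT', hmem]
  have htend : Filter.Tendsto T' Filter.atTop Filter.atTop := by
    refine Filter.tendsto_atTop_finset_of_monotone ?_ ?_
    · intro S T hST Q hQ
      rw [hT'mem] at hQ ⊢; exact hST hQ
    · intro Q
      exact ⟨{u Q}, by rw [hT'mem]; simp⟩
  have hM := (euler_chi (1 : ClassGroup (𝓞 M) →* ℤˣ) s hs1 hs2).comp htend
  have h0 := euler_chi (1 : ClassGroup (𝓞 E) →* ℤˣ) s hs1 hs2
  have h1 := euler_chi χ₁ s hs1 hs2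
  have h2 := euler_chi χ₂ s hs1 hs2
  have h3 := euler_chi (χ₁ * χ₂) s hs1 hs2
  rw [Lc_one] at hM h0
  have hA := hM.pow 2
  have hB := ((h0.mul h1).mul h2).mul h3
  rw [one_pow] at hA
  rw [mul_one, mul_one, mul_one] at hB
  have hsgn : ∀ (χ : ClassGroup (𝓞 E) →* ℤˣ) C, ((χ C : ℤ) : ℝ) = 1 ∨ ((χ C : ℤ) : ℝ) = -1 := by
    intro χ C
    rcases Int.units_eq_one_or (χ C) with h | h <;> rw [h] <;> simp
  have hloc : ∀ p : HeightOneSpectrum (𝓞 E), (1 - (((1 : ClassGroup (𝓞 E) →* ℤˣ) (ClassGroup.mk0 (pI p)) : ℤ) : ℝ) * nt s (pI p)) *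
      (1 - ((χ₁ (ClassGroup.mk0 (pI p)) : ℤ) : ℝ) * nt s (pI p)) * (1 - ((χ₂ (ClassGroup.mk0 (pI p)) : ℤ) : ℝ) * nt s (pI p)) *
      (1 - (((χ₁ * χ₂) (ClassGroup.mk0 (pI p)) : ℤ) : ℝ) * nt s (pI p)) ≤
      (∏ Q ∈ fib p, (1 - (((1 : ClassGroup (𝓞 M) →* ℤˣ) (ClassGroup.mk0 (pI Q)) : ℤ) : ℝ) * nt s (pI Q))) ^ 2 := by
    intro p
    have hx0 := nt_pos s (pI p)
    have hx1 := nt_lt_one s hs1 p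
    rw [MonoidHom.mul_apply, Units.val_mul, Int.cast_mul, MonoidHom.one_apply, Units.val_one, Int.cast_one]
    rcases H p with ⟨c1, c2, P, P', hne, h, n1, n2⟩ | ⟨P, h, n1⟩
    · have hf : fib p = {P, P'} := by ext Q; rw [hmem, h]; simp
      have e1 : nt s (pI P) = nt s (pI p) := by rw [nt, nt, pI_val, pI_val, n1]
      have e2 : nt s (pI P') = nt s (pI p) := by rw [nt, nt, pI_val, pI_val, n2]
      rw [hf, Finset.prod_pair hne, e1, e2, c1, c2]
      apply le_of_eq; simp; ring
    · have hf : fib p = {P} := by ext Q; rw [hmem, h]; simp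
      have e1 : nt s (pI P) = nt s (pI p) ^ 2 := by
        rw [nt, nt, pI_val, pI_val, n1, Nat.cast_pow, ← Real.rpow_natCast, ← Real.rpow_natCast,
          ← Real.rpow_mul (by positivity), ← Real.rpow_mul (by positivity), mul_comm]
      rw [hf, Finset.prod_singleton, e1]
      refine (local_ineq _ _ _ hx0 hx1 (hsgn χ₁ _) (hsgn χ₂ _)).trans (le_of_eq ?_)
      simp
  have hlocpos : ∀ p : HeightOneSpectrum (𝓞 E), ∀ χ : ClassGroup (𝓞 E) →* ℤˣ, 0 < (1 - ((χ (ClassGroup.mk0 (pI p)) : ℤ) : ℝ) * nt s (pI p)) := by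
    intro p χ
    have hx0 := nt_pos s (pI p)
    have hx1 := nt_lt_one s hs1 p
    rcases hsgn χ (ClassGroup.mk0 (pI p)) with h | h <;> rw [h] <;> linarith
  set A := Zt M s ^ 2 with hAdef
  set B := Zt E s * Lc χ₁ s * Lc χ₂ s * Lc (χ₁ * χ₂) s with hBdef
  set r : Finset (HeightOneSpectrum (𝓞 E)) → ℝ := fun T => ∏ p ∈ T, ((1 - (((1 : ClassGroup (𝓞 E) →* ℤˣ) (ClassGroup.mk0 (pI p)) : ℤ) : ℝ) * nt s (pI p)) *
      (1 - ((χ₁ (ClassGroup.mk0 (pI p)) : ℤ) : ℝ) * nt s (pI p)) * (1 - ((χ₂ (ClassGroup.mk0 (pI p)) : ℤ) : ℝ) * nt s (pI p)) *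
      (1 - (((χ₁ * χ₂) (ClassGroup.mk0 (pI p)) : ℤ) : ℝ) * nt s (pI p))) with hr
  set q : Finset (HeightOneSpectrum (𝓞 E)) → ℝ := fun T => (∏ Q ∈ T' T, (1 - (((1 : ClassGroup (𝓞 M) →* ℤˣ) (ClassGroup.mk0 (pI Q)) : ℤ) : ℝ) * nt s (pI Q))) ^ 2 with hq
  have hA' : Filter.Tendsto (fun T => q T * A) Filter.atTop (𝓝 1) := by
    refine hA.congr fun T => ?_
    rw [hq, hAdef, Function.comp_apply, mul_pow]
  have hB' : Filter.Tendsto (fun T => r T * B) Filter.atTop (𝓝 1) := by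
    refine hB.congr fun T => ?_
    rw [hr, hBdef]; simp only [Finset.prod_mul_distrib]; ring
  have hrpos : ∀ T, 0 < r T := fun T => Finset.prod_pos fun p _ =>
    mul_pos (mul_pos (mul_pos (hlocpos p _) (hlocpos p _)) (hlocpos p _)) (hlocpos p _)
  have hrq : ∀ T, r T ≤ q T := by
    intro T
    have hdisj : q T = ∏ p ∈ T, (∏ Q ∈ fib p, (1 - (((1 : ClassGroup (𝓞 M) →* ℤˣ) (ClassGroup.mk0 (pI Q)) : ℤ) : ℝ) * nt s (pI Q))) ^ 2 := by
      rw [hq, Finset.prod_pow]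
      simp only
      congr 1
      rw [hT']
      refine Finset.prod_biUnion ?_
      intro p _ p' _ hpp
      rw [Function.onFun, Finset.disjoint_left]
      intro Q h h'
      rw [hmem] at h h'
      exact hpp (h.symm.trans h')
    rw [hdisj]
    exact Finset.prod_le_prod (fun p _ => (mul_pos (mul_pos (mul_pos (hlocpos p _) (hlocpos p _)) (hlocpos p _)) (hlocpos p _)).le) (fun p _ => hloc p)
  have hA0 : 0 ≤ A := by positivity
  by_contra hlt
  push Not at hlt
  -- B < A
  have hApos : 0 < A := by
    rcases hA0.lt_or_eq with h | h
    · exact h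
    · rw [← h] at hA'
      simp only [mul_zero] at hA'
      exact absurd (tendsto_nhds_unique tendsto_const_nhds hA') (by norm_num)
  have hqlim : Filter.Tendsto q Filter.atTop (𝓝 (1 / A)) := by
    have := hA'.div_const A
    refine this.congr fun T => ?_
    field_simp
  have hqbd : ∀ᶠ T in Filter.atTop, r T * B ≤ r T * A - r T * (A - B) := Filter.Eventually.of_forall fun T => by ring_nf; rfl
  have hB0 : B ≠ 0 := by
    intro h
    rw [h] at hB'
    simp only [mul_zero] at hB'
    exact absurd (tendsto_nhds_unique tendsto_const_nhds hB') (by norm_num)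
  have hrlim : Filter.Tendsto r Filter.atTop (𝓝 (1 / B)) := by
    have := hB'.div_const B
    refine this.congr fun T => ?_
    field_simp
  have hb1 : 0 ≤ 1 / B := ge_of_tendsto' hrlim fun T => (hrpos T).le
  have hBpos : 0 < B := lt_of_le_of_ne (by simpa using hb1) hB0.symm
  have := le_of_tendsto_of_tendsto' hrlim hqlim hrq
  rw [one_div_le_one_div hBpos hApos] at this
  linarith

theorem no_two_chars (u : HeightOneSpectrum (𝓞 M) → HeightOneSpectrum (𝓞 E)) (χ₁ χ₂ : ClassGroup (𝓞 E) →* ℤˣ)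
    (H : SplitHyp u χ₁ χ₂) (h1 : χ₁ ≠ 1) (h2 : χ₂ ≠ 1) (h12 : χ₁ * χ₂ ≠ 1) : False := by
  obtain ⟨B1, hB1⟩ := Lc_bd χ₁ h1
  obtain ⟨B2, hB2⟩ := Lc_bd χ₂ h2
  obtain ⟨B3, hB3⟩ := Lc_bd _ h12
  have hl : Filter.Tendsto (fun s : ℝ => ((s - 1) * Zt M s) ^ 2) (𝓝[>] 1) (𝓝 (dedekindZeta_residue M ^ 2)) := Zt_tendsto.pow 2
  have hlin : Filter.Tendsto (fun s : ℝ => s - 1) (𝓝[>] 1) (𝓝 0) := by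
    have : Filter.Tendsto (fun s : ℝ => s - 1) (𝓝 1) (𝓝 (1 - 1)) := (continuous_id.sub continuous_const).tendsto 1
    rw [sub_self] at this
    exact this.mono_left nhdsWithin_le_nhds
  have hr : Filter.Tendsto (fun s : ℝ => (s - 1) * ((s - 1) * Zt E s) * (B1 * B2 * B3)) (𝓝[>] 1) (𝓝 (0 * dedekindZeta_residue E * (B1 * B2 * B3))) :=
    (hlin.mul Zt_tendsto).mul_const _
  rw [zero_mul, zero_mul] at hr
  have hle : dedekindZeta_residue M ^ 2 ≤ 0 := by
    refine le_of_tendsto_of_tendsto hl hr ?_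
    filter_upwards [near_one, hB1, hB2, hB3] with s hs b1 b2 b3
    have hz := zeta_ineq u χ₁ χ₂ H s hs.1 hs.2
    have hZ : 0 ≤ Zt E s := tsum_nonneg fun _ => (nt_pos s _).le
    have e1 : Lc χ₁ s * Lc χ₂ s * Lc (χ₁ * χ₂) s ≤ B1 * B2 * B3 := by
      refine (le_abs_self _).trans ?_
      rw [abs_mul, abs_mul]
      have a1 := abs_nonneg (Lc χ₁ s)
      have a2 := abs_nonneg (Lc χ₂ s)
      have a3 := abs_nonneg (Lc (χ₁ * χ₂) s)
      have : 0 ≤ B1 := a1.trans b1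
      have : 0 ≤ B2 := a2.trans b2
      gcongr
    calc ((s - 1) * Zt M s) ^ 2 = (s - 1) ^ 2 * Zt M s ^ 2 := by ring
      _ ≤ (s - 1) ^ 2 * (Zt E s * Lc χ₁ s * Lc χ₂ s * Lc (χ₁ * χ₂) s) := by gcongr
      _ = (s - 1) ^ 2 * Zt E s * (Lc χ₁ s * Lc χ₂ s * Lc (χ₁ * χ₂) s) := by ring
      _ ≤ (s - 1) ^ 2 * Zt E s * (B1 * B2 * B3) := by gcongr
      _ = _ := by ring
  have := dedekindZeta_residue_pos M
  nlinarith

end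
end HL

namespace HL
open NumberField Module IsDedekindDomain
open scoped nonZeroDivisors Topology Pointwise

noncomputable section
open scoped Classical
set_option linter.unusedSectionVars false

variable {E M : Type*} [Field E] [NumberField E] [Field M] [NumberField M] [Algebra E M]

theorem gal_smul_coe (τ : M ≃ₐ[E] M) (x : 𝓞 M) : ((τ • x : 𝓞 M) : M) = τ (x : M) := rfl

/-- the action of an automorphism on primes -/
def sgP (τ : M ≃ₐ[E] M) (P : HeightOneSpectrum (𝓞 M)) : HeightOneSpectrum (𝓞 M) where
  asIdeal := τ • P.asIdeal
  isPrime := by have := P.isPrime; infer_instance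
  ne_bot := by
    intro h
    apply P.ne_bot
    have := congrArg (fun I => τ⁻¹ • I) h
    simpa using this

theorem sgP_mul (τ υ : M ≃ₐ[E] M) (P : HeightOneSpectrum (𝓞 M)) : sgP (τ * υ) P = sgP τ (sgP υ P) := by
  ext1; simp [sgP, mul_smul]

theorem sgP_one (P : HeightOneSpectrum (𝓞 M)) : sgP (1 : M ≃ₐ[E] M) P = P := by
  ext1; simp [sgP]

theorem sgP_intval (τ : M ≃ₐ[E] M) (P : HeightOneSpectrum (𝓞 M)) (x : 𝓞 M) :
    (sgP τ P).intValuation (τ • x) = P.intValuation x := by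
  rcases eq_or_ne x 0 with rfl | hx
  · simp
  have hx' : τ • x ≠ 0 := by
    intro h
    apply hx
    have := congrArg (fun I => τ⁻¹ • I) h
    simpa using this
  rw [HeightOneSpectrum.intValuation_eq_exp_neg_multiplicity _ hx,
    HeightOneSpectrum.intValuation_eq_exp_neg_multiplicity _ hx']
  have h1 : Ideal.span {τ • x} = τ • Ideal.span {x} := by
    rw [Ideal.pointwise_smul_def, Ideal.map_span]; simp
  have h2 : multiplicity (sgP τ P).asIdeal (Ideal.span {τ • x}) = multiplicity P.asIdeal (Ideal.span {x}) := by
    rw [h1]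
    have := multiplicity_map_eq (MulDistribMulAction.toMulEquiv (Ideal (𝓞 M)) τ) (a := P.asIdeal) (b := Ideal.span {x})
    exact this
  rw [h2]

theorem sgP_val (τ : M ≃ₐ[E] M) (P : HeightOneSpectrum (𝓞 M)) (x : M) :
    (sgP τ P).valuation M (τ x) = P.valuation M x := by
  obtain ⟨x, y, hy, rfl⟩ := IsFractionRing.div_surjective (A := 𝓞 M) x
  rw [map_div₀, map_div₀, map_div₀]
  have h : ∀ z : 𝓞 M, (sgP τ P).valuation M (τ (algebraMap (𝓞 M) M z)) = P.valuation M (algebraMap (𝓞 M) M z) := by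
    intro z
    have : τ (algebraMap (𝓞 M) M z) = algebraMap (𝓞 M) M (τ • z) := rfl
    rw [this, HeightOneSpectrum.valuation_of_algebraMap, HeightOneSpectrum.valuation_of_algebraMap, sgP_intval]
  rw [h, h]

/-- abbreviation: the prime below -/
def dn (P : HeightOneSpectrum (𝓞 M)) : HeightOneSpectrum (𝓞 E) := HeightOneSpectrum.under (𝓞 E) P

instance (P : HeightOneSpectrum (𝓞 M)) : P.asIdeal.LiesOver (dn (E := E) P).asIdeal := by
  constructor; rfl

theorem dn_iff (P : HeightOneSpectrum (𝓞 M)) (p : HeightOneSpectrum (𝓞 E)) : dn P = p ↔ P.asIdeal.LiesOver p.asIdeal := by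
  constructor
  · rintro rfl; infer_instance
  · intro h; ext1; exact h.over.symm

theorem dn_val (P : HeightOneSpectrum (𝓞 M)) (x : E) :
    P.valuation M (algebraMap E M x) = (dn P : HeightOneSpectrum (𝓞 E)).valuation E x ^ ((dn P : HeightOneSpectrum (𝓞 E)).asIdeal.ramificationIdx' P.asIdeal) :=
  (HeightOneSpectrum.valuation_liesOver M (dn P) P x).symm


def SqAt (p : HeightOneSpectrum (𝓞 E)) (a : E) : Prop :=
  ∃ z : E, z ≠ 0 ∧ p.valuation E (a / z ^ 2 - 1) < p.valuation E 4

def EvAt (p : HeightOneSpectrum (𝓞 E)) (a : E) : Prop :=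
  ∃ t : E, t ≠ 0 ∧ p.valuation E (a * t ^ 2) = 1

def GoodAt (p : HeightOneSpectrum (𝓞 E)) (a : E) : Prop :=
  SqAt p a ∨ (p.valuation E 2 = 1 ∧ EvAt p a)

theorem val_nat_le (p : HeightOneSpectrum (𝓞 E)) (n : ℕ) : p.valuation E (n : E) ≤ 1 := by
  have := p.valuation_le_one (K := E) (n : 𝓞 E)
  simpa using this

theorem val_four_le (p : HeightOneSpectrum (𝓞 E)) : p.valuation E 4 ≤ 1 := by
  simpa using val_nat_le p 4

variable (σ : M ≃ₐ[E] M) (s : M) (a : E) (hs : s ^ 2 = algebraMap E M a) (hσ : σ s = - s)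

include hs hσ in
theorem theta_sq (P : HeightOneSpectrum (𝓞 M)) (h : SqAt (dn P) a) :
    ∃ θ : M, θ + σ θ = 1 ∧ P.valuation M (θ * σ θ) < 1 ∧ P.valuation M (θ - σ θ) = 1 := by
  obtain ⟨z, hz, h⟩ := h
  have he : (dn P : HeightOneSpectrum (𝓞 E)).asIdeal.ramificationIdx' P.asIdeal ≠ 0 :=
    Ideal.IsDedekindDomain.ramificationIdx'_ne_zero_of_liesOver P.asIdeal (dn P).ne_bot
  have hz' : algebraMap E M z ≠ 0 := by simpa using hz
  have h4 : (4 : E) ≠ 0 := by norm_num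
  refine ⟨(1 + s / algebraMap E M z) / 2, ?_, ?_, ?_⟩
  · simp only [map_div₀, map_add, map_one, AlgEquiv.commutes, hσ, map_ofNat]; ring
  · have : (1 + s / algebraMap E M z) / 2 * σ ((1 + s / algebraMap E M z) / 2) = algebraMap E M (-((a / z ^ 2 - 1) / 4)) := by
      simp only [map_div₀, map_add, map_one, AlgEquiv.commutes, hσ, map_ofNat, map_neg, map_sub, map_pow, ← hs]
      field_simp; ring
    rw [this, dn_val]
    apply pow_lt_one₀ (zero_le) _ he
    rw [Valuation.map_neg, map_div₀]
    apply (div_lt_one₀ (zero_lt_iff.2 ((Valuation.ne_zero_iff _).2 h4))).2 h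
  · have : (1 + s / algebraMap E M z) / 2 - σ ((1 + s / algebraMap E M z) / 2) = s / algebraMap E M z := by
      simp only [map_div₀, map_add, map_one, AlgEquiv.commutes, hσ, map_ofNat]; ring
    rw [this]
    have h2 : P.valuation M (s / algebraMap E M z) ^ 2 = 1 := by
      rw [← map_pow, div_pow, hs, ← map_pow, ← map_div₀, dn_val]
      have : (dn P : HeightOneSpectrum (𝓞 E)).valuation E (a / z ^ 2) = 1 := by
        have h3 := h.trans_le (val_four_le _)
        have := Valuation.map_add_eq_of_lt_right ((dn P : HeightOneSpectrum (𝓞 E)).valuation E) (x := a / z ^ 2 - 1) (y := 1) (by simpa using h3)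
        simpa using this
      rw [this, one_pow]
    exact (pow_eq_one_iff.1 h2).resolve_right two_ne_zero

include hs hσ in
theorem theta_ev (P : HeightOneSpectrum (𝓞 M)) (h2 : (dn P : HeightOneSpectrum (𝓞 E)).valuation E 2 = 1) (h : EvAt (dn P) a) :
    ∃ θ : M, P.valuation M θ ≤ 1 ∧ P.valuation M (θ - σ θ) = 1 := by
  obtain ⟨t, ht, h⟩ := h
  have h3 : P.valuation M (s * algebraMap E M t) = 1 := by
    have h2 : P.valuation M (s * algebraMap E M t) ^ 2 = 1 := by
      rw [← map_pow, mul_pow, hs, ← map_pow, ← map_mul, dn_val, h, one_pow]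
    exact (pow_eq_one_iff.1 h2).resolve_right two_ne_zero
  refine ⟨s * algebraMap E M t, h3.le, ?_⟩
  have : s * algebraMap E M t - σ (s * algebraMap E M t) = algebraMap E M 2 * (s * algebraMap E M t) := by
    simp only [map_mul, AlgEquiv.commutes, hσ, map_ofNat]; ring
  rw [this, map_mul, h3, dn_val, h2]; simp

theorem split_ne (P : HeightOneSpectrum (𝓞 M)) (θ : M) (h1 : θ + σ θ = 1) (h2 : P.valuation M (θ * σ θ) < 1) :
    sgP σ P ≠ P := by
  intro h
  have hv : P.valuation M (σ θ) = P.valuation M θ := by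
    conv_lhs => rw [← h]
    exact sgP_val σ P θ
  rw [map_mul, hv] at h2
  have h3 : P.valuation M θ < 1 := by
    by_contra h4
    push Not at h4
    exact absurd h2 (not_lt.2 (one_le_mul h4 h4))
  have : P.valuation M (θ + σ θ) < 1 := Valuation.map_add_lt _ h3 (hv ▸ h3)
  rw [h1, map_one] at this
  exact lt_irrefl _ this

theorem theta_int (P : HeightOneSpectrum (𝓞 M)) (θ : M) (h1 : θ + σ θ = 1) (h2 : P.valuation M (θ * σ θ) < 1) :
    P.valuation M θ ≤ 1 := by
  by_contra h3
  push Not at h3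
  have h4 : σ θ = 1 - θ := by rw [← h1]; ring
  rw [h4, map_mul, Valuation.map_sub_eq_of_lt_right _ (by simpa using h3)] at h2
  exact absurd h2 (not_lt.2 (one_le_mul h3.le h3.le))

theorem not_inertia (P : HeightOneSpectrum (𝓞 M)) (θ : M) (h1 : P.valuation M θ ≤ 1) (h2 : P.valuation M (θ - σ θ) = 1) :
    σ ∉ Ideal.inertia (M ≃ₐ[E] M) P.asIdeal := by
  intro hi
  have hi' : ∀ x : 𝓞 M, P.valuation M (σ (x : M) - x) < 1 := by
    intro x
    have : σ • x - x ∈ P.asIdeal := hi x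
    rw [← HeightOneSpectrum.valuation_lt_one_iff_mem (K := M)] at this
    exact this
  obtain ⟨b, c, hc⟩ := HeightOneSpectrum.exists_primeCompl_mul_eq_of_integer P θ h1
  have hσθ : P.valuation M (σ θ) ≤ 1 := by
    have : σ θ = θ - (θ - σ θ) := by ring
    rw [this]
    exact (Valuation.map_sub _ _ _).trans (max_le h1 h2.le)
  have hcv : P.valuation M (c : 𝓞 M) = 1 := (P.valuation_eq_one_iff_notMem).2 c.2
  have e : σ (b : M) - b = σ θ * (σ ((c : 𝓞 M) : M) - (c : 𝓞 M)) + (- ((θ - σ θ) * ((c : 𝓞 M) : M))) := by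
    have hc' : (b : M) = θ * ((c : 𝓞 M) : M) := hc.symm
    rw [hc', map_mul]; ring
  have h5 := hi' b
  rw [e, Valuation.map_add_eq_of_lt_right] at h5
  · rw [Valuation.map_neg, map_mul, h2, hcv] at h5; simp at h5
  · rw [Valuation.map_neg, map_mul, map_mul, h2, hcv]
    calc _ ≤ 1 * P.valuation M (σ ((c : 𝓞 M) : M) - (c : 𝓞 M)) := by gcongr
      _ < 1 := by simpa using hi' c
      _ = _ := by simp

include hs hσ in
theorem exists_theta (P : HeightOneSpectrum (𝓞 M)) (h : GoodAt (dn P) a) :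
    ∃ θ : M, P.valuation M θ ≤ 1 ∧ P.valuation M (θ - σ θ) = 1 := by
  rcases h with h | ⟨h2, h⟩
  · obtain ⟨θ, h1, h2, h3⟩ := theta_sq σ s a hs hσ P h
    exact ⟨θ, theta_int σ P θ h1 h2, h3⟩
  · exact theta_ev σ s a hs hσ P h2 h

variable (h2 : ∀ τ : M ≃ₐ[E] M, τ = 1 ∨ τ = σ)

variable [IsGalois E M]

include h2 in
theorem sigma_sq : σ * σ = 1 := by
  rcases h2 (σ * σ) with h | h
  · exact h
  · have : σ = 1 := by simpa using h
    rw [this]; rfl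

include hs hσ h2 in
theorem unram (P : HeightOneSpectrum (𝓞 M)) (h : GoodAt (dn P) a) : P.asIdeal.ramificationIdx (𝓞 E) = 1 := by
  have := P.isPrime
  have := (dn (E := E) P).isPrime
  have hm := (dn (E := E) P).isMaximal
  have hf : Finite (𝓞 E ⧸ (dn (E := E) P).asIdeal) := inferInstance
  have hf2 : Finite (dn (E := E) P).asIdeal.ResidueField :=
    Finite.of_surjective _ ((dn (E := E) P).asIdeal.bijective_algebraMap_quotient_residueField).surjective
  have := Ideal.card_inertia_eq_ramificationIdxIn (G := M ≃ₐ[E] M) (dn (E := E) P).asIdeal P.asIdeal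
  rw [Ideal.ramificationIdxIn_eq_ramificationIdx (dn (E := E) P).asIdeal P.asIdeal (M ≃ₐ[E] M)] at this
  rw [← this]
  obtain ⟨θ, h3, h4⟩ := exists_theta σ s a hs hσ P h
  have h5 := not_inertia σ P θ h3 h4
  have : Ideal.inertia (M ≃ₐ[E] M) P.asIdeal = ⊥ := by
    rw [eq_bot_iff]
    intro τ hτ
    rcases h2 τ with rfl | rfl
    · simp
    · exact absurd hτ h5
  rw [this]; simp

include hs hσ h2 in
theorem val_eq (P : HeightOneSpectrum (𝓞 M)) (h : GoodAt (dn P) a) (x : E) :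
    P.valuation M (algebraMap E M x) = (dn P : HeightOneSpectrum (𝓞 E)).valuation E x := by
  have := P.isPrime
  rw [dn_val, Ideal.ramificationIdx'_eq_ramificationIdx _ _ (dn (E := E) P).ne_bot, unram σ s a hs hσ h2 P h, pow_one]

theorem dn_sgP (τ : M ≃ₐ[E] M) (P : HeightOneSpectrum (𝓞 M)) : dn (E := E) (sgP τ P) = dn P := by
  rw [dn_iff]
  constructor
  show _ = (τ • P.asIdeal).under (𝓞 E)
  simp [dn, HeightOneSpectrum.under]

theorem dn_surj (p : HeightOneSpectrum (𝓞 E)) : ∃ P : HeightOneSpectrum (𝓞 M), dn P = p := by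
  have := p.isPrime
  obtain ⟨⟨P, hP, hl⟩⟩ := (inferInstance : Nonempty (p.asIdeal.primesOver (𝓞 M)))
  have hb : P ≠ ⊥ := Ideal.ne_bot_of_liesOver_of_ne_bot p.ne_bot P
  exact ⟨⟨P, hP, hb⟩, (dn_iff _ _).2 hl⟩

include h2 in
theorem dn_eq_iff (P Q : HeightOneSpectrum (𝓞 M)) : dn (E := E) Q = dn P ↔ Q = P ∨ Q = sgP σ P := by
  constructor
  · intro h
    have := P.isPrime
    have := Q.isPrime
    have hl := (dn_iff _ _).1 h
    obtain ⟨τ, hτ⟩ := Ideal.exists_smul_eq_of_isGaloisGroup (dn (E := E) P).asIdeal P.asIdeal Q.asIdeal (M ≃ₐ[E] M)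
    rcases h2 τ with rfl | rfl
    · left; ext1; rw [← hτ]; simp
    · right; ext1; rw [← hτ]; rfl
  · rintro (rfl | rfl)
    · rfl
    · exact dn_sgP _ _

include hs hσ h2 in
theorem norm_split (hne : σ ≠ 1) (P : HeightOneSpectrum (𝓞 M)) (h : GoodAt (dn P) a) :
    (sgP σ P ≠ P → Ideal.absNorm P.asIdeal = Ideal.absNorm (dn (E := E) P).asIdeal) ∧
    (sgP σ P = P → Ideal.absNorm P.asIdeal = Ideal.absNorm (dn (E := E) P).asIdeal ^ 2) := by
  have := P.isPrime
  have := (dn (E := E) P).isPrime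
  have hn := Ideal.absNorm_eq_pow_inertiaDeg'_of_liesOver P.asIdeal (dn (E := E) P).asIdeal inferInstance (dn (E := E) P).ne_bot
  have hm := (dn (E := E) P).isMaximal
  rw [Ideal.inertiaDeg'_eq_inertiaDeg] at hn
  have hc := Ideal.ncard_primesOver_mul_ramificationIdxIn_mul_inertiaDegIn (dn (E := E) P).asIdeal (𝓞 M) (M ≃ₐ[E] M)
  rw [Ideal.ramificationIdxIn_eq_ramificationIdx (dn (E := E) P).asIdeal P.asIdeal (M ≃ₐ[E] M),
    Ideal.inertiaDegIn_eq_inertiaDeg (dn (E := E) P).asIdeal P.asIdeal (M ≃ₐ[E] M), unram σ s a hs hσ h2 P h, one_mul] at hc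
  have hG : Nat.card (M ≃ₐ[E] M) = 2 := by
    have : (Set.univ : Set (M ≃ₐ[E] M)) = {1, σ} := by
      ext τ; simpa using h2 τ
    rw [← Set.ncard_univ, this, Set.ncard_pair hne.symm]
  have hpo : (dn (E := E) P).asIdeal.primesOver (𝓞 M) = {P.asIdeal, (sgP σ P).asIdeal} := by
    ext Q
    constructor
    · rintro ⟨hQ, hl⟩
      have hb : Q ≠ ⊥ := Ideal.ne_bot_of_liesOver_of_ne_bot (dn (E := E) P).ne_bot Q
      have := (dn_eq_iff σ h2 P ⟨Q, hQ, hb⟩).1 ((dn_iff _ _).2 hl)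
      rcases this with h | h
      · left; exact congrArg HeightOneSpectrum.asIdeal h
      · right; exact congrArg HeightOneSpectrum.asIdeal h
    · rintro (rfl | rfl)
      · exact ⟨P.isPrime, inferInstance⟩
      · exact ⟨(sgP σ P).isPrime, (dn_iff _ _).1 (dn_sgP σ P)⟩
  rw [hG, hpo] at hc
  constructor
  · intro hne'
    have : P.asIdeal ≠ (sgP σ P).asIdeal := fun h => hne' (HeightOneSpectrum.ext h.symm)
    rw [Set.ncard_pair this] at hc
    have : P.asIdeal.inertiaDeg (𝓞 E) = 1 := by omega
    rw [hn, this, pow_one]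
  · intro he
    rw [he] at hc
    simp at hc
    rw [hn, hc]

end
end HL

namespace HL
open NumberField Module IsDedekindDomain
open scoped nonZeroDivisors Topology Pointwise

noncomputable section
open scoped Classical
set_option linter.unusedSectionVars false

variable {K : Type*} [Field K] [NumberField K]

abbrev Dv (K : Type*) [Field K] [NumberField K] := HeightOneSpectrum (𝓞 K) →₀ ℤ

/-- additive valuation -/
def ord (P : HeightOneSpectrum (𝓞 K)) (x : K) : ℤ := - WithZero.log (P.valuation K x)

theorem ord_mul (P : HeightOneSpectrum (𝓞 K)) {x y : K} (hx : x ≠ 0) (hy : y ≠ 0) : ord P (x * y) = ord P x + ord P y := by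
  rw [ord, map_mul, WithZero.log_mul (by simpa using hx) (by simpa using hy), ord, ord]; ring

theorem ord_one (P : HeightOneSpectrum (𝓞 K)) : ord P 1 = 0 := by simp [ord]

theorem ord_inv (P : HeightOneSpectrum (𝓞 K)) (x : K) : ord P x⁻¹ = - ord P x := by
  rw [ord, map_inv₀, WithZero.log_inv, ord]

theorem val_eq_exp (P : HeightOneSpectrum (𝓞 K)) {x : K} (hx : x ≠ 0) : P.valuation K x = WithZero.exp (- ord P x) := by
  rw [ord, neg_neg, WithZero.exp_log (by simpa using hx)]

theorem ord_eq_zero_iff (P : HeightOneSpectrum (𝓞 K)) {x : K} (hx : x ≠ 0) : ord P x = 0 ↔ P.valuation K x = 1 := by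
  rw [val_eq_exp P hx, WithZero.exp_eq_one, neg_eq_zero]

/-- multiplicity of a prime in an ideal -/
def cnt (P : HeightOneSpectrum (𝓞 K)) (I : Ideal (𝓞 K)) : ℤ := ((Associates.mk P.asIdeal).count (Associates.mk I).factors : ℕ)

theorem ord_int (P : HeightOneSpectrum (𝓞 K)) {x : 𝓞 K} (hx : x ≠ 0) : ord P (x : K) = cnt P (Ideal.span {x}) := by
  rw [ord, HeightOneSpectrum.valuation_of_algebraMap, HeightOneSpectrum.intValuation_if_neg _ hx, WithZero.log_exp, neg_neg, cnt]

theorem cnt_mul (P : HeightOneSpectrum (𝓞 K)) {I J : Ideal (𝓞 K)} (hI : I ≠ 0) (hJ : J ≠ 0) : cnt P (I * J) = cnt P I + cnt P J := by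
  rw [cnt, ← Associates.mk_mul_mk, Associates.count_mul (by simpa using hI) (by simpa using hJ) P.associates_irreducible, cnt, cnt]
  push_cast; rfl

theorem cnt_fin {I : Ideal (𝓞 K)} (hI : I ≠ 0) : {P : HeightOneSpectrum (𝓞 K) | cnt P I ≠ 0}.Finite := by
  have := Associates.finite_factors hI
  rw [Filter.eventually_cofinite] at this
  exact this

theorem cnt_self (P Q : HeightOneSpectrum (𝓞 K)) : cnt P Q.asIdeal = if P = Q then 1 else 0 := by
  split_ifs with h
  · subst h
    have := FractionalIdeal.count_self K P
    rw [FractionalIdeal.count_coe K P P.ne_bot] at this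
    exact this
  · have := FractionalIdeal.count_maximal_coprime K P (w := Q) (Ne.symm h)
    rw [FractionalIdeal.count_coe K P Q.ne_bot] at this
    exact this

theorem ord_fin {x : K} (hx : x ≠ 0) : {P : HeightOneSpectrum (𝓞 K) | ord P x ≠ 0}.Finite := by
  obtain ⟨n, d, hd, rfl⟩ := IsFractionRing.div_surjective (A := 𝓞 K) x
  have hd0 : d ≠ 0 := nonZeroDivisors.ne_zero hd
  have hn0 : n ≠ 0 := by rintro rfl; simp at hx
  refine ((cnt_fin (I := Ideal.span {n}) (by simpa using hn0)).union (cnt_fin (I := Ideal.span {d}) (by simpa using hd0))).subset ?_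
  intro P hP
  by_contra h
  simp only [Set.mem_union, Set.mem_ofPred_eq, not_or, not_not] at h
  apply hP
  rw [div_eq_mul_inv, ord_mul, ord_inv]
  · have h1 := ord_int P hn0
    have h2 := ord_int P hd0
    rw [h1, h2, h.1, h.2]; simp
  · simpa using hn0
  · simpa using hd0

/-- principal divisors -/
def dv : Additive Kˣ →+ Dv K where
  toFun x := Finsupp.ofSupportFinite (fun P => ord P ((x.toMul : Kˣ) : K)) (ord_fin (x.toMul).ne_zero)
  map_zero' := by ext P; simp [Finsupp.ofSupportFinite, ord_one]
  map_add' x y := by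
    ext P
    exact ord_mul P (Units.ne_zero _) (Units.ne_zero _)

theorem dv_apply (x : Additive Kˣ) (P : HeightOneSpectrum (𝓞 K)) : dv x P = ord P ((x.toMul : Kˣ) : K) := rfl

/-- divisor of an ideal -/
def dI (I : Idl K) : Dv K := Finsupp.ofSupportFinite (fun P => cnt P I.1) (cnt_fin (nonZeroDivisors.coe_ne_zero I))

theorem dI_apply (I : Idl K) (P) : dI I P = cnt P I.1 := rfl

theorem dI_mul (I J : Idl K) : dI (I * J) = dI I + dI J := by
  ext P; simp only [dI_apply, Finsupp.coe_add, Pi.add_apply, Submonoid.coe_mul]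
  exact cnt_mul P (nonZeroDivisors.coe_ne_zero I) (nonZeroDivisors.coe_ne_zero J)

theorem dI_prime (P : HeightOneSpectrum (𝓞 K)) : dI (pI P : Idl K) = Finsupp.single P 1 := by
  ext Q
  rw [dI_apply, pI_val, cnt_self, Finsupp.single_apply]
  simp [eq_comm]

/-- lifting homomorphisms to the class group -/
theorem class_lift {G : Type*} [AddCommGroup G] (F : Dv K →+ G) (hF : ∀ x, F (dv x) = 0) :
    ∃ χ : ClassGroup (𝓞 K) →* Multiplicative G, ∀ I : Idl K, χ (ClassGroup.mk0 I) = Multiplicative.ofAdd (F (dI I)) := by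
  have key : ∀ I J : Idl K, ClassGroup.mk0 I = ClassGroup.mk0 J → F (dI I) = F (dI J) := by
    intro I J h
    obtain ⟨x, y, hx, hy, h⟩ := ClassGroup.mk0_eq_mk0_iff.1 h
    have hx' : (x : K) ≠ 0 := by simpa using hx
    have hy' : (y : K) ≠ 0 := by simpa using hy
    have h1 : dv (Additive.ofMul (Units.mk0 (x : K) hx')) + dI I = dv (Additive.ofMul (Units.mk0 (y : K) hy')) + dI J := by
      ext P
      simp only [Finsupp.coe_add, Pi.add_apply, dv_apply, dI_apply, toMul_ofMul, Units.val_mk0]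
      rw [ord_int P hx, ord_int P hy, ← cnt_mul, h, cnt_mul]
      · simpa using hy
      · exact (nonZeroDivisors.coe_ne_zero J)
      · simpa using hx
      · exact (nonZeroDivisors.coe_ne_zero I)
    have := congrArg F h1
    simpa [hF] using this
  refine ⟨MonoidHom.mk' (fun c => Multiplicative.ofAdd (F (dI (Function.surjInv ClassGroup.mk0_surjective c)))) ?_, ?_⟩
  · intro c d
    rw [← ofAdd_add, ← map_add, ← dI_mul]
    congr 1
    apply key
    rw [map_mul, Function.surjInv_eq ClassGroup.mk0_surjective, Function.surjInv_eq ClassGroup.mk0_surjective, Function.surjInv_eq ClassGroup.mk0_surjective]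
  · intro I
    show Multiplicative.ofAdd _ = _
    congr 1
    apply key
    rw [Function.surjInv_eq ClassGroup.mk0_surjective]

theorem dv_quot_finite : Finite (Dv K ⧸ (dv : Additive Kˣ →+ Dv K).range) := by
  obtain ⟨χ, hχ⟩ := class_lift (QuotientAddGroup.mk' (dv : Additive Kˣ →+ Dv K).range) (by
    intro x
    simp)
  have : Function.Surjective χ := by
    rw [← MonoidHom.range_eq_top, eq_top_iff]
    rintro ⟨D⟩ -
    show Multiplicative.ofAdd (QuotientAddGroup.mk' _ D) ∈ _
    induction D using Finsupp.induction_linear with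
    | zero => rw [map_zero]; exact one_mem _
    | add f g hf hg => rw [map_add, ofAdd_add]; exact mul_mem hf hg
    | single P n =>
      have : Finsupp.single P n = n • Finsupp.single P (1 : ℤ) := by simp
      rw [this, map_zsmul, ofAdd_zsmul]
      apply zpow_mem
      exact ⟨ClassGroup.mk0 (pI P), by rw [hχ, dI_prime]⟩
  exact Finite.of_surjective (fun c => (χ c).toAdd) this

end
end HL

namespace HL
open Module

noncomputable section
open scoped Classical
set_option linter.unusedSectionVars false

theorem fr_add {A B : Type*} [AddCommGroup A] [AddCommGroup B] [Module.Finite ℤ A] (f : A →ₗ[ℤ] B) :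
    finrank ℤ (LinearMap.range f) + finrank ℤ (LinearMap.ker f) = finrank ℤ A := by
  rw [← Submodule.finrank_quotient_add_finrank (LinearMap.ker f), (f.quotKerEquivRange).finrank_eq]

theorem fr_fin_index {B : Type*} [AddCommGroup B] [Module.Finite ℤ B] (S : Submodule ℤ B) (n : ℤ) (hn : n ≠ 0)
    (h : ∀ b : B, n • b ∈ S) : finrank ℤ S = finrank ℤ B := by
  rw [← Submodule.finrank_quotient_add_finrank S]
  have : finrank ℤ (B ⧸ S) = 0 := by
    rw [Module.finrank_eq_zero_iff_isTorsion]
    rintro ⟨b⟩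
    refine ⟨⟨n, mem_nonZeroDivisors_of_ne_zero hn⟩, ?_⟩
    show n • (Submodule.Quotient.mk b : B ⧸ S) = 0
    rw [← Submodule.Quotient.mk_smul, Submodule.Quotient.mk_eq_zero]
    exact h b
  omega

/-- multiplication by 2 -/
abbrev two (B : Type*) [AddCommGroup B] : B →+ B := nsmulAddMonoidHom 2

theorem idx_equiv {B C : Type*} [AddCommGroup B] [AddCommGroup C] (e : B ≃+ C) :
    (two B).range.index = (two C).range.index ∧ Nat.card (two B).ker = Nat.card (two C).ker := by
  constructor
  · rw [← AddSubgroup.index_map_equiv _ e]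
    congr 1
    ext x
    simp only [AddSubgroup.mem_map, AddMonoidHom.mem_range, nsmulAddMonoidHom_apply]
    constructor
    · rintro ⟨_, ⟨y, rfl⟩, rfl⟩; exact ⟨e y, by simp⟩
    · rintro ⟨y, rfl⟩; exact ⟨_, ⟨e.symm y, rfl⟩, by simp⟩
  · refine Nat.card_congr (e.toEquiv.subtypeEquiv ?_)
    intro a
    simp only [AddMonoidHom.mem_ker, nsmulAddMonoidHom_apply, AddEquiv.toEquiv_eq_coe, EquivLike.coe_coe]
    constructor
    · intro h; rw [← map_nsmul, h, map_zero]
    · intro h; rw [← map_nsmul] at h; exact (AddEquiv.map_eq_zero_iff e).1 h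

theorem idx_fin {T : Type*} [AddCommGroup T] [Finite T] : (two T).range.index = Nat.card (two T).ker := by
  have h1 := AddSubgroup.card_mul_index (two T).range
  have h2 := AddSubgroup.card_mul_index (two T).ker
  rw [AddSubgroup.index_ker] at h2
  have : 0 < Nat.card (two T).range := Nat.card_pos
  have h3 : Nat.card (two T).range * (two T).range.index = Nat.card (two T).range * Nat.card (two T).ker := by
    rw [h1, mul_comm, h2]
  exact Nat.eq_of_mul_eq_mul_left this h3

theorem idx_free (n : ℕ) : (two (Fin n → ℤ)).range.index = 2 ^ n := by
  let f : (Fin n → ℤ) →+ (Fin n → ZMod 2) :=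
    { toFun := fun x i => (x i : ZMod 2), map_zero' := by ext; simp, map_add' := by intros; ext; simp }
  have : (two (Fin n → ℤ)).range = f.ker := by
    ext x
    simp only [AddMonoidHom.mem_range, AddMonoidHom.mem_ker, nsmulAddMonoidHom_apply]
    constructor
    · rintro ⟨y, rfl⟩
      ext i
      simp [f]
      left; exact (by decide : (2 : ZMod 2) = 0)
    · intro h
      have : ∀ i, ∃ k, x i = 2 * k := by
        intro i
        have := congrFun h i
        exact (ZMod.intCast_zmod_eq_zero_iff_dvd (x i) 2).1 this
      choose k hk using this
      exact ⟨k, by ext i; simp [hk]⟩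
  rw [this, AddSubgroup.index_ker]
  have : f.range = ⊤ := by
    rw [AddMonoidHom.range_eq_top]
    intro y
    refine ⟨fun i => ((y i).val : ℤ), ?_⟩
    ext i; simp [f]
  rw [this]
  simp

theorem idx_two (B : Type*) [AddCommGroup B] [Module.Finite ℤ B] :
    (two B).range.index = 2 ^ (finrank ℤ B) * Nat.card (two B).ker := by
  obtain ⟨n, ι, _, p, hp, e, ⟨f⟩⟩ := @AddCommGroup.equiv_free_prod_directSum_zmod B _ (Module.Finite.iff_addGroup_fg.mp inferInstance)
  have hne : ∀ i, NeZero (p i ^ e i) := fun i => ⟨pow_ne_zero _ (hp i).ne_zero⟩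
  let g : B ≃+ (Fin n → ℤ) × (∀ i, ZMod (p i ^ e i)) :=
    f.trans (AddEquiv.prodCongr Finsupp.addEquivFunOnFinite (DirectSum.addEquivProd _))
  have hfr : finrank ℤ B = n := by
    rw [(g.toIntLinearEquiv).finrank_eq]
    have := fr_add (LinearMap.fst ℤ (Fin n → ℤ) (∀ i, ZMod (p i ^ e i)))
    rw [← this]
    have h1 : LinearMap.range (LinearMap.fst ℤ (Fin n → ℤ) (∀ i, ZMod (p i ^ e i))) = ⊤ := LinearMap.range_eq_top.2 LinearMap.fst_surjective
    rw [h1, finrank_top]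
    have h2 : finrank ℤ (LinearMap.ker (LinearMap.fst ℤ (Fin n → ℤ) (∀ i, ZMod (p i ^ e i)))) = 0 := by
      rw [LinearMap.ker_fst]
      have : Module.IsTorsion ℤ (∀ i, ZMod (p i ^ e i)) := by
        intro x
        refine ⟨⟨(Nat.card (∀ i, ZMod (p i ^ e i)) : ℤ), mem_nonZeroDivisors_of_ne_zero (by exact_mod_cast Nat.card_pos.ne')⟩, ?_⟩
        show (Nat.card (∀ i, ZMod (p i ^ e i)) : ℤ) • x = 0
        rw [natCast_zsmul]; exact card_nsmul_eq_zero'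
      have h3 := (Module.finrank_eq_zero_iff_isTorsion).2 this
      have h4 := fr_add (LinearMap.inr ℤ (Fin n → ℤ) (∀ i, ZMod (p i ^ e i)))
      omega
    simp [h2]
  obtain ⟨h1, h2⟩ := idx_equiv g
  rw [h1, h2, hfr]
  have h3 : (two ((Fin n → ℤ) × (∀ i, ZMod (p i ^ e i)))).range = (two (Fin n → ℤ)).range.prod (two (∀ i, ZMod (p i ^ e i))).range := by
    ext ⟨x, y⟩
    simp only [AddSubgroup.mem_prod, AddMonoidHom.mem_range, nsmulAddMonoidHom_apply]
    constructor
    · rintro ⟨⟨u, v⟩, h⟩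
      exact ⟨⟨u, congrArg Prod.fst h⟩, ⟨v, congrArg Prod.snd h⟩⟩
    · rintro ⟨⟨u, h⟩, ⟨v, h'⟩⟩
      exact ⟨(u, v), by rw [Prod.smul_mk, h, h']⟩
  have h4 : Nat.card (two ((Fin n → ℤ) × (∀ i, ZMod (p i ^ e i)))).ker = Nat.card (two (∀ i, ZMod (p i ^ e i))).ker := by
    refine Nat.card_congr ⟨fun x => ⟨x.1.2, congrArg Prod.snd x.2⟩, fun y => ⟨(0, y.1), ?_⟩, ?_, ?_⟩
    · have := y.2
      simp only [AddMonoidHom.mem_ker, nsmulAddMonoidHom_apply] at this ⊢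
      rw [Prod.smul_mk, this]; simp
    · rintro ⟨⟨x, y⟩, h⟩
      have : x = 0 := by
        have := congrArg Prod.fst h
        ext i
        have := congrFun this i
        simpa using this
      simp [this]
    · rintro ⟨y, h⟩; rfl
  rw [h3, AddSubgroup.index_prod, idx_free, idx_fin, h4]


section herb
variable {A : Type*} [AddCommGroup A] (s : A →+ A) (hs : ∀ a, s (s a) = a)

/-- fixed part -/
def fixP : AddSubgroup A := (s - AddMonoidHom.id A).ker
/-- anti-fixed part -/
def fixM : AddSubgroup A := (s + AddMonoidHom.id A).ker

theorem mem_fixP (a : A) : a ∈ fixP s ↔ s a = a := by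
  simp [fixP, AddMonoidHom.mem_ker, sub_eq_zero]

theorem mem_fixM (a : A) : a ∈ fixM s ↔ s a = - a := by
  simp [fixM, AddMonoidHom.mem_ker, eq_neg_iff_add_eq_zero]

theorem idx_sub (B : AddSubgroup A) [Module.Finite ℤ B] :
    (B.map (two A)).relIndex B = 2 ^ (finrank ℤ B) * Nat.card (two B).ker := by
  rw [← idx_two B, AddSubgroup.relIndex]
  congr 1
  ext x
  simp only [AddSubgroup.mem_addSubgroupOf, AddSubgroup.mem_map, AddMonoidHom.mem_range, nsmulAddMonoidHom_apply]
  constructor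
  · rintro ⟨y, hy, h⟩; exact ⟨⟨y, hy⟩, Subtype.ext h⟩
  · rintro ⟨y, rfl⟩; exact ⟨y, y.2, rfl⟩

include hs in
theorem herb [Module.Finite ℤ A] :
    (s + AddMonoidHom.id A).range.relIndex (fixP s) * 2 ^ finrank ℤ (fixM s) =
    (s - AddMonoidHom.id A).range.relIndex (fixM s) * 2 ^ finrank ℤ (fixP s) ∧
    finrank ℤ (fixP s) + finrank ℤ (fixM s) = finrank ℤ A ∧
    (fixP s ⊔ fixM s).index ≠ 0 ∧
    (s - AddMonoidHom.id A).range.relIndex (fixM s) ≠ 0 := by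
  have fP : Module.Finite ℤ (fixP s) := inferInstanceAs (Module.Finite ℤ (AddSubgroup.toIntSubmodule (fixP s)))
  have fM : Module.Finite ℤ (fixM s) := inferInstanceAs (Module.Finite ℤ (AddSubgroup.toIntSubmodule (fixM s)))
  have e1 : (fixP s ⊔ fixM s).map (s + AddMonoidHom.id A) = (fixP s).map (two A) := by
    rw [AddSubgroup.map_sup]
    have : (fixM s).map (s + AddMonoidHom.id A) = ⊥ := (AddSubgroup.map_eq_bot_iff _).2 le_rfl
    rw [this, sup_bot_eq]
    ext x
    simp only [AddSubgroup.mem_map, mem_fixP]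
    constructor
    · rintro ⟨y, hy, rfl⟩; exact ⟨y, hy, by simp [hy, two_nsmul]⟩
    · rintro ⟨y, hy, rfl⟩; exact ⟨y, hy, by simp [hy, two_nsmul]⟩
  have e2 : (fixP s ⊔ fixM s).map (s - AddMonoidHom.id A) = (fixM s).map (two A) := by
    rw [AddSubgroup.map_sup]
    have : (fixP s).map (s - AddMonoidHom.id A) = ⊥ := (AddSubgroup.map_eq_bot_iff _).2 le_rfl
    rw [this, bot_sup_eq]
    ext x
    simp only [AddSubgroup.mem_map, mem_fixM]
    constructor
    · rintro ⟨y, hy, rfl⟩; exact ⟨-y, by simp [hy], by simp [hy, two_nsmul, sub_eq_add_neg]⟩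
    · rintro ⟨y, hy, rfl⟩; exact ⟨-y, by simp [hy], by simp [hy, two_nsmul, sub_eq_add_neg]⟩
  have i1 : ((fixP s).map (two A)).relIndex (s + AddMonoidHom.id A).range = (fixP s ⊔ fixM s).index := by
    rw [← e1, AddMonoidHom.range_eq_map, AddSubgroup.relIndex_map_map]
    have : (s + AddMonoidHom.id A).ker ≤ fixP s ⊔ fixM s := le_sup_right
    rw [sup_of_le_left this, top_sup_eq, AddSubgroup.relIndex_top_right]
  have i2 : ((fixM s).map (two A)).relIndex (s - AddMonoidHom.id A).range = (fixP s ⊔ fixM s).index := by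
    rw [← e2, AddMonoidHom.range_eq_map, AddSubgroup.relIndex_map_map]
    have : (s - AddMonoidHom.id A).ker ≤ fixP s ⊔ fixM s := le_sup_left
    rw [sup_of_le_left this, top_sup_eq, AddSubgroup.relIndex_top_right]
  have r1 : (s + AddMonoidHom.id A).range ≤ fixP s := by
    rintro _ ⟨x, rfl⟩; rw [mem_fixP]; simp [hs, add_comm]
  have r2 : (s - AddMonoidHom.id A).range ≤ fixM s := by
    rintro _ ⟨x, rfl⟩; rw [mem_fixM]; simp [hs]
  have l1 : (fixP s).map (two A) ≤ (s + AddMonoidHom.id A).range := e1 ▸ AddSubgroup.map_le_range _ _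
  have l2 : (fixM s).map (two A) ≤ (s - AddMonoidHom.id A).range := e2 ▸ AddSubgroup.map_le_range _ _
  have m1 := AddSubgroup.relIndex_mul_relIndex _ _ _ l1 r1
  have m2 := AddSubgroup.relIndex_mul_relIndex _ _ _ l2 r2
  rw [i1, idx_sub] at m1
  rw [i2, idx_sub] at m2
  have ker_eq : Nat.card (two (fixP s)).ker = Nat.card (two (fixM s)).ker := by
    have hh : ∀ a : A, 2 • a = 0 → -a = a := by
      intro a h; rw [neg_eq_iff_add_eq_zero, ← two_nsmul, h]
    have h1 : ∀ x : (two (fixP s)).ker, 2 • (x.1.1) = 0 := fun x => congrArg Subtype.val x.2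
    have h2 : ∀ x : (two (fixM s)).ker, 2 • (x.1.1) = 0 := fun x => congrArg Subtype.val x.2
    refine Nat.card_congr ⟨fun x => ⟨⟨x.1.1, ?_⟩, Subtype.ext (h1 x)⟩, fun x => ⟨⟨x.1.1, ?_⟩, Subtype.ext (h2 x)⟩, fun x => rfl, fun x => rfl⟩
    · rw [mem_fixM, hh _ (h1 x)]; exact (mem_fixP s _).1 x.1.2
    · rw [mem_fixP]; rw [(mem_fixM s _).1 x.1.2, hh _ (h2 x)]
  have hk : Nat.card (two (fixM s)).ker ≠ 0 := by
    have : Finite (two (fixM s)).ker := by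
      have f3 : Module.Finite ℤ (two (fixM s)).ker := inferInstanceAs (Module.Finite ℤ (AddSubgroup.toIntSubmodule (two (fixM s)).ker))
      refine Module.finite_of_fg_torsion (two (fixM s)).ker ?_
      intro x
      refine ⟨⟨2, mem_nonZeroDivisors_of_ne_zero (by norm_num)⟩, ?_⟩
      apply Subtype.ext
      have := x.2
      rw [AddMonoidHom.mem_ker, nsmulAddMonoidHom_apply] at this
      show (2 : ℤ) • x.1 = 0
      rw [two_zsmul, ← two_nsmul, this]
    exact Nat.card_pos.ne'
  have hidx : (fixP s ⊔ fixM s).index ≠ 0 := by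
    intro h
    rw [h, zero_mul] at m2
    have : (2 : ℕ) ^ finrank ℤ (fixM s) * Nat.card (two (fixM s)).ker ≠ 0 := mul_ne_zero (by positivity) hk
    exact this m2.symm
  refine ⟨?_, ?_, hidx, ?_⟩
  · apply Nat.eq_of_mul_eq_mul_left (Nat.pos_of_ne_zero hidx)
    rw [← mul_assoc, m1, ← mul_assoc, m2, ker_eq]; ring
  · have := fr_add (s + AddMonoidHom.id A).toIntLinearMap
    rw [← this]
    congr 1
    have h3 : LinearMap.range (s + AddMonoidHom.id A).toIntLinearMap ≤ AddSubgroup.toIntSubmodule (fixP s) := r1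
    have h4 := fr_fin_index (B := fixP s) (Submodule.comap (AddSubgroup.toIntSubmodule (fixP s)).subtype (LinearMap.range (s + AddMonoidHom.id A).toIntLinearMap)) 2 (by norm_num) (by
      intro b
      refine ⟨b, ?_⟩
      have hb := (mem_fixP s _).1 b.2
      simp [hb, two_zsmul]
      rfl)
    rw [← h4]
    exact (Submodule.comapSubtypeEquivOfLe h3).finrank_eq
  · intro h
    rw [h, mul_zero] at m2
    have : (2 : ℕ) ^ finrank ℤ (fixM s) * Nat.card (two (fixM s)).ker ≠ 0 := mul_ne_zero (by positivity) hk
    exact this m2.symm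

end herb
end
end HL

namespace HL
open Module

noncomputable section
open scoped Classical
set_option linter.unusedSectionVars false

section absAlg
variable {L I : Type*} [AddCommGroup L] [AddCommGroup I]

/-- free `ℤ[G]`-module -/
abbrev Nn (C : Type*) := C → ℤ × ℤ

/-- swap -/
def swN (C : Type*) : Nn C →+ Nn C := AddMonoidHom.mk' (fun n c => ((n c).2, (n c).1)) (by intro a b; rfl)

theorem swN_apply {C : Type*} (n : Nn C) (c : C) : swN C n c = ((n c).2, (n c).1) := rfl

variable (d : L →+ I) (sI : I →+ I) (sL : L →+ L)

/-- the map from the free module to ideals -/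
def ph [Fintype (I ⧸ d.range)] : Nn (I ⧸ d.range) →+ I :=
  AddMonoidHom.mk' (fun n => ∑ c, ((n c).1 • (Quotient.out c : I) + (n c).2 • sI (Quotient.out c : I))) (by
    intro a b
    rw [← Finset.sum_add_distrib]
    refine Finset.sum_congr rfl fun c _ => ?_
    simp only [Pi.add_apply, Prod.fst_add, Prod.snd_add, add_smul]
    abel)

theorem ph_apply [Fintype (I ⧸ d.range)] (n) : ph d sI n = ∑ c, ((n c).1 • (Quotient.out c : I) + (n c).2 • sI (Quotient.out c : I)) := rfl

theorem ph_sw [Fintype (I ⧸ d.range)] (hI : ∀ x, sI (sI x) = x) (n) : ph d sI (swN _ n) = sI (ph d sI n) := by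
  rw [ph_apply, ph_apply, map_sum]
  refine Finset.sum_congr rfl fun c _ => ?_
  simp only [swN_apply, map_add, map_zsmul, hI]
  abel

theorem ph_surj [Fintype (I ⧸ d.range)] (D : I) : ∃ z q, D = d z + ph d sI q := by
  have h : (QuotientAddGroup.mk (Quotient.out (QuotientAddGroup.mk D : I ⧸ d.range)) : I ⧸ d.range) = QuotientAddGroup.mk D :=
    Quotient.out_eq' _
  rw [QuotientAddGroup.eq] at h
  obtain ⟨z, hz⟩ := h
  refine ⟨z, Pi.single (QuotientAddGroup.mk D) (1, 0), ?_⟩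
  rw [ph_apply, Finset.sum_eq_single (QuotientAddGroup.mk D)]
  · rw [hz]; simp
  · intro c _ hc
    simp [Pi.single_eq_of_ne hc]
  · simp

/-- the defining map of A -/
def dA [Fintype (I ⧸ d.range)] : L × Nn (I ⧸ d.range) →+ I := d.coprod (ph d sI)

theorem mem_dA [Fintype (I ⧸ d.range)] (x) : x ∈ (dA d sI).ker ↔ d x.1 + ph d sI x.2 = 0 := Iff.rfl

/-- the involution on A -/
def sA [Fintype (I ⧸ d.range)] (hI : ∀ x, sI (sI x) = x) (hd : ∀ x, d (sL x) = sI (d x)) : (dA d sI).ker →+ (dA d sI).ker :=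
  AddMonoidHom.mk' (fun x => ⟨(sL x.1.1, swN _ x.1.2), by
    have := (mem_dA d sI _).1 x.2
    rw [mem_dA]
    simp only [hd, ph_sw d sI hI, ← map_add, this, map_zero]⟩) (by
    intro a b; apply Subtype.ext; simp)

variable (hI : ∀ x, sI (sI x) = x) (hL : ∀ x, sL (sL x) = x) (hd : ∀ x, d (sL x) = sI (d x))

theorem sA_val [Fintype (I ⧸ d.range)] (x) : (sA d sI sL hI hd x).1 = (sL x.1.1, swN _ x.1.2) := rfl

include hI hL hd in
theorem abs_main [Finite (I ⧸ d.range)]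
    (L90 : ∀ x, x + sL x = 0 → ∃ y, x = y - sL y)
    [hfin : Module.Finite ℤ d.ker]
    (hrk : finrank ℤ d.ker = 2 * finrank ℤ (d.ker ⊓ fixP sL : AddSubgroup L) + 1)
    (hW : ∀ y1 y2, sI y1 = y1 → sI y2 = y2 → 
      (∃ e D, sL e = e ∧ y1 = d e + (D + sI D)) ∨ (∃ e D, sL e = e ∧ y2 = d e + (D + sI D)) ∨
      (∃ e D, sL e = e ∧ y1 - y2 = d e + (D + sI D)))
    (b : L) (D : I) (hb : sL b = b) (hbD : d b = D + sI D) : ∃ y, b = y + sL y := by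
  have : Fintype (I ⧸ d.range) := Fintype.ofFinite _
  set s := sA d sI sL hI hd with hs
  have hss : ∀ x, s (s x) = x := by
    intro x; apply Subtype.ext
    rw [sA_val, sA_val]
    ext
    · simp [hL]
    · simp [swN_apply]
    · simp [swN_apply]
  -- projection
  let p : (dA d sI).ker →ₗ[ℤ] Nn (I ⧸ d.range) := ((AddMonoidHom.snd L (Nn (I ⧸ d.range))).comp (AddSubgroup.subtype (dA d sI).ker)).toIntLinearMap
  have hp : ∀ x, p x = x.1.2 := fun x => rfl
  let kd := AddSubgroup.toIntSubmodule d.ker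
  let ek : d.ker →+ (dA d sI).ker := AddMonoidHom.mk' (fun x => ⟨(x.1, 0), by
    rw [mem_dA, map_zero, add_zero]; exact x.2⟩) (by intro a b; apply Subtype.ext; simp)
  have hek : ∀ x, (ek x).1 = (x.1, 0) := fun x => rfl
  have hex : LinearMap.range ek.toIntLinearMap = LinearMap.ker p := by
    ext x
    rw [LinearMap.mem_range, LinearMap.mem_ker, hp]
    constructor
    · rintro ⟨y, rfl⟩; rfl
    · intro h
      refine ⟨⟨x.1.1, ?_⟩, ?_⟩
      · have := (mem_dA d sI _).1 x.2
        rw [h, map_zero, add_zero] at this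
        exact this
      · apply Subtype.ext
        exact Prod.ext rfl h.symm
  have hekinj : Function.Injective ek := by
    intro x y h
    exact Subtype.ext (congrArg (fun z => z.1.1) h)
  have hN : IsNoetherian ℤ (dA d sI).ker := isNoetherian_of_range_eq_ker ek.toIntLinearMap p hex
  have hAf : Module.Finite ℤ (dA d sI).ker := inferInstance
  have hcard : ∀ x : I, ∃ z, d z = (Fintype.card (I ⧸ d.range) : ℤ) • x := by
    intro x
    have : (Fintype.card (I ⧸ d.range) : ℕ) • (QuotientAddGroup.mk x : (I ⧸ d.range)) = 0 := card_nsmul_eq_zero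
    rw [← QuotientAddGroup.mk_nsmul, QuotientAddGroup.eq_zero_iff] at this
    obtain ⟨z, hz⟩ := this
    exact ⟨z, by rw [hz, natCast_zsmul]⟩
  have hc0 : (Fintype.card (I ⧸ d.range) : ℤ) ≠ 0 := by
    have : Nonempty (I ⧸ d.range) := ⟨0⟩
    exact_mod_cast Fintype.card_ne_zero
  have rA : 2 * Fintype.card (I ⧸ d.range) + finrank ℤ d.ker = finrank ℤ (dA d sI).ker := by
    rw [← fr_add p, ← hex, fr_fin_index (LinearMap.range p) _ hc0]
    · congr 1
      · simp [Module.finrank_pi_fintype]; ring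
      · exact (LinearEquiv.ofInjective ek.toIntLinearMap hekinj).finrank_eq
    · intro n
      obtain ⟨z, hz⟩ := hcard (ph d sI n)
      refine ⟨⟨(-z, (Fintype.card (I ⧸ d.range) : ℤ) • n), ?_⟩, rfl⟩
      rw [mem_dA]; simp only [map_neg, map_zsmul, hz]; simp
  have rP : Fintype.card (I ⧸ d.range) + finrank ℤ (d.ker ⊓ fixP sL : AddSubgroup L) = finrank ℤ (fixP s) := by
    have : Module.Finite ℤ (fixP s) := inferInstanceAs (Module.Finite ℤ (AddSubgroup.toIntSubmodule (fixP s)))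
    let p' : fixP s →ₗ[ℤ] ((I ⧸ d.range) → ℤ) := (AddMonoidHom.mk' (fun x : fixP s => fun c => (x.1.1.2 c).1) (by intro a b; rfl)).toIntLinearMap
    let e' : (d.ker ⊓ fixP sL : AddSubgroup L) →+ fixP s := AddMonoidHom.mk' (fun x => ⟨ek ⟨x.1, x.2.1⟩, by
      rw [mem_fixP]; apply Subtype.ext
      rw [sA_val]
      ext
      · exact (mem_fixP sL _).1 x.2.2
      · rfl
      · rfl⟩) (by intro a b; apply Subtype.ext; apply Subtype.ext; simp [hek])
    have he' : ∀ x, (e' x).1.1 = (x.1, 0) := fun x => rfl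
    have hinj : Function.Injective e' := by
      intro x y h
      exact Subtype.ext (congrArg (fun z => z.1.1.1) h)
    have hex' : LinearMap.range e'.toIntLinearMap = LinearMap.ker p' := by
      ext x
      rw [LinearMap.mem_range, LinearMap.mem_ker]
      constructor
      · rintro ⟨y, rfl⟩; rfl
      · intro h
        have hf := congrArg Subtype.val ((mem_fixP s _).1 x.2)
        rw [sA_val] at hf
        have h0 : x.1.1.2 = 0 := by
          funext c
          have h1 : (x.1.1.2 c).1 = 0 := congrFun h c
          have h2 : (x.1.1.2 c).2 = (x.1.1.2 c).1 := congrArg (fun z => (z.2 c).1) hf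
          exact Prod.ext h1 (h2.trans h1)
        refine ⟨⟨x.1.1.1, ?_, ?_⟩, ?_⟩
        · have := (mem_dA d sI _).1 x.1.2
          rw [h0, map_zero, add_zero] at this
          exact this
        · exact (mem_fixP sL _).2 (congrArg Prod.fst hf)
        · apply Subtype.ext; apply Subtype.ext
          exact Prod.ext rfl h0.symm
    rw [← fr_add p', ← hex', fr_fin_index (LinearMap.range p') _ hc0]
    · congr 1
      · simp [Module.finrank_pi_fintype]
      · exact (LinearEquiv.ofInjective e'.toIntLinearMap hinj).finrank_eq
    · intro m
      obtain ⟨z, hz⟩ := hcard (∑ c, m c • (Quotient.out c : I))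
      refine ⟨⟨⟨(-(z + sL z), fun c => ((Fintype.card (I ⧸ d.range) : ℤ) • m c, (Fintype.card (I ⧸ d.range) : ℤ) • m c)), ?_⟩, ?_⟩, rfl⟩
      · rw [mem_dA, ph_apply]; simp only [map_neg, map_add, hd, hz]
        simp only [mul_smul, smul_eq_mul]
        rw [Finset.sum_add_distrib, map_zsmul, map_sum, Finset.smul_sum, Finset.smul_sum]
        simp only [map_zsmul]
        abel
      · rw [mem_fixP]; apply Subtype.ext
        rw [sA_val]
        refine Prod.ext ?_ rfl
        simp only [map_neg, map_add, hL, add_comm]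
  obtain ⟨h1, h2, -, h4⟩ := herb s hss
  have hfm : finrank ℤ (fixM s) = finrank ℤ (fixP s) + 1 := by omega
  rw [hfm, pow_succ] at h1
  have h5 : (s - AddMonoidHom.id (dA d sI).ker).range.relIndex (fixM s) = (s + AddMonoidHom.id (dA d sI).ker).range.relIndex (fixP s) * 2 := by
    have : 0 < 2 ^ finrank ℤ (fixP s) := by positivity
    apply Nat.eq_of_mul_eq_mul_right this
    rw [← h1]; ring
  -- transfer
  have key : ∀ (a : (dA d sI).ker) (y : L) (m : Nn (I ⧸ d.range)), a.1 = (y - sL y, m - swN (I ⧸ d.range) m) → 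
      (∃ e D, sL e = e ∧ d y + ph d sI m = d e + (D + sI D)) → a ∈ (s - AddMonoidHom.id (dA d sI).ker).range := by
    rintro a y m ha ⟨e, D, he, hD⟩
    obtain ⟨z, q, rfl⟩ := ph_surj d sI D
    have hmem : (-(y - e - (z + sL z)), -(m - (q + swN (I ⧸ d.range) q))) ∈ (dA d sI).ker := by
      rw [mem_dA]
      simp only [map_neg, map_sub, map_add, hd, ph_sw d sI hI] at hD ⊢
      have := sub_eq_zero.2 hD
      rw [← neg_eq_zero, ← this]; abel
    refine ⟨⟨_, hmem⟩, ?_⟩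
    apply Subtype.ext
    rw [ha, AddMonoidHom.sub_apply, AddSubgroup.coe_sub, sA_val]
    have hsw : ∀ q, swN (I ⧸ d.range) (swN (I ⧸ d.range) q) = q := fun q => rfl
    ext1
    · simp only [map_neg, map_sub, map_add, hL, he, AddMonoidHom.id_apply, Prod.fst_sub]; abel
    · simp only [map_neg, map_sub, map_add, hsw, AddMonoidHom.id_apply, Prod.snd_sub]; abel
  have pre : ∀ a : (dA d sI).ker, a ∈ fixM s → ∃ y m, a.1 = (y - sL y, m - swN (I ⧸ d.range) m) ∧ sI (d y + ph d sI m) = d y + ph d sI m := by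
    intro a ha
    have hf := congrArg Subtype.val ((mem_fixM s _).1 ha)
    rw [sA_val] at hf
    have hf1 : sL a.1.1 = - a.1.1 := congrArg Prod.fst hf
    have hf2 : swN (I ⧸ d.range) a.1.2 = - a.1.2 := congrArg Prod.snd hf
    obtain ⟨y, hy⟩ := L90 a.1.1 (by rw [hf1]; abel)
    have hm : a.1.2 = (fun c => ((a.1.2 c).1, 0)) - swN (I ⧸ d.range) (fun c => ((a.1.2 c).1, 0)) := by
      funext c
      have : (a.1.2 c).1 = - (a.1.2 c).2 := congrArg Prod.snd (congrFun hf2 c)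
      ext
      · simp [swN_apply]
      · simp [swN_apply, this]
    refine ⟨y, _, Prod.ext hy hm, ?_⟩
    have hk := (mem_dA d sI _).1 a.2
    rw [hy, hm, map_sub, map_sub, hd, ph_sw d sI hI] at hk
    rw [map_add, ← sub_eq_zero, ← neg_eq_zero, ← hk]; abel
  have hle : (s - AddMonoidHom.id (dA d sI).ker).range.relIndex (fixM s) ≤ 2 := by
    by_contra hlt
    push Not at hlt
    have hfinq : Finite (fixM s ⧸ ((s - AddMonoidHom.id (dA d sI).ker).range.addSubgroupOf (fixM s))) := Nat.finite_of_card_ne_zero h4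
    have : Fintype (fixM s ⧸ ((s - AddMonoidHom.id (dA d sI).ker).range.addSubgroupOf (fixM s))) := Fintype.ofFinite _
    have hlt' : 2 < Fintype.card (fixM s ⧸ ((s - AddMonoidHom.id (dA d sI).ker).range.addSubgroupOf (fixM s))) := by
      rw [← Nat.card_eq_fintype_card]; exact hlt
    rw [Fintype.two_lt_card_iff] at hlt'
    obtain ⟨a, b, c, hab, hac, hbc⟩ := hlt'
    obtain ⟨a, rfl⟩ := QuotientAddGroup.mk_surjective a
    obtain ⟨b, rfl⟩ := QuotientAddGroup.mk_surjective b
    obtain ⟨c, rfl⟩ := QuotientAddGroup.mk_surjective c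
    rw [ne_comm, Ne, QuotientAddGroup.eq, AddSubgroup.mem_addSubgroupOf] at hab hac hbc
    obtain ⟨y1, m1, ha1, hi1⟩ := pre (-c + a : fixM s).1 (-c + a : fixM s).2
    obtain ⟨y2, m2, ha2, hi2⟩ := pre (-c + b : fixM s).1 (-c + b : fixM s).2
    rcases hW _ _ hi1 hi2 with h | h | h
    · exact hac (key _ _ _ ha1 h)
    · exact hbc (key _ _ _ ha2 h)
    · apply hab
      refine key _ (y1 - y2) (m1 - m2) ?_ ?_
      · have : ((-b + a : fixM s) : (dA d sI).ker).1 = ((-c + a : fixM s) : (dA d sI).ker).1 - ((-c + b : fixM s) : (dA d sI).ker).1 := by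
          simp only [AddSubgroup.coe_add, AddSubgroup.coe_neg]; abel
        rw [this, ha1, ha2]
        ext1
        · simp only [map_sub, Prod.fst_sub]; abel
        · simp only [map_sub, Prod.snd_sub]; abel
      · convert h using 6
        simp only [map_sub]; abel
  have h6 : (s + AddMonoidHom.id (dA d sI).ker).range.relIndex (fixP s) = 1 := by omega
  rw [AddSubgroup.relIndex_eq_one] at h6
  obtain ⟨y, n, hy⟩ := ph_surj d sI (-D)
  have hmem : (b + (y + sL y), n + swN (I ⧸ d.range) n) ∈ (dA d sI).ker := by
    rw [mem_dA]
    simp only [map_add, hd, ph_sw d sI hI, hbD]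
    have := congrArg sI hy
    rw [map_neg, map_add] at this
    have e1 : D = - (d y + ph d sI n) := by rw [← hy, neg_neg]
    have e2 : sI D = - (sI (d y) + sI (ph d sI n)) := by rw [← this, neg_neg]
    rw [e2, e1]; abel
  have hmp : (⟨_, hmem⟩ : (dA d sI).ker) ∈ fixP s := by
    rw [mem_fixP]; apply Subtype.ext
    rw [sA_val]
    have hsw : ∀ q, swN (I ⧸ d.range) (swN (I ⧸ d.range) q) = q := fun q => rfl
    ext1
    · simp only [map_add, hL, hb]; abel
    · simp only [map_add, hsw]; abel
  obtain ⟨x, hx⟩ := h6 hmp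
  have := congrArg (fun z => z.1.1) hx
  simp only [AddMonoidHom.add_apply, AddSubgroup.coe_add, sA_val, Prod.fst_add, AddMonoidHom.id_apply, hs] at this
  refine ⟨x.1.1 - y, ?_⟩
  rw [map_sub]
  have h7 : b = (b + (y + sL y)) - (y + sL y) := by abel
  rw [h7, ← this]; abel

end absAlg

end
end HL

namespace HL
open NumberField Module IsDedekindDomain
open scoped nonZeroDivisors Topology Pointwise

noncomputable section
open scoped Classical
set_option linter.unusedSectionVars false

section
variable {K : Type*} [Field K] [NumberField K]

theorem ker_dv_iff (x : Additive Kˣ) : x ∈ (dv : Additive Kˣ →+ Dv K).ker ↔ ∃ u : (𝓞 K)ˣ, ((x.toMul : Kˣ) : K) = ((u : 𝓞 K) : K) := by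
  constructor
  · intro h
    have h1 : ∀ P : HeightOneSpectrum (𝓞 K), P.valuation K ((x.toMul : Kˣ) : K) = 1 := by
      intro P
      rw [← ord_eq_zero_iff P (Units.ne_zero _), ← dv_apply]
      have : dv x = 0 := h
      rw [this]; rfl
    obtain ⟨u, hu⟩ := HeightOneSpectrum.mem_integers_of_valuation_le_one K ((x.toMul : Kˣ) : K) (fun P => (h1 P).le)
    obtain ⟨w, hw⟩ := HeightOneSpectrum.mem_integers_of_valuation_le_one K (((x.toMul)⁻¹ : Kˣ) : K) (fun P => by
      rw [Units.val_inv_eq_inv_val, map_inv₀, h1 P, inv_one])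
    have huw : u * w = 1 := by
      apply FaithfulSMul.algebraMap_injective (𝓞 K) K
      rw [map_mul, hu, hw, map_one, Units.mul_inv]
    exact ⟨Units.mkOfMulEqOne u w huw, hu.symm⟩
  · rintro ⟨u, hu⟩
    show dv x = 0
    ext P
    rw [dv_apply, hu, Finsupp.coe_zero, Pi.zero_apply]
    rw [ord_eq_zero_iff P (by rw [← hu]; exact Units.ne_zero _)]
    have hle := P.valuation_le_one (K := K) (u : 𝓞 K)
    have hle2 := P.valuation_le_one (K := K) ((u⁻¹ : (𝓞 K)ˣ) : 𝓞 K)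
    have hm : P.valuation K ((u : 𝓞 K) : K) * P.valuation K (((u⁻¹ : (𝓞 K)ˣ) : 𝓞 K) : K) = 1 := by
      rw [← map_mul, ← map_mul, Units.mul_inv, map_one, map_one]
    apply le_antisymm hle
    rw [← hm]
    exact mul_le_of_le_one_right' hle2

theorem fr_range_inj {A B : Type*} [AddCommGroup A] [AddCommGroup B] (f : A →+ B) (hf : Function.Injective f) (S : AddSubgroup B)
    (h : ∀ x, x ∈ S ↔ ∃ y, f y = x) : Nonempty (A ≃ₗ[ℤ] S) := by
  have : S = f.range := by ext x; rw [h]; rfl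
  subst this
  exact ⟨(AddMonoidHom.ofInjective hf).toIntLinearEquiv⟩

end

variable {E M : Type*} [Field E] [NumberField E] [Field M] [NumberField M] [Algebra E M]

/-- the action on the multiplicative group -/
def sgL (σ : M ≃ₐ[E] M) : Additive Mˣ →+ Additive Mˣ := MonoidHom.toAdditive (Units.map (σ : M →* M))

theorem sgL_val (σ : M ≃ₐ[E] M) (x : Additive Mˣ) : (((sgL σ x).toMul : Mˣ) : M) = σ ((x.toMul : Mˣ) : M) := rfl

/-- the action on divisors -/
def sgI (σ : M ≃ₐ[E] M) : Dv M →+ Dv M := Finsupp.mapDomain.addMonoidHom (sgP σ)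

theorem dvM_ext {x y : Additive Mˣ} (h : ((x.toMul : Mˣ) : M) = ((y.toMul : Mˣ) : M)) : x = y := Units.ext h

variable (σ : M ≃ₐ[E] M) (s : M) (a : E) (hs : s ^ 2 = algebraMap E M a) (hσ : σ s = -s)
  (h2 : ∀ τ : M ≃ₐ[E] M, τ = 1 ∨ τ = σ) [IsGalois E M]

include h2 in
theorem sg_sg (x : M) : σ (σ x) = x := by
  have := sigma_sq σ h2
  exact DFunLike.congr_fun this x

include h2 in
theorem sgP_sgP (P : HeightOneSpectrum (𝓞 M)) : sgP σ (sgP σ P) = P := by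
  rw [← sgP_mul, sigma_sq σ h2, sgP_one]

include h2 in
theorem sgI_apply (D : Dv M) (P) : sgI σ D P = D (sgP σ P) := by
  have hinj : Function.Injective (sgP σ : HeightOneSpectrum (𝓞 M) → _) := by
    intro P Q h
    rw [← sgP_sgP σ h2 P, h, sgP_sgP σ h2]
  conv_lhs => rw [← sgP_sgP σ h2 P]
  exact Finsupp.mapDomain_apply hinj _ _

include h2 in
theorem sgI_dv (x : Additive Mˣ) : dv (sgL σ x) = sgI σ (dv x) := by
  ext P
  rw [sgI_apply σ h2, dv_apply, dv_apply, sgL_val]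
  conv_lhs => rw [← sgP_sgP σ h2 P]
  rw [ord, ord, sgP_val]

include h2 hσ hs in
theorem L90 (ha : a ≠ 0) (x : Additive Mˣ) (hx : x + sgL σ x = 0) : ∃ y, x = y - sgL σ y := by
  have h1 : ((x.toMul : Mˣ) : M) * σ ((x.toMul : Mˣ) : M) = 1 := by
    rw [← sgL_val, ← Units.val_mul, ← toMul_add, hx]; rfl
  have hs0 : s ≠ 0 := by
    rintro rfl
    apply ha
    apply (algebraMap E M).injective
    rw [← hs]; simp
  set X := ((x.toMul : Mˣ) : M) with hX
  suffices ∃ y : M, y ≠ 0 ∧ X * σ y = y by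
    obtain ⟨y, hy, hy2⟩ := this
    refine ⟨Additive.ofMul (Units.mk0 y hy), ?_⟩
    rw [eq_sub_iff_add_eq]
    apply dvM_ext
    rw [toMul_add, Units.val_mul, sgL_val]
    exact hy2
  by_cases h : 1 + X = 0
  · refine ⟨s, hs0, ?_⟩
    rw [hσ, eq_neg_of_add_eq_zero_right h]; ring
  · refine ⟨1 + X, h, ?_⟩
    rw [map_add, map_one, mul_add, h1]; ring

include h2 in
theorem fixed_iff (x : M) : σ x = x ↔ ∃ y : E, algebraMap E M y = x := by
  constructor
  · intro h
    apply IsGalois.mem_range_algebraMap_iff_fixed x |>.2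
    intro f
    rcases h2 f with rfl | rfl
    · rfl
    · exact h
  · rintro ⟨y, rfl⟩; simp

include h2 hσ hs in
theorem inf_card (hne : σ ≠ 1) (hpos : ∀ φ : E →+* ℝ, 0 < φ a) :
    Fintype.card (InfinitePlace M) = Fintype.card (InfinitePlace E) * 2 := by
  have : IsUnramifiedAtInfinitePlaces E M := by
    constructor
    intro w
    rw [← InfinitePlace.mk_embedding w, InfinitePlace.isUnramified_mk_iff_forall_isConj]
    intro τ hτ
    rcases h2 τ with rfl | rfl
    · rfl
    exfalso
    set φ := w.embedding
    have h1 := hτ.eq s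
    rw [hσ, map_neg] at h1
    have hr := hτ.isReal_comp
    have h3 := hpos hr.embedding
    have h4 : ((hr.embedding a : ℝ) : ℂ) = φ s ^ 2 := by
      rw [ComplexEmbedding.IsReal.coe_embedding_apply, RingHom.comp_apply, ← hs, map_pow]
    have h5 : (φ s).re = 0 := by
      have := congrArg Complex.re h1
      simp at this
      linarith
    have h6 := congrArg Complex.re h4
    rw [Complex.ofReal_re, pow_two, Complex.mul_re, h5] at h6
    nlinarith [mul_self_nonneg (φ s).im]
  rw [IsUnramifiedAtInfinitePlaces.card_infinitePlace E M]
  congr 1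
  rw [← IsGalois.card_aut_eq_finrank]
  rw [Nat.card_eq_two_iff]
  exact ⟨1, σ, hne.symm, by ext τ; simpa using h2 τ⟩

theorem fin_ker : Module.Finite ℤ (dv : Additive Mˣ →+ Dv M).ker ∧ finrank ℤ (dv : Additive Mˣ →+ Dv M).ker = Units.rank M := by
  obtain ⟨e⟩ := fr_range_inj (MonoidHom.toAdditive (Units.map (algebraMap (𝓞 M) M : 𝓞 M →* M)))
    (fun x y h => by
      apply Units.ext
      apply FaithfulSMul.algebraMap_injective (𝓞 M) M
      exact congrArg Units.val h) (dv : Additive Mˣ →+ Dv M).ker (by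
      intro x
      rw [ker_dv_iff]
      constructor
      · rintro ⟨u, hu⟩; exact ⟨Additive.ofMul u, dvM_ext hu.symm⟩
      · rintro ⟨u, rfl⟩; exact ⟨u, rfl⟩)
  exact ⟨Module.Finite.equiv e, by rw [← e.finrank_eq, Units.finrank_eq]⟩

include h2 hσ hs in
theorem fin_kerP (hg : ∀ p, GoodAt p a) : finrank ℤ ((dv : Additive Mˣ →+ Dv M).ker ⊓ fixP (sgL σ) : AddSubgroup (Additive Mˣ)) = Units.rank E := by
  obtain ⟨e⟩ := fr_range_inj (MonoidHom.toAdditive (Units.map ((algebraMap E M).comp (algebraMap (𝓞 E) E) : 𝓞 E →* M)))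
    (fun x y h => by
      apply Units.ext
      apply FaithfulSMul.algebraMap_injective (𝓞 E) E
      apply (algebraMap E M).injective
      exact congrArg Units.val h) ((dv : Additive Mˣ →+ Dv M).ker ⊓ fixP (sgL σ)) (by
      intro x
      rw [AddSubgroup.mem_inf, mem_fixP]
      constructor
      · rintro ⟨h1, h3⟩
        have h4 := congrArg (fun z : Additive Mˣ => ((z.toMul : Mˣ) : M)) h3
        simp only [sgL_val] at h4
        obtain ⟨y, hy⟩ := (fixed_iff σ h2 _).1 h4
        have hy0 : y ≠ 0 := by
          rintro rfl
          rw [map_zero] at hy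
          exact Units.ne_zero _ hy.symm
        have h5 : Additive.ofMul (Units.mk0 y hy0) ∈ (dv : Additive Eˣ →+ Dv E).ker := by
          show dv _ = 0
          ext p
          obtain ⟨P, rfl⟩ := dn_surj (M := M) p
          rw [dv_apply, Finsupp.coe_zero, Pi.zero_apply, ord_eq_zero_iff _ (Units.ne_zero _)]
          rw [← val_eq σ s a hs hσ h2 P (hg _)]
          simp only [toMul_ofMul, Units.val_mk0, hy]
          rw [← ord_eq_zero_iff _ (Units.ne_zero _), ← dv_apply]
          have : dv x = 0 := h1
          rw [this]; rfl
        obtain ⟨u, hu⟩ := (ker_dv_iff _).1 h5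
        refine ⟨Additive.ofMul u, dvM_ext ?_⟩
        rw [← hy]
        exact congrArg (algebraMap E M) hu.symm
      · rintro ⟨u, rfl⟩
        constructor
        · rw [ker_dv_iff]
          exact ⟨Units.map (algebraMap (𝓞 E) (𝓞 M) : 𝓞 E →* 𝓞 M) u.toMul, rfl⟩
        · apply dvM_ext
          rw [sgL_val]
          exact σ.commutes _)
  rw [← e.finrank_eq, Units.finrank_eq]

end
end HL

namespace HL
open NumberField Module IsDedekindDomain
open scoped nonZeroDivisors Topology Pointwise

noncomputable section
open scoped Classical
set_option linter.unusedSectionVars false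

/-- two distinct nonzero characters of an exponent two group -/
theorem two_chars {V : Type*} [AddCommGroup V] (hV : ∀ v : V, 2 • v = 0) (v1 v2 : V) (h1 : v1 ≠ 0) (h2 : v2 ≠ 0) (h12 : v1 ≠ v2) :
    ∃ f g : V →+ ZMod 2, f ≠ 0 ∧ g ≠ 0 ∧ f ≠ g := by
  let _ : Module (ZMod 2) V := AddCommGroup.zmodModule hV
  have key : ∀ v : V, v ≠ 0 → ∃ f : V →+ ZMod 2, f v ≠ 0 := by
    intro v hv
    by_contra hc
    push Not at hc
    exact hv ((Module.forall_dual_apply_eq_zero_iff (ZMod 2) v).1 fun φ => hc φ.toAddMonoidHom)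
  obtain ⟨f, hf⟩ := key v1 h1
  obtain ⟨g, hg⟩ := key v2 h2
  obtain ⟨k, hk⟩ := key (v1 - v2) (sub_ne_zero.2 h12)
  have nz : ∀ (f : V →+ ZMod 2) v, f v ≠ 0 → f ≠ 0 := by rintro f v h rfl; exact h rfl
  by_cases hfg : f = g
  · subst hfg
    refine ⟨f, k, nz _ _ hf, nz _ _ hk, ?_⟩
    rintro rfl
    apply hk
    have : ∀ x y : ZMod 2, x ≠ 0 → y ≠ 0 → x - y = 0 := by decide
    rw [map_sub]; exact this _ _ hf hg
  · exact ⟨f, g, nz _ _ hf, nz _ _ hg, hfg⟩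

/-- sign character -/
def sgnZ : Multiplicative (ZMod 2) →* ℤˣ where
  toFun x := if x.toAdd = 0 then 1 else -1
  map_one' := by simp
  map_mul' := by
    intro x y
    have : ∀ x y : ZMod 2, (if x + y = 0 then (1 : ℤˣ) else -1) = (if x = 0 then 1 else -1) * (if y = 0 then 1 else -1) := by decide
    exact this x.toAdd y.toAdd

theorem sgnZ_one (x : ZMod 2) : sgnZ (Multiplicative.ofAdd x) = 1 ↔ x = 0 := by
  show (if x = 0 then (1 : ℤˣ) else -1) = 1 ↔ x = 0
  revert x; decide

variable {E M : Type*} [Field E] [NumberField E] [Field M] [NumberField M] [Algebra E M]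

theorem dv_char (f : Dv E →+ ZMod 2) (hf : ∀ x, f (dv x) = 0) :
    ∃ χ : ClassGroup (𝓞 E) →* ℤˣ, (∀ p, χ (ClassGroup.mk0 (pI p)) = sgnZ (Multiplicative.ofAdd (f (Finsupp.single p 1)))) := by
  obtain ⟨χ, hχ⟩ := class_lift f hf
  refine ⟨sgnZ.comp χ, fun p => ?_⟩
  rw [MonoidHom.comp_apply, hχ, dI_prime]

theorem dv_ne (f : Dv E →+ ZMod 2) (hf : f ≠ 0) : ∃ p, f (Finsupp.single p 1) ≠ 0 := by
  by_contra h
  push Not at h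
  apply hf
  ext p
  simpa using h p

variable (σ : M ≃ₐ[E] M) (s : M) (a : E) (hs : s ^ 2 = algebraMap E M a) (hσ : σ s = -s)
  (h2 : ∀ τ : M ≃ₐ[E] M, τ = 1 ∨ τ = σ) [IsGalois E M]

include h2 in
theorem jfin (D : Dv E) : (Function.support fun P : HeightOneSpectrum (𝓞 M) => D (dn P)).Finite := by
  have : (Function.support fun P : HeightOneSpectrum (𝓞 M) => D (dn P)) ⊆ ⋃ p ∈ D.support, {P | dn P = p} := by
    intro P hP
    simp only [Set.mem_iUnion]
    exact ⟨dn P, by simpa using hP, rfl⟩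
  refine Set.Finite.subset (Set.Finite.biUnion D.support.finite_toSet fun p _ => ?_) this
  obtain ⟨P, rfl⟩ := dn_surj (M := M) p
  refine (Set.toFinite {P, sgP σ P}).subset fun Q hQ => ?_
  simpa using (dn_eq_iff σ h2 P Q).1 hQ

/-- extension of divisors -/
def jD : Dv E →+ Dv M :=
  AddMonoidHom.mk' (fun D => Finsupp.ofSupportFinite _ (jfin σ h2 D)) (by intro D D'; ext P; rfl)

theorem jD_apply (D : Dv E) (P : HeightOneSpectrum (𝓞 M)) : jD σ h2 D P = D (dn P) := rfl

include hs hσ in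
theorem jD_dv (hg : ∀ p, GoodAt p a) (x : Additive Eˣ) : jD σ h2 (dv x) = dv (MonoidHom.toAdditive (Units.map (algebraMap E M : E →* M)) x) := by
  ext P
  rw [jD_apply, dv_apply, dv_apply, ord, ord, ← val_eq σ s a hs hσ h2 P (hg _)]
  rfl

/-- a section of `dn` -/
def Tsec (M : Type*) [Field M] [NumberField M] [Algebra E M] [IsGalois E M] (p : HeightOneSpectrum (𝓞 E)) : HeightOneSpectrum (𝓞 M) := Classical.choose (dn_surj (M := M) p)

theorem dn_Tsec (p : HeightOneSpectrum (𝓞 E)) : dn (Tsec M p) = p := Classical.choose_spec (dn_surj (M := M) p)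

include h2 in
theorem Tsec_or (P : HeightOneSpectrum (𝓞 M)) : Tsec M (dn (E := E) P) = P ∨ Tsec M (dn (E := E) P) = sgP σ P :=
  (dn_eq_iff σ h2 P _).1 (dn_Tsec _)

theorem jD_norm (B : Dv E) (hB : ∀ P : HeightOneSpectrum (𝓞 M), sgP σ P = P → Even (B (dn P))) :
    ∃ D : Dv M, jD σ h2 B = D + sgI σ D := by
  let D0 : HeightOneSpectrum (𝓞 M) → ℤ := fun P => if sgP σ P = P then B (dn P) / 2 else if P = Tsec M (dn (E := E) P) then B (dn P) else 0
  have hfin : D0.support.Finite := by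
    refine (jfin (M := M) σ h2 B).subset fun P hP hc => hP ?_
    have hc' : B (dn P) = 0 := hc
    show (if sgP σ P = P then B (dn P) / 2 else if P = Tsec M (dn (E := E) P) then B (dn P) else 0) = 0
    rw [hc']; simp
  refine ⟨Finsupp.ofSupportFinite D0 hfin, ?_⟩
  ext P
  rw [Finsupp.add_apply, sgI_apply σ h2, jD_apply]
  show _ = D0 P + D0 (sgP σ P)
  simp only [D0, sgP_sgP σ h2, dn_sgP]
  by_cases h : sgP σ P = P
  · obtain ⟨k, hk⟩ := hB P h
    rw [if_pos h, if_pos h.symm]; omega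
  · rw [if_neg h, if_neg (Ne.symm h)]
    rcases Tsec_or σ h2 P with h3 | h3
    · rw [if_pos h3.symm, h3, if_neg h, add_zero]
    · rw [if_neg (by rw [h3]; exact Ne.symm h), if_pos h3.symm, zero_add]

theorem jD_surj (y : Dv M) (hy : sgI σ y = y) : ∃ D, y = jD σ h2 D := by
  have hinj : Function.Injective (Tsec M : HeightOneSpectrum (𝓞 E) → HeightOneSpectrum (𝓞 M)) := by
    intro p q h
    rw [← dn_Tsec (M := M) p, h, dn_Tsec]
  refine ⟨Finsupp.comapDomain (Tsec M) y hinj.injOn, ?_⟩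
  ext P
  rw [jD_apply, Finsupp.comapDomain_apply]
  rcases Tsec_or σ h2 P with h3 | h3
  · rw [h3]
  · rw [h3, ← sgI_apply σ h2, hy]

theorem sgI_jD (D : Dv E) : sgI σ (jD σ h2 D) = jD σ h2 D := by
  ext P
  rw [sgI_apply σ h2, jD_apply, jD_apply, dn_sgP]

/-- the norm-trivial divisors -/
def Wg : AddSubgroup (Dv E) where
  carrier := {B | ∃ e D, sgL σ e = e ∧ jD σ h2 B = dv e + (D + sgI σ D)}
  zero_mem' := ⟨0, 0, by simp⟩
  add_mem' := by
    rintro B B' ⟨e, D, h, h'⟩ ⟨e', D', k, k'⟩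
    refine ⟨e + e', D + D', by rw [map_add, h, k], ?_⟩
    rw [map_add, h', k', map_add, map_add]; abel
  neg_mem' := by
    rintro B ⟨e, D, h, h'⟩
    refine ⟨-e, -D, by rw [map_neg, h], ?_⟩
    rw [map_neg, h', map_neg, map_neg]; abel

theorem mem_Wg (B : Dv E) : B ∈ Wg σ h2 ↔ ∃ e D, sgL σ e = e ∧ jD σ h2 B = dv e + (D + sgI σ D) := Iff.rfl

include hs hσ h2 in
theorem hW_claim (hne : σ ≠ 1) (hg : ∀ p, GoodAt p a) (y1 y2 : Dv M) (i1 : sgI σ y1 = y1) (i2 : sgI σ y2 = y2) :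
    (∃ e D, sgL σ e = e ∧ y1 = dv e + (D + sgI σ D)) ∨ (∃ e D, sgL σ e = e ∧ y2 = dv e + (D + sgI σ D)) ∨
      (∃ e D, sgL σ e = e ∧ y1 - y2 = dv e + (D + sgI σ D)) := by
  obtain ⟨B1, rfl⟩ := jD_surj σ h2 y1 i1
  obtain ⟨B2, rfl⟩ := jD_surj σ h2 y2 i2
  rw [← map_sub, ← mem_Wg, ← mem_Wg, ← mem_Wg]
  by_contra hc
  push Not at hc
  obtain ⟨c1, c2, c3⟩ := hc
  obtain ⟨f, g, hf, hg0, hfg⟩ := two_chars (V := Dv E ⧸ Wg σ h2) (by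
    rintro ⟨B⟩
    show 2 • (QuotientAddGroup.mk B : Dv E ⧸ Wg σ h2) = 0
    rw [← QuotientAddGroup.mk_nsmul, QuotientAddGroup.eq_zero_iff, mem_Wg]
    exact ⟨0, jD σ h2 B, map_zero _, by rw [sgI_jD, map_nsmul, map_zero, zero_add, two_nsmul]⟩)
    (QuotientAddGroup.mk B1) (QuotientAddGroup.mk B2)
    (by rwa [Ne, QuotientAddGroup.eq_zero_iff]) (by rwa [Ne, QuotientAddGroup.eq_zero_iff])
    (by
      rw [ne_comm, Ne, QuotientAddGroup.eq, neg_add_eq_sub]; exact c3)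
  have hWdv : ∀ x : Additive Eˣ, (QuotientAddGroup.mk (dv x) : Dv E ⧸ Wg σ h2) = 0 := by
    intro x
    rw [QuotientAddGroup.eq_zero_iff, mem_Wg, jD_dv σ s a hs hσ h2 hg]
    refine ⟨MonoidHom.toAdditive (Units.map (algebraMap E M : E →* M)) x, 0, ?_, by rw [map_zero, add_zero, add_zero]⟩
    apply dvM_ext
    rw [sgL_val]
    exact σ.commutes _
  have hWs : ∀ P : HeightOneSpectrum (𝓞 M), sgP σ P ≠ P → (QuotientAddGroup.mk (Finsupp.single (dn P) 1) : Dv E ⧸ Wg σ h2) = 0 := by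
    intro P hP
    rw [QuotientAddGroup.eq_zero_iff, mem_Wg]
    obtain ⟨D, hD⟩ := jD_norm σ h2 (Finsupp.single (dn P) 1) (by
      intro Q hQ
      by_cases h : dn (E := E) Q = dn P
      · exfalso
        rcases (dn_eq_iff σ h2 P Q).1 h with rfl | rfl
        · exact hP hQ
        · rw [sgP_sgP σ h2] at hQ; exact hP hQ.symm
      · rw [Finsupp.single_eq_of_ne h]; simp)
    exact ⟨0, D, map_zero _, by rw [map_zero, zero_add, hD]⟩
  let π := QuotientAddGroup.mk' (Wg σ h2)
  have hsurj : Function.Surjective π := QuotientAddGroup.mk'_surjective _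
  obtain ⟨χ₁, hχ₁⟩ := dv_char (f.comp π) (by
    intro x; show f (QuotientAddGroup.mk (dv x)) = 0; rw [hWdv, map_zero])
  obtain ⟨χ₂, hχ₂⟩ := dv_char (g.comp π) (by
    intro x; show g (QuotientAddGroup.mk (dv x)) = 0; rw [hWdv, map_zero])
  refine no_two_chars (dn : HeightOneSpectrum (𝓞 M) → HeightOneSpectrum (𝓞 E)) χ₁ χ₂ ?_ ?_ ?_ ?_
  · intro p
    obtain ⟨P, rfl⟩ := dn_surj (M := M) p
    obtain ⟨n1, n2⟩ := norm_split σ s a hs hσ h2 hne P (hg _)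
    by_cases hP : sgP σ P = P
    · right
      refine ⟨P, fun Q => ?_, n2 hP⟩
      rw [dn_eq_iff σ h2, hP, or_self]
    · left
      refine ⟨?_, ?_, P, sgP σ P, Ne.symm hP, fun Q => dn_eq_iff σ h2 P Q, n1 hP, ?_⟩
      · rw [hχ₁, sgnZ_one]; show f (QuotientAddGroup.mk _) = 0; rw [hWs P hP, map_zero]
      · rw [hχ₂, sgnZ_one]; show g (QuotientAddGroup.mk _) = 0; rw [hWs P hP, map_zero]
      · have := (norm_split σ s a hs hσ h2 hne (sgP σ P) (hg _)).1 (by rw [sgP_sgP σ h2]; exact Ne.symm hP)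
        rw [this, dn_sgP]
  · obtain ⟨p, hp⟩ := dv_ne (f.comp π) (by
      intro h; apply hf
      refine AddMonoidHom.ext fun v => ?_; obtain ⟨v, rfl⟩ := hsurj v; exact DFunLike.congr_fun h v)
    rintro rfl
    exact hp ((sgnZ_one _).1 (hχ₁ p).symm)
  · obtain ⟨p, hp⟩ := dv_ne (g.comp π) (by
      intro h; apply hg0
      refine AddMonoidHom.ext fun v => ?_; obtain ⟨v, rfl⟩ := hsurj v; exact DFunLike.congr_fun h v)
    rintro rfl
    exact hp ((sgnZ_one _).1 (hχ₂ p).symm)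
  · obtain ⟨p, hp⟩ := dv_ne ((f + g).comp π) (by
      intro h; apply hfg
      refine AddMonoidHom.ext fun v => ?_; obtain ⟨v, rfl⟩ := hsurj v
      have := DFunLike.congr_fun h v
      have h0 : f (π v) + g (π v) = 0 := this
      have : ∀ x y : ZMod 2, x + y = 0 → x = y := by decide
      exact this _ _ h0)
    intro h
    apply hp
    have := DFunLike.congr_fun h (ClassGroup.mk0 (pI p))
    rw [MonoidHom.mul_apply, hχ₁, hχ₂, ← map_mul, ← ofAdd_add, MonoidHom.one_apply, sgnZ_one] at this
    exact this

theorem EvAt_even (p : HeightOneSpectrum (𝓞 E)) (b : E) (hb : b ≠ 0) (h : EvAt p b) : Even (ord p b) := by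
  obtain ⟨t, ht, h⟩ := h
  rw [← ord_eq_zero_iff p (mul_ne_zero hb (pow_ne_zero 2 ht)), pow_two, ord_mul p hb (mul_ne_zero ht ht), ord_mul p ht ht] at h
  exact ⟨- ord p t, by omega⟩

include hs hσ h2 in
theorem star_M (hne : σ ≠ 1) (ha : a ≠ 0) (hpos : ∀ φ : E →+* ℝ, 0 < φ a) (b : E) (hb : b ≠ 0)
    (hg : ∀ p : HeightOneSpectrum (𝓞 E), SqAt p a ∨ (p.valuation E 2 = 1 ∧ EvAt p a ∧ EvAt p b)) :
    ∃ y : M, algebraMap E M b = y * σ y := by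
  have hg' : ∀ p, GoodAt p a := fun p => (hg p).imp id fun h => ⟨h.1, h.2.1⟩
  have := (dv_quot_finite (K := M))
  have := (fin_ker (M := M)).1
  have hc := inf_card σ s a hs hσ h2 hne hpos
  obtain ⟨D, hD⟩ := jD_norm σ h2 (dv (Additive.ofMul (Units.mk0 b hb))) (by
    intro P hP
    rw [dv_apply]
    apply EvAt_even _ _ hb
    rcases hg (dn P) with h | h
    · obtain ⟨θ, t1, t2, t3⟩ := theta_sq σ s a hs hσ P h
      exact absurd hP (split_ne σ P θ t1 t2)
    · exact h.2.2)
  rw [jD_dv σ s a hs hσ h2 hg'] at hD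
  obtain ⟨y, hy⟩ := abs_main (dv : Additive Mˣ →+ Dv M) (sgI σ) (sgL σ)
    (fun x => by ext P; rw [sgI_apply σ h2, sgI_apply σ h2, sgP_sgP σ h2])
    (fun x => dvM_ext (by rw [sgL_val, sgL_val, sg_sg σ h2]))
    (sgI_dv σ h2) (L90 σ s a hs hσ h2 ha)
    (by
      rw [(fin_ker (M := M)).2, fin_kerP σ s a hs hσ h2 hg', Units.rank, Units.rank, hc]
      have : 0 < Fintype.card (InfinitePlace E) := Fintype.card_pos
      omega)
    (hW_claim σ s a hs hσ h2 hne hg') _ D (dvM_ext (by rw [sgL_val]; exact σ.commutes _)) hD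
  refine ⟨((y.toMul : Mˣ) : M), ?_⟩
  rw [← sgL_val, ← Units.val_mul, ← toMul_add, ← hy]
  rfl

end
end HL

namespace HL
open NumberField Module IsDedekindDomain
open scoped nonZeroDivisors Topology Pointwise

noncomputable section
open scoped Classical
set_option linter.unusedSectionVars false

universe u
theorem exists_quad {E : Type u} [Field E] [NumberField E] (a : E) (ha : ∀ r : E, r ^ 2 ≠ a) :
    ∃ (M : Type u) (_ : Field M) (_ : NumberField M) (_ : Algebra E M) (_ : IsGalois E M) (σ : M ≃ₐ[E] M) (s : M),
      s ^ 2 = algebraMap E M a ∧ σ s = -s ∧ σ ≠ 1 ∧ (∀ τ : M ≃ₐ[E] M, τ = 1 ∨ τ = σ) := by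
  have hirr : Irreducible (Polynomial.X ^ 2 - Polynomial.C a) := X_pow_sub_C_irreducible_of_prime Nat.prime_two ha
  have : Fact (Irreducible (Polynomial.X ^ 2 - Polynomial.C a)) := ⟨hirr⟩
  have hmon : (Polynomial.X ^ 2 - Polynomial.C a).Monic := Polynomial.monic_X_pow_sub_C a two_ne_zero
  let M := AdjoinRoot (Polynomial.X ^ 2 - Polynomial.C a)
  have hfin : Module.Finite E M := hmon.finite_adjoinRoot
  have hN : NumberField M := NumberField.of_module_finite E M
  have hrk : finrank E M = 2 := by
    rw [(AdjoinRoot.powerBasis hirr.ne_zero).finrank, AdjoinRoot.powerBasis_dim, Polynomial.natDegree_X_pow_sub_C]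
  have hq : Algebra.IsQuadraticExtension E M := ⟨hrk⟩
  have hG : IsGalois E M := inferInstance
  have hcard : Nat.card (M ≃ₐ[E] M) = 2 := by rw [IsGalois.card_aut_eq_finrank, hrk]
  let s : M := AdjoinRoot.root _
  have hs : s ^ 2 = algebraMap E M a := by
    have := AdjoinRoot.eval₂_root (Polynomial.X ^ 2 - Polynomial.C a)
    rw [Polynomial.eval₂_sub, Polynomial.eval₂_pow, Polynomial.eval₂_X, Polynomial.eval₂_C, sub_eq_zero] at this
    exact this
  rw [Nat.card_eq_two_iff' 1] at hcard
  obtain ⟨σ, hσ, huniq⟩ := hcard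
  refine ⟨M, inferInstance, hN, inferInstance, hG, σ, s, hs, ?_, hσ, ?_⟩
  · have h1 : σ s ^ 2 = s ^ 2 := by rw [← map_pow, hs, AlgEquiv.commutes]
    rcases sq_eq_sq_iff_eq_or_eq_neg.1 h1 with h | h
    · exfalso
      apply hσ
      have : (σ : M →ₐ[E] M) = AlgHom.id E M := AdjoinRoot.algHom_ext h
      exact AlgEquiv.ext fun x => DFunLike.congr_fun this x
    · exact h
  · intro τ
    by_cases h : τ = 1
    · exact Or.inl h
    · exact Or.inr (huniq τ h)

theorem star_E {E : Type u} [Field E] [NumberField E] (a b : E) (ha : a ≠ 0) (hpos : ∀ φ : E →+* ℝ, 0 < φ a) (hb : b ≠ 0)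
    (hg : ∀ p : HeightOneSpectrum (𝓞 E), SqAt p a ∨ (p.valuation E 2 = 1 ∧ EvAt p a ∧ EvAt p b)) :
    ∃ x y : E, b = x ^ 2 - a * y ^ 2 := by
  by_cases hsq : ∃ r, r ^ 2 = a
  · obtain ⟨r, rfl⟩ := hsq
    have hr : r ≠ 0 := by rintro rfl; simp at ha
    refine ⟨(b + 1) / 2, (b - 1) / (2 * r), ?_⟩
    field_simp; ring
  · push Not at hsq
    obtain ⟨M, _, _, _, _, σ, s, hs, hσ, hne, h2⟩ := exists_quad a hsq
    obtain ⟨y, hy⟩ := star_M σ s a hs hσ h2 hne ha hpos b hb hg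
    have hs0 : s ≠ 0 := by
      rintro rfl
      apply ha
      apply (algebraMap E M).injective
      rw [← hs]; simp
    have h22 : σ 2 = 2 := map_ofNat σ 2
    obtain ⟨p, hp⟩ := (fixed_iff σ h2 ((y + σ y) / 2)).1 (by
      rw [map_div₀, map_add, sg_sg σ h2, add_comm, h22])
    obtain ⟨q, hq⟩ := (fixed_iff σ h2 ((y - σ y) / (2 * s))).1 (by
      rw [map_div₀, map_sub, sg_sg σ h2, map_mul, hσ, h22]; field_simp; ring)
    refine ⟨p, q, ?_⟩
    apply (algebraMap E M).injective
    rw [hy, map_sub, map_mul, map_pow, map_pow, hp, hq, ← hs]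
    field_simp; ring

end
end HL

namespace HL
open NumberField Module IsDedekindDomain
open scoped nonZeroDivisors Topology Pointwise

noncomputable section
open scoped Classical
set_option linter.unusedSectionVars false

/-- values of the norm form of the quaternion algebra (b,c) -/
def Nr {F : Type*} [Field F] (b c : F) : Set F := {t | ∃ x y z w : F, t = (x ^ 2 - b * y ^ 2) - c * (z ^ 2 - b * w ^ 2)}

section Nr
variable {F : Type*} [Field F] {b c : F}

theorem Nr_mul {s t : F} (hs : s ∈ Nr b c) (ht : t ∈ Nr b c) : s * t ∈ Nr b c := by
  obtain ⟨x, y, z, w, rfl⟩ := hs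
  obtain ⟨x', y', z', w', rfl⟩ := ht
  exact ⟨x * x' + b * y * y' + c * z * z' - b * c * w * w', x * y' + y * x' - c * z * w' + c * w * z',
    x * z' + z * x' + b * y * w' - b * w * y', x * w' + w * x' + y * z' - z * y', by ring⟩

theorem Nr_sq (t : F) : t ^ 2 ∈ Nr b c := ⟨t, 0, 0, 0, by ring⟩

theorem Nr_div {s t : F} (hs : s ∈ Nr b c) (ht : t ∈ Nr b c) : s / t ∈ Nr b c := by
  rcases eq_or_ne t 0 with rfl | h0
  · exact ⟨0, 0, 0, 0, by simp⟩
  have : s / t = s * t * (1 / t) ^ 2 := by field_simp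
  rw [this]
  exact Nr_mul (Nr_mul hs ht) (Nr_sq _)

theorem Nr_swap : Nr b c = Nr c b := by
  ext t
  constructor
  · rintro ⟨x, y, z, w, rfl⟩; exact ⟨x, z, y, w, by ring⟩
  · rintro ⟨x, y, z, w, rfl⟩; exact ⟨x, z, y, w, by ring⟩

theorem Nr_twist (hb : b ≠ 0) : Nr b (-(b * c)) = Nr b c := by
  ext t
  constructor
  · rintro ⟨x, y, z, w, rfl⟩; exact ⟨x, y, b * w, z, by ring⟩
  · rintro ⟨x, y, z, w, rfl⟩; exact ⟨x, y, w, z / b, by field_simp; ring⟩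

theorem Nr_norm (n p q : F) (hn : n = p ^ 2 - b * q ^ 2) (hn0 : n ≠ 0) : Nr b (c * n) = Nr b c := by
  have hn0' : p ^ 2 - b * q ^ 2 ≠ 0 := hn ▸ hn0
  ext t
  constructor
  · rintro ⟨x, y, z, w, rfl⟩; exact ⟨x, y, p * z + b * q * w, p * w + q * z, by rw [hn]; ring⟩
  · rintro ⟨x, y, z, w, rfl⟩
    refine ⟨x, y, (p * z - b * q * w) / n, (p * w - q * z) / n, ?_⟩
    rw [hn]; field_simp; ring

theorem Nr_scale (t : F) (ht : t ≠ 0) : Nr b (c * t ^ 2) = Nr b c :=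
  Nr_norm _ t 0 (by ring) (pow_ne_zero 2 ht)

theorem Nr_scale' (t : F) (ht : t ≠ 0) : Nr (b * t ^ 2) c = Nr b c := by
  rw [Nr_swap, Nr_scale t ht, Nr_swap]

end Nr

section loc
variable {F : Type*} [Field F] [NumberField F] (p : HeightOneSpectrum (𝓞 F))

theorem SqAt_mul {s t : F} (hs : SqAt p s) (ht : SqAt p t) : SqAt p (s * t) := by
  obtain ⟨z, hz, h⟩ := hs
  obtain ⟨w, hw, k⟩ := ht
  refine ⟨z * w, mul_ne_zero hz hw, ?_⟩
  have e : s * t / (z * w) ^ 2 - 1 = (s / z ^ 2 - 1) * (t / w ^ 2) + (t / w ^ 2 - 1) := by field_simp; ring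
  have k1 : p.valuation F (t / w ^ 2) ≤ 1 := by
    have : t / w ^ 2 = (t / w ^ 2 - 1) + 1 := by ring
    rw [this]
    exact (Valuation.map_add _ _ _).trans (max_le (k.le.trans (val_four_le p)) (by simp))
  rw [e]
  refine Valuation.map_add_lt _ ?_ k
  rw [map_mul]
  exact lt_of_le_of_lt (mul_le_of_le_one_right' k1) h

theorem SqAt_of_val {t : F} (h : p.valuation F (t - 1) < p.valuation F 4) : SqAt p t := ⟨1, one_ne_zero, by simpa using h⟩

theorem SqAt_sq {t : F} (ht : t ≠ 0) : SqAt p (t ^ 2) := ⟨t, ht, by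
  rw [div_self (pow_ne_zero 2 ht), sub_self, map_zero, zero_lt_iff]
  simp⟩

variable (b c : F)

/-- `t` is a reduced norm locally -/
def InH (t : F) : Prop := t ≠ 0 ∧ ∃ n ∈ Nr b c, n ≠ 0 ∧ SqAt p (t * n)

variable {b c}

theorem InH_mul {s t : F} (hs : InH p b c s) (ht : InH p b c t) : InH p b c (s * t) := by
  obtain ⟨h0, n, hn, hn0, h⟩ := hs
  obtain ⟨k0, m, hm, hm0, k⟩ := ht
  refine ⟨mul_ne_zero h0 k0, n * m, Nr_mul hn hm, mul_ne_zero hn0 hm0, ?_⟩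
  have : s * t * (n * m) = (s * n) * (t * m) := by ring
  rw [this]; exact SqAt_mul p h k

theorem InH_nr {t : F} (ht : t ∈ Nr b c) (h0 : t ≠ 0) : InH p b c t :=
  ⟨h0, t, ht, h0, by rw [← pow_two]; exact SqAt_sq p h0⟩

theorem InH_loc {t : F} (h0 : t ≠ 0) (h : SqAt p t) : InH p b c t :=
  ⟨h0, 1, by simpa using Nr_sq (b := b) (c := c) 1, one_ne_zero, by simpa using h⟩

theorem InH_div {s t : F} (hs : InH p b c s) (ht : InH p b c t) : InH p b c (s / t) := by
  have : s / t = s * t * (1 / t) ^ 2 := by have := ht.1; field_simp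
  rw [this]
  exact InH_mul p (InH_mul p hs ht) (InH_nr p (Nr_sq _) (pow_ne_zero 2 (one_div_ne_zero ht.1)))

theorem InH_of_mul {s t : F} (hs : InH p b c (s * t)) (ht : InH p b c t) : InH p b c s := by
  have := InH_div p hs ht
  rwa [mul_div_cancel_right₀ _ ht.1] at this

theorem InH_congr {b' c' : F} (h : Nr b c = Nr b' c') {t : F} : InH p b c t ↔ InH p b' c' t := by
  unfold InH; rw [h]

variable {π : F} (hπ : p.valuation F π = WithZero.exp (-1 : ℤ))

include hπ in
theorem pi_ne : π ≠ 0 := by rintro rfl; rw [map_zero] at hπ; exact WithZero.exp_ne_zero hπ.symm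

include hπ in
theorem pi_lt : p.valuation F π < 1 := by
  rw [hπ, ← WithZero.exp_zero, WithZero.exp_lt_exp]; norm_num

include hπ in
theorem lt_one_iff (x : F) : p.valuation F x < 1 ↔ p.valuation F x ≤ p.valuation F π := by
  constructor
  · intro h
    rcases eq_or_ne x 0 with rfl | hx
    · simp
    rw [val_eq_exp p hx, ← WithZero.exp_zero, WithZero.exp_lt_exp] at h
    rw [val_eq_exp p hx, hπ, WithZero.exp_le_exp]; omega
  · intro h; exact h.trans_lt (pi_lt p hπ)

include hπ in
theorem factor (x : F) (i : ℕ) (h : p.valuation F x ≤ p.valuation F π ^ i) : ∃ u, p.valuation F u ≤ 1 ∧ x = π ^ i * u := by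
  have hp := pi_ne p hπ
  refine ⟨x / π ^ i, ?_, by field_simp⟩
  rw [map_div₀, map_pow]
  exact div_le_one_of_le₀ h (zero_le)

include hπ in
theorem norm_ord (x : F) (hx : x ≠ 0) : ∃ t, t ≠ 0 ∧ (p.valuation F (x * t ^ 2) = 1 ∨ p.valuation F (x * t ^ 2) = p.valuation F π) := by
  have hp := pi_ne p hπ
  have key : ∀ k : ℤ, p.valuation F (x * (π ^ (-k)) ^ 2) = WithZero.exp (- ord p x + 2 * k) := by
    intro k
    rw [map_mul, map_pow, map_zpow₀, hπ, val_eq_exp p hx, ← WithZero.exp_zsmul, ← WithZero.exp_nsmul, ← WithZero.exp_add]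
    congr 1; simp
  rcases Int.even_or_odd' (ord p x) with ⟨k, hk | hk⟩
  · refine ⟨π ^ (-k), zpow_ne_zero _ hp, Or.inl ?_⟩
    rw [key, ← WithZero.exp_zero]; congr 1; omega
  · refine ⟨π ^ (-k), zpow_ne_zero _ hp, Or.inr ?_⟩
    rw [key, hπ]; congr 1; omega

include hπ in
theorem exists_e : ∃ e : ℕ, p.valuation F 2 = p.valuation F π ^ e := by
  have h20 : (2 : F) ≠ 0 := two_ne_zero
  have h := val_nat_le p 2
  rw [Nat.cast_ofNat, val_eq_exp p h20, ← WithZero.exp_zero, WithZero.exp_le_exp] at h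
  obtain ⟨e, he⟩ := Int.eq_ofNat_of_zero_le (show 0 ≤ ord p (2 : F) by omega)
  refine ⟨e, ?_⟩
  rw [val_eq_exp p h20, hπ, ← WithZero.exp_nsmul, he]; congr 1; simp

theorem val_one_of_sub {t : F} (h : p.valuation F (t - 1) < 1) : p.valuation F t = 1 := by
  have : t = 1 + (t - 1) := by ring
  rw [this, Valuation.map_add_eq_of_lt_left]
  · simp
  · simpa using h

include hπ in
theorem climb (H : ∀ (i : ℕ) (u : F), 1 ≤ i → p.valuation F u ≤ 1 → ∃ h, InH p b c h ∧ p.valuation F (h - (1 + π ^ i * u)) ≤ p.valuation F π ^ (i + 1))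
    (t : F) (ht : p.valuation F (t - 1) < 1) : InH p b c t := by
  obtain ⟨e, he⟩ := exists_e p hπ
  have hlt := pi_lt p hπ
  have hpos : 0 < p.valuation F π := by rw [zero_lt_iff]; simpa using pi_ne p hπ
  have ne0 : ∀ t : F, p.valuation F (t - 1) < 1 → t ≠ 0 := by
    rintro t ht rfl; simp at ht
  have key : ∀ k : ℕ, ∀ i : ℕ, 1 ≤ i → 2 * e + 1 ≤ i + k → ∀ t : F, p.valuation F (t - 1) ≤ p.valuation F π ^ i → InH p b c t := by
    intro k
    induction k with
    | zero =>
      intro i h1 hi t ht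
      apply InH_loc p (ne0 t (ht.trans_lt (pow_lt_one₀ zero_le hlt (by omega))))
      apply SqAt_of_val
      refine ht.trans_lt ?_
      have : (4 : F) = 2 ^ 2 := by norm_num
      rw [this, map_pow, he, ← pow_mul]
      exact pow_lt_pow_right_of_lt_one₀ hpos hlt (by omega)
    | succ k ih =>
      intro i h1 hi t ht
      obtain ⟨u, hu, hu2⟩ := factor p hπ _ _ ht
      obtain ⟨h, hh, hh2⟩ := H i u h1 hu
      rw [← hu2] at hh2
      have e1 : h - (1 + (t - 1)) = h - t := by ring
      rw [e1] at hh2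
      have hv1 : p.valuation F t = 1 := val_one_of_sub p (ht.trans_lt (pow_lt_one₀ zero_le hlt (by omega)))
      have hvh : p.valuation F h = 1 := by
        have : h = t + (h - t) := by ring
        rw [this, Valuation.map_add_eq_of_lt_left, hv1]
        rw [hv1]
        exact hh2.trans_lt (pow_lt_one₀ zero_le hlt (by omega))
      have h3 : InH p b c (t / h) := by
        apply ih (i + 1) (by omega) (by omega)
        have : t / h - 1 = - ((h - t) / h) := by have := hh.1; field_simp; ring
        rw [this, Valuation.map_neg, map_div₀, hvh, div_one]
        exact hh2
      have := InH_mul p h3 hh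
      rwa [div_mul_cancel₀ _ hh.1] at this
  exact key (2 * e + 1) 1 le_rfl (by omega) t (by rw [pow_one]; exact (lt_one_iff p hπ _).1 ht)

include hπ in
theorem climb_full (H : ∀ (i : ℕ) (u : F), 1 ≤ i → p.valuation F u ≤ 1 → ∃ h, InH p b c h ∧ p.valuation F (h - (1 + π ^ i * u)) ≤ p.valuation F π ^ (i + 1))
    (H0 : ∀ u, p.valuation F u = 1 → ∃ h, InH p b c h ∧ p.valuation F (h - u) < 1)
    (H1 : ∃ h, InH p b c h ∧ p.valuation F h = p.valuation F π)
    (t : F) (ht : t ≠ 0) : InH p b c t := by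
  have units : ∀ t, p.valuation F t = 1 → InH p b c t := by
    intro t ht
    obtain ⟨h, hh, hh2⟩ := H0 t ht
    have hvh : p.valuation F h = 1 := by
      have : h = t + (h - t) := by ring
      rw [this, Valuation.map_add_eq_of_lt_left, ht]
      rwa [ht]
    have h3 : InH p b c (t / h) := by
      apply climb p hπ H
      have : t / h - 1 = - ((h - t) / h) := by have := hh.1; field_simp; ring
      rw [this, Valuation.map_neg, map_div₀, hvh, div_one]
      exact hh2
    have := InH_mul p h3 hh
    rwa [div_mul_cancel₀ _ hh.1] at this
  obtain ⟨s, hs, h | h⟩ := norm_ord p hπ t ht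
  · exact InH_of_mul p (units _ h) (InH_nr p (Nr_sq _) (pow_ne_zero 2 hs))
  · obtain ⟨q, hq, hq2⟩ := H1
    refine InH_of_mul p (t := s ^ 2) ?_ (InH_nr p (Nr_sq _) (pow_ne_zero 2 hs))
    have h3 : InH p b c (t * s ^ 2 / q) := by
      apply units
      rw [map_div₀, h, hq2, div_self]
      simpa using pi_ne p hπ
    have := InH_mul p h3 hq
    rwa [div_mul_cancel₀ _ hq.1] at this

end loc

end
end HL

namespace HL
open NumberField Module IsDedekindDomain
open scoped nonZeroDivisors Topology Pointwise

noncomputable section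
open scoped Classical
set_option linter.unusedSectionVars false

section residue
variable {F : Type*} [Field F] [NumberField F] (p : HeightOneSpectrum (𝓞 F))

theorem approx_int {u : F} (hu : p.valuation F u ≤ 1) : ∃ a : 𝓞 F, p.valuation F (algebraMap (𝓞 F) F a - u) < 1 := by
  obtain ⟨a, ha⟩ := p.exists_valuation_sub_lt_of_integer hu 1
  exact ⟨a, by simpa using ha⟩

theorem two_mem_iff : (2 : 𝓞 F) ∈ p.asIdeal ↔ p.valuation F 2 < 1 := by
  have e : algebraMap (𝓞 F) F 2 = 2 := map_ofNat (algebraMap (𝓞 F) F) 2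
  rw [← HeightOneSpectrum.valuation_lt_one_iff_mem (K := F)]
  change p.valuation F (algebraMap (𝓞 F) F 2) < 1 ↔ _
  rw [e]

theorem res_sqrt (h2 : p.valuation F 2 < 1) {u : F} (hu : p.valuation F u ≤ 1) :
    ∃ y : F, p.valuation F y ≤ 1 ∧ p.valuation F (y ^ 2 - u) < 1 := by
  obtain ⟨a, ha⟩ := approx_int p hu
  have : p.asIdeal.IsMaximal := p.isMaximal
  let _ : Field (𝓞 F ⧸ p.asIdeal) := Ideal.Quotient.field p.asIdeal
  have : Finite (𝓞 F ⧸ p.asIdeal) := Ideal.finiteQuotientOfFreeOfNeBot p.asIdeal p.ne_bot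
  have : Fintype (𝓞 F ⧸ p.asIdeal) := Fintype.ofFinite _
  have h20 : (2 : 𝓞 F) ∈ p.asIdeal := (two_mem_iff p).2 h2
  have hc : ringChar (𝓞 F ⧸ p.asIdeal) = 2 := by
    have h3 : ringChar (𝓞 F ⧸ p.asIdeal) ∣ 2 := by
      apply ringChar.dvd
      have := Ideal.Quotient.eq_zero_iff_mem.2 h20
      rw [map_ofNat] at this
      exact_mod_cast this
    rcases (Nat.dvd_prime Nat.prime_two).1 h3 with h | h
    · exact absurd h (CharP.ringChar_ne_one)
    · exact h
  obtain ⟨r, hr⟩ := FiniteField.isSquare_of_char_two hc (Ideal.Quotient.mk p.asIdeal a)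
  obtain ⟨y, rfl⟩ := Ideal.Quotient.mk_surjective r
  rw [← map_mul, Ideal.Quotient.eq, ← HeightOneSpectrum.valuation_lt_one_iff_mem (K := F)] at hr
  refine ⟨algebraMap (𝓞 F) F y, p.valuation_le_one y, ?_⟩
  have : (algebraMap (𝓞 F) F y) ^ 2 - u = (algebraMap (𝓞 F) F a - u) - algebraMap (𝓞 F) F (a - y * y) := by
    rw [map_sub, map_mul]; ring
  rw [this]
  exact Valuation.map_sub_lt _ ha hr

theorem res_quad (h2 : p.valuation F 2 = 1) {b c : F} (hb : p.valuation F b = 1) (hc : p.valuation F c ≤ 1) :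
    ∃ x y : F, p.valuation F x ≤ 1 ∧ p.valuation F y ≤ 1 ∧ p.valuation F (x ^ 2 - b * y ^ 2 - c) < 1 := by
  obtain ⟨b', hb'⟩ := approx_int p hb.le
  obtain ⟨c', hc'⟩ := approx_int p hc
  have : p.asIdeal.IsMaximal := p.isMaximal
  let _ : Field (𝓞 F ⧸ p.asIdeal) := Ideal.Quotient.field p.asIdeal
  have : Finite (𝓞 F ⧸ p.asIdeal) := Ideal.finiteQuotientOfFreeOfNeBot p.asIdeal p.ne_bot
  have : Fintype (𝓞 F ⧸ p.asIdeal) := Fintype.ofFinite _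
  have h20 : ¬ (2 : 𝓞 F) ∈ p.asIdeal := fun h => ((two_mem_iff p).1 h).ne h2
  have hch : ringChar (𝓞 F ⧸ p.asIdeal) ≠ 2 := by
    intro h
    apply h20
    rw [← Ideal.Quotient.eq_zero_iff_mem, map_ofNat]
    have := (ringChar.spec (𝓞 F ⧸ p.asIdeal) 2).2 (by rw [h])
    exact_mod_cast this
  have hb0 : Ideal.Quotient.mk p.asIdeal b' ≠ 0 := by
    intro h
    rw [Ideal.Quotient.eq_zero_iff_mem, ← HeightOneSpectrum.valuation_lt_one_iff_mem (K := F)] at h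
    have : b = algebraMap (𝓞 F) F b' - (algebraMap (𝓞 F) F b' - b) := by ring
    have h3 := Valuation.map_sub_lt _ h hb'
    rw [← this] at h3
    exact h3.ne hb
  obtain ⟨r, s, hrs⟩ := FiniteField.exists_root_sum_quadratic (R := 𝓞 F ⧸ p.asIdeal)
    (f := Polynomial.X ^ 2 - Polynomial.C (Ideal.Quotient.mk p.asIdeal c')) (g := Polynomial.C (- Ideal.Quotient.mk p.asIdeal b') * Polynomial.X ^ 2)
    (Polynomial.degree_X_pow_sub_C (by norm_num) _) (Polynomial.degree_C_mul_X_pow 2 (neg_ne_zero.2 hb0))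
    (FiniteField.odd_card_of_char_ne_two hch)
  obtain ⟨x, rfl⟩ := Ideal.Quotient.mk_surjective r
  obtain ⟨y, rfl⟩ := Ideal.Quotient.mk_surjective s
  have hm : x ^ 2 - c' - b' * y ^ 2 ∈ p.asIdeal := by
    rw [← Ideal.Quotient.eq_zero_iff_mem]
    simp only [map_sub, map_mul, map_pow]
    simp at hrs
    linear_combination hrs
  rw [← HeightOneSpectrum.valuation_lt_one_iff_mem (K := F)] at hm
  refine ⟨algebraMap (𝓞 F) F x, algebraMap (𝓞 F) F y, p.valuation_le_one x, p.valuation_le_one y, ?_⟩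
  have : (algebraMap (𝓞 F) F x) ^ 2 - b * (algebraMap (𝓞 F) F y) ^ 2 - c =
      algebraMap (𝓞 F) F (x ^ 2 - c' - b' * y ^ 2) + (algebraMap (𝓞 F) F c' - c) + (algebraMap (𝓞 F) F b' - b) * (algebraMap (𝓞 F) F y) ^ 2 := by
    simp only [map_sub, map_mul, map_pow]; ring
  rw [this]
  refine Valuation.map_add_lt _ (Valuation.map_add_lt _ hm hc') ?_
  rw [map_mul, map_pow]
  refine lt_of_le_of_lt (mul_le_of_le_one_right' ?_) hb'
  exact pow_le_one₀ zero_le (p.valuation_le_one y)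

variable {π : F} (hπ : p.valuation F π = WithZero.exp (-1 : ℤ))

include hπ in
theorem odd_lemma (h2 : p.valuation F 2 = 1) {b c : F} (hb : p.valuation F b = 1) (hc : p.valuation F c = 1) :
    ∃ x y : F, p.valuation F x ≤ 1 ∧ p.valuation F y ≤ 1 ∧ p.valuation F (x ^ 2 - b * y ^ 2 - c) = p.valuation F π := by
  obtain ⟨x, y, hx, hy, h⟩ := res_quad p h2 hb hc.le
  have hlt := pi_lt p hπ
  have hpos : 0 < p.valuation F π := by rw [zero_lt_iff]; simpa using pi_ne p hπ
  have h' := (lt_one_iff p hπ _).1 h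
  rcases h'.eq_or_lt with h' | h'
  · exact ⟨x, y, hx, hy, h'⟩
  have ch : ∀ z : F, p.valuation F z = 1 → p.valuation F (2 * z * π + π ^ 2) = p.valuation F π := by
    intro z hz
    rw [Valuation.map_add_eq_of_lt_left]
    · simp [h2, hz]
    · rw [map_mul, map_mul, h2, hz, map_pow, one_mul, one_mul, pow_two]
      exact mul_lt_of_lt_one_right hpos hlt
  rcases hx.eq_or_lt with hx1 | hx1
  · refine ⟨x + π, y, (Valuation.map_add _ _ _).trans (max_le hx hlt.le), hy, ?_⟩
    have : (x + π) ^ 2 - b * y ^ 2 - c = (2 * x * π + π ^ 2) + (x ^ 2 - b * y ^ 2 - c) := by ring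
    rw [this, Valuation.map_add_eq_of_lt_left, ch x hx1]
    rwa [ch x hx1]
  · have hy1 : p.valuation F y = 1 := by
      rcases hy.eq_or_lt with hy1 | hy1
      · exact hy1
      exfalso
      have e : c = (x ^ 2 - b * y ^ 2) - (x ^ 2 - b * y ^ 2 - c) := by ring
      have : p.valuation F c < 1 := by
        rw [e]
        refine Valuation.map_sub_lt _ (Valuation.map_sub_lt _ ?_ ?_) h
        · rw [map_pow]; exact pow_lt_one₀ zero_le hx1 two_ne_zero
        · rw [map_mul, hb, one_mul, map_pow]; exact pow_lt_one₀ zero_le hy1 two_ne_zero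
      exact this.ne hc
    refine ⟨x, y + π, hx, (Valuation.map_add _ _ _).trans (max_le hy hlt.le), ?_⟩
    have : x ^ 2 - b * (y + π) ^ 2 - c = - b * (2 * y * π + π ^ 2) + (x ^ 2 - b * y ^ 2 - c) := by ring
    have e2 : p.valuation F (- b * (2 * y * π + π ^ 2)) = p.valuation F π := by
      rw [map_mul, Valuation.map_neg, hb, one_mul, ch y hy1]
    rw [this, Valuation.map_add_eq_of_lt_left, e2]
    rwa [e2]

end residue
end
end HL

namespace HL
open NumberField Module IsDedekindDomain
open scoped nonZeroDivisors Topology Pointwise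

noncomputable section
open scoped Classical
set_option linter.unusedSectionVars false

section cases
variable {F : Type*} [Field F] [NumberField F] (p : HeightOneSpectrum (𝓞 F))
variable {π : F} (hπ : p.valuation F π = WithZero.exp (-1 : ℤ)) {b c : F}

include hπ in
theorem climb_nr (H : ∀ (i : ℕ) (u : F), 1 ≤ i → p.valuation F u ≤ 1 → ∃ h ∈ Nr b c, p.valuation F (h - (1 + π ^ i * u)) ≤ p.valuation F π ^ (i + 1))
    (H0 : ∀ u, p.valuation F u = 1 → ∃ h ∈ Nr b c, p.valuation F (h - u) < 1)
    (H1 : ∃ h ∈ Nr b c, p.valuation F h = p.valuation F π)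
    (t : F) (ht : t ≠ 0) : InH p b c t := by
  have hlt := pi_lt p hπ
  refine climb_full p hπ ?_ ?_ ?_ t ht
  · intro i u hi hu
    obtain ⟨h, hh, hv⟩ := H i u hi hu
    refine ⟨h, InH_nr p hh ?_, hv⟩
    rintro rfl
    have h1 : p.valuation F (0 - (1 + π ^ i * u)) = 1 := by
      rw [zero_sub, Valuation.map_neg, Valuation.map_add_eq_of_lt_left, map_one]
      rw [map_one, map_mul, map_pow]
      exact lt_of_le_of_lt (mul_le_of_le_one_right' hu) (pow_lt_one₀ zero_le hlt (by omega))
    rw [h1] at hv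
    exact absurd hv (not_le.2 (pow_lt_one₀ zero_le hlt (by omega)))
  · intro u hu
    obtain ⟨h, hh, hv⟩ := H0 u hu
    refine ⟨h, InH_nr p hh ?_, hv⟩
    rintro rfl
    rw [zero_sub, Valuation.map_neg] at hv
    exact hv.ne hu
  · obtain ⟨h, hh, hv⟩ := H1
    refine ⟨h, InH_nr p hh ?_, hv⟩
    rintro rfl
    rw [map_zero] at hv
    exact pi_ne p hπ ((map_eq_zero (p.valuation F)).1 hv.symm)

include hπ in
theorem val_pi_mul {i : ℕ} {w : F} (hw : p.valuation F w < 1) : p.valuation F (π ^ i * w) ≤ p.valuation F π ^ (i + 1) := by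
  rw [map_mul, map_pow, pow_succ]
  gcongr
  exact (lt_one_iff p hπ w).1 hw

include hπ in
theorem H1c (hc : p.valuation F c = p.valuation F π) : ∃ h ∈ Nr b c, p.valuation F h = p.valuation F π :=
  ⟨-c, ⟨0, 0, 1, 0, by ring⟩, by rw [Valuation.map_neg, hc]⟩

include hπ in
theorem case_I (h2 : p.valuation F 2 < 1) (hb : p.valuation F b = 1) (hc : p.valuation F c = p.valuation F π)
    (t : F) (ht : t ≠ 0) : InH p b c t := by
  have hp0 := pi_ne p hπ
  have hb0 : b ≠ 0 := by rintro rfl; simp at hb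
  have hc0 : c ≠ 0 := by rintro rfl; rw [map_zero] at hc; exact hp0 ((map_eq_zero (p.valuation F)).1 hc.symm)
  refine climb_nr p hπ ?_ ?_ (H1c p hπ hc) t ht
  · intro i u hi hu
    rcases Nat.even_or_odd' i with ⟨k, rfl | rfl⟩
    · obtain ⟨y, hy, hv⟩ := res_sqrt p h2 (u := - u / b) (by rw [map_div₀, hb, div_one, Valuation.map_neg]; exact hu)
      refine ⟨1 - b * (π ^ k * y) ^ 2, ⟨1, π ^ k * y, 0, 0, by ring⟩, ?_⟩
      have : 1 - b * (π ^ k * y) ^ 2 - (1 + π ^ (2 * k) * u) = π ^ (2 * k) * (- b * (y ^ 2 - -u / b)) := by field_simp; ring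
      rw [this]
      apply val_pi_mul p hπ
      rwa [map_mul, Valuation.map_neg, hb, one_mul]
    · obtain ⟨y, hy, hv⟩ := res_sqrt p h2 (u := - (π * u / c)) (by
        rw [Valuation.map_neg, map_div₀, hc, map_mul, mul_div_cancel_left₀ _ (by simpa using hp0)]; exact hu)
      refine ⟨1 - c * (π ^ k * y) ^ 2, ⟨1, 0, π ^ k * y, 0, by ring⟩, ?_⟩
      have : 1 - c * (π ^ k * y) ^ 2 - (1 + π ^ (2 * k + 1) * u) = π ^ (2 * k + 1) * (- (c / π) * (y ^ 2 - -(π * u / c))) := by field_simp; ring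
      rw [this]
      apply val_pi_mul p hπ
      rwa [map_mul, Valuation.map_neg, map_div₀, hc, div_self (by simpa using hp0), one_mul]
  · intro u hu
    obtain ⟨y, hy, hv⟩ := res_sqrt p h2 hu.le
    exact ⟨y ^ 2, Nr_sq _, hv⟩

include hπ in
theorem odd_H (h2 : p.valuation F 2 = 1) (i : ℕ) (u : F) (hi : 1 ≤ i) (hu : p.valuation F u ≤ 1) :
    ∃ h ∈ Nr b c, p.valuation F (h - (1 + π ^ i * u)) ≤ p.valuation F π ^ (i + 1) := by
  have hlt := pi_lt p hπ
  refine ⟨(1 + π ^ i * u / 2) ^ 2, Nr_sq _, ?_⟩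
  have : (1 + π ^ i * u / 2) ^ 2 - (1 + π ^ i * u) = π ^ i * (π ^ i * (u / 2) ^ 2) := by field_simp; ring
  rw [this]
  apply val_pi_mul p hπ
  rw [map_mul, map_pow, map_pow, map_div₀, h2, div_one]
  exact lt_of_le_of_lt (mul_le_of_le_one_right' (pow_le_one₀ zero_le hu)) (pow_lt_one₀ zero_le hlt (by omega))

theorem odd_H0 (h2 : p.valuation F 2 = 1) (hb : p.valuation F b = 1) (u : F) (hu : p.valuation F u = 1) :
    ∃ h ∈ Nr b c, p.valuation F (h - u) < 1 := by
  obtain ⟨x, y, -, -, h⟩ := res_quad p h2 hb hu.le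
  exact ⟨x ^ 2 - b * y ^ 2, ⟨x, y, 0, 0, by ring⟩, h⟩

include hπ in
theorem case_II (h2 : p.valuation F 2 = 1) (hb : p.valuation F b = 1) (hc : p.valuation F c = p.valuation F π)
    (t : F) (ht : t ≠ 0) : InH p b c t :=
  climb_nr p hπ (odd_H p hπ h2) (odd_H0 p h2 hb) (H1c p hπ hc) t ht

include hπ in
theorem case_III (h2 : p.valuation F 2 = 1) (hb : p.valuation F b = 1) (hc : p.valuation F c = 1)
    (t : F) (ht : t ≠ 0) : InH p b c t := by
  refine climb_nr p hπ (odd_H p hπ h2) (odd_H0 p h2 hb) ?_ t ht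
  obtain ⟨x, y, -, -, h⟩ := odd_lemma p hπ h2 hb hc
  exact ⟨_, ⟨x, y, 1, 0, by ring⟩, h⟩

include hπ in
/-- case A: `b = z^2 (1 + 4 η)` -/
theorem case_A (h2 : p.valuation F 2 < 1) (z η : F) (hz : z ≠ 0) (hη : p.valuation F η ≤ 1) (hb : b = z ^ 2 * (1 + 4 * η)) (hc : p.valuation F c = 1)
    (t : F) (ht : t ≠ 0) : InH p b c t := by
  have hlt := pi_lt p hπ
  have hpos : 0 < p.valuation F π := by rw [zero_lt_iff]; simpa using pi_ne p hπ
  have form : ∀ X Y : F, X ^ 2 + X * Y - η * Y ^ 2 = (X + Y / 2) ^ 2 - b * (Y / (2 * z)) ^ 2 := by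
    intro X Y; rw [hb]; field_simp; ring
  refine climb_nr p hπ ?_ ?_ ?_ t ht
  · intro i u hi hu
    refine ⟨1 ^ 2 + 1 * (π ^ i * u) - η * (π ^ i * u) ^ 2, ⟨1 + (π ^ i * u) / 2, (π ^ i * u) / (2 * z), 0, 0, by rw [form]; ring⟩, ?_⟩
    have : 1 ^ 2 + 1 * (π ^ i * u) - η * (π ^ i * u) ^ 2 - (1 + π ^ i * u) = π ^ i * (π ^ i * (- η * u ^ 2)) := by ring
    rw [this]
    apply val_pi_mul p hπ
    rw [map_mul, map_pow, map_mul, map_pow, Valuation.map_neg]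
    exact lt_of_le_of_lt (mul_le_of_le_one_right' (mul_le_one' hη (pow_le_one₀ zero_le hu))) (pow_lt_one₀ zero_le hlt (by omega))
  · intro u hu
    obtain ⟨y, hy, hv⟩ := res_sqrt p h2 hu.le
    exact ⟨y ^ 2, Nr_sq _, hv⟩
  · obtain ⟨x, hx, hv⟩ := res_sqrt p h2 hc.le
    have hv' := (lt_one_iff p hπ _).1 hv
    rcases hv'.eq_or_lt with h | h
    · exact ⟨_, ⟨x, 0, 1, 0, by ring⟩, h⟩
    have hx1 : p.valuation F x = 1 := by
      refine le_antisymm hx (not_lt.1 fun h3 => ?_)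
      have e : c = x ^ 2 - (x ^ 2 - c) := by ring
      have : p.valuation F c < 1 := by
        rw [e]
        refine Valuation.map_sub_lt _ ?_ hv
        rw [map_pow]; exact pow_lt_one₀ zero_le h3 two_ne_zero
      exact this.ne hc
    refine ⟨(x ^ 2 + x * π - η * π ^ 2) - c * (1 ^ 2 - b * 0 ^ 2), ⟨_, _, 1, 0, by rw [form]⟩, ?_⟩
    have e1 : (x ^ 2 + x * π - η * π ^ 2) - c * (1 ^ 2 - b * 0 ^ 2) = x * π + (- η * π ^ 2 + (x ^ 2 - c)) := by ring
    have e2 : p.valuation F (x * π) = p.valuation F π := by rw [map_mul, hx1, one_mul]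
    rw [e1, Valuation.map_add_eq_of_lt_left, e2]
    rw [e2]
    refine Valuation.map_add_lt _ ?_ h
    rw [map_mul, Valuation.map_neg, map_pow, pow_two]
    exact lt_of_le_of_lt (mul_le_of_le_one_left' hη) (mul_lt_of_lt_one_right hpos hlt)

include hπ in
theorem dichotomy (h2 : p.valuation F 2 < 1) (hb : p.valuation F b = 1) (e : ℕ) (he : p.valuation F 2 = p.valuation F π ^ e) (j : ℕ) (hj : j ≤ 2 * e) :
    (∃ z k, p.valuation F z = 1 ∧ p.valuation F (z ^ 2 - b) = p.valuation F π ^ (2 * k + 1)) ∨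
    (∃ z, p.valuation F z = 1 ∧ p.valuation F (z ^ 2 - b) ≤ p.valuation F π ^ j) := by
  have hlt := pi_lt p hπ
  induction j with
  | zero =>
    refine Or.inr ⟨1, map_one _, ?_⟩
    rw [pow_zero]
    exact (Valuation.map_sub _ _ _).trans (max_le (by simp) hb.le)
  | succ j ih =>
    rcases ih (by omega) with h | ⟨z, hz, h⟩
    · exact Or.inl h
    have hz0 : z ≠ 0 := by rintro rfl; simp at hz
    obtain ⟨u, hu, hu2⟩ := factor p hπ _ _ h
    rcases hu.eq_or_lt with hu1 | hu1
    swap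
    · exact Or.inr ⟨z, hz, by rw [hu2]; exact val_pi_mul p hπ hu1⟩
    rcases Nat.even_or_odd' j with ⟨k, rfl | rfl⟩
    swap
    · exact Or.inl ⟨z, k, hz, by rw [hu2, map_mul, hu1, mul_one, map_pow]⟩
    obtain ⟨y, hy, hv⟩ := res_sqrt p h2 (u := -u) (by rw [Valuation.map_neg]; exact hu)
    have hle : p.valuation F ((z + π ^ k * y) ^ 2 - b) ≤ p.valuation F π ^ (2 * k + 1) := by
      have : (z + π ^ k * y) ^ 2 - b = π ^ (2 * k) * (y ^ 2 - -u) + 2 * (z * (π ^ k * y)) := by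
        linear_combination hu2
      rw [this]
      refine (Valuation.map_add _ _ _).trans (max_le (val_pi_mul p hπ hv) ?_)
      rw [map_mul, map_mul, map_mul, hz, he, one_mul, map_pow, ← mul_assoc, ← pow_add]
      refine (mul_le_of_le_one_right' hy).trans ?_
      exact pow_le_pow_of_le_one zero_le hlt.le (by omega)
    refine Or.inr ⟨z + π ^ k * y, ?_, hle⟩
    have h3 : p.valuation F ((z + π ^ k * y) ^ 2) = 1 := by
      have : (z + π ^ k * y) ^ 2 = b + ((z + π ^ k * y) ^ 2 - b) := by ring
      rw [this, Valuation.map_add_eq_of_lt_left, hb]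
      rw [hb]
      exact hle.trans_lt (pow_lt_one₀ zero_le hlt (by omega))
    rw [map_pow] at h3
    exact (pow_eq_one_iff_of_nonneg zero_le two_ne_zero).1 h3

include hπ in
theorem case_IV (h2 : p.valuation F 2 < 1) (hb : p.valuation F b = 1) (hc : p.valuation F c = 1)
    (t : F) (ht : t ≠ 0) : InH p b c t := by
  have hp0 := pi_ne p hπ
  have hvp0 : p.valuation F π ≠ 0 := by simpa using hp0
  obtain ⟨e, he⟩ := exists_e p hπ
  rcases dichotomy p hπ h2 hb e he (2 * e) le_rfl with ⟨z, k, hz, h⟩ | ⟨z, hz, h⟩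
  · have hn0 : z ^ 2 - b ≠ 0 := by
      intro h0; rw [h0, map_zero] at h; exact pow_ne_zero _ hvp0 h.symm
    have e1 : Nr b (c * (z ^ 2 - b) * (1 / π ^ k) ^ 2) = Nr b c := by
      rw [Nr_scale _ (one_div_ne_zero (pow_ne_zero _ hp0)), Nr_norm _ z 1 (by ring) hn0]
    rw [← InH_congr p e1]
    refine case_I p hπ h2 hb ?_ t ht
    rw [map_mul, map_mul, hc, h, map_pow, map_div₀, map_pow, map_one]
    field_simp
    rw [pow_succ, ← pow_mul, mul_comm k]
  · have hz0 : z ≠ 0 := by rintro rfl; simp at hz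
    refine case_A p hπ h2 z ((b - z ^ 2) / (4 * z ^ 2)) hz0 ?_ (by field_simp; ring) hc t ht
    have e4 : (4 : F) = 2 ^ 2 := by norm_num
    rw [map_div₀, map_mul, map_pow, hz, one_pow, mul_one, e4, map_pow, he, ← pow_mul, mul_comm e, ← Valuation.map_neg, neg_sub]
    exact div_le_one_of_le₀ h zero_le

include hπ in
theorem case_u (hb : p.valuation F b = 1) (hc : p.valuation F c = 1 ∨ p.valuation F c = p.valuation F π)
    (t : F) (ht : t ≠ 0) : InH p b c t := by
  have h2 : p.valuation F 2 ≤ 1 := by simpa using val_nat_le p 2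
  rcases h2.eq_or_lt with h2 | h2 <;> rcases hc with hc | hc
  · exact case_III p hπ h2 hb hc t ht
  · exact case_II p hπ h2 hb hc t ht
  · exact case_IV p hπ h2 hb hc t ht
  · exact case_I p hπ h2 hb hc t ht

include hπ in
theorem case_u' (hb : p.valuation F b = 1) (hc0 : c ≠ 0) (t : F) (ht : t ≠ 0) : InH p b c t := by
  obtain ⟨s, hs, h⟩ := norm_ord p hπ c hc0
  rw [← InH_congr p (Nr_scale s hs)]
  exact case_u p hπ hb h t ht

end cases

theorem local_univ {F : Type*} [Field F] [NumberField F] (p : HeightOneSpectrum (𝓞 F)) {b c : F} (hb : b ≠ 0) (hc : c ≠ 0) (t : F) (ht : t ≠ 0) :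
    InH p b c t := by
  obtain ⟨π, hπ⟩ := p.valuation_exists_uniformizer F
  have hp0 := pi_ne p hπ
  have hvp0 : p.valuation F π ≠ 0 := by simpa using hp0
  obtain ⟨s, hs, h | h⟩ := norm_ord p hπ b hb
  · rw [← InH_congr p (Nr_scale' s hs)]
    exact case_u' p hπ h hc t ht
  · rw [← InH_congr p (Nr_scale' s hs)]
    obtain ⟨r, hr, h' | h'⟩ := norm_ord p hπ c hc
    · rw [← InH_congr p (Nr_scale r hr), InH_congr p Nr_swap]
      exact case_u' p hπ h' (mul_ne_zero hb (pow_ne_zero 2 hs)) t ht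
    · rw [← InH_congr p (Nr_scale r hr), ← InH_congr p (Nr_twist (mul_ne_zero hb (pow_ne_zero 2 hs))), ← InH_congr p (Nr_scale (1 / π) (by simpa using hp0)), InH_congr p Nr_swap]
      refine case_u' p hπ ?_ (mul_ne_zero hb (pow_ne_zero 2 hs)) t ht
      rw [map_mul, Valuation.map_neg, map_mul, h, h', map_pow, map_div₀, map_one]
      field_simp
end
end HL

namespace HL
open NumberField Module IsDedekindDomain
open scoped nonZeroDivisors Topology Pointwise

noncomputable section
open scoped Classical
set_option linter.unusedSectionVars false

section Nr2
variable {F : Type*} [Field F] [CharZero F] {a b c : F}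

theorem Nr_one (t : F) : t ∈ Nr b 1 := ⟨(t + 1) / 2, 0, (t - 1) / 2, 0, by ring⟩

theorem Nr_univ_of_norm (x y : F) (h : c = x ^ 2 - b * y ^ 2) (hc : c ≠ 0) (t : F) : t ∈ Nr b c := by
  have := Nr_norm (b := b) (c := 1) c x y h hc
  rw [one_mul] at this
  rw [this]; exact Nr_one t

theorem Nr_univ_of_sq (s : F) (h : b = s ^ 2) (hs : s ≠ 0) (t : F) : t ∈ Nr b c := by
  have := Nr_scale' (b := 1) (c := c) s hs
  rw [one_mul, ← h] at this
  rw [this, Nr_swap]; exact Nr_one t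

theorem Nr_sym (hb : b ≠ 0) (hc : c ≠ 0) (h : c ∈ Nr a b) : a ∈ Nr b c := by
  obtain ⟨x, y, z, w, h⟩ := h
  by_cases hQ : y ^ 2 - b * w ^ 2 = 0
  · by_cases hw : w = 0
    · have hy : y = 0 := by simpa [hw] using hQ
      exact Nr_univ_of_norm x z (by rw [h, hw, hy]; ring) hc a
    · have hb' : b = (y / w) ^ 2 := by field_simp; linear_combination -hQ
      refine Nr_univ_of_sq (y / w) hb' ?_ a
      intro h0; rw [h0] at hb'; exact hb (by simpa using hb')
  · have e : a = ((x ^ 2 - b * z ^ 2) - c * (1 ^ 2 - b * 0 ^ 2)) / (y ^ 2 - b * w ^ 2) := by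
      field_simp; linear_combination h
    rw [e]
    exact Nr_div ⟨x, z, 1, 0, rfl⟩ ⟨y, w, 0, 0, by ring⟩

theorem Nr_iso (hb : b ≠ 0) (hc : c ≠ 0) (x y : F) (h : b = x ^ 2 - a * y ^ 2) : a ∈ Nr b c :=
  Nr_sym hb hc (Nr_univ_of_norm x y h hb c)

end Nr2

section sgn
variable {F : Type*} [Field F] [NumberField F]

theorem approx_real (S : InfinitePlace F → ℕ) (ε : ℝ) (hε : 0 < ε) : ∃ η : F, ∀ v : InfinitePlace F, v (η - S v) < ε := by
  have hd := InfinitePlace.denseRange_algebraMap_pi F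
  let z : (v : InfinitePlace F) → WithAbs v.1 := fun v => ((S v : ℕ) : WithAbs v.1)
  obtain ⟨η, hη⟩ := hd.exists_dist_lt z hε
  refine ⟨η, fun v => ?_⟩
  rw [dist_pi_lt_iff hε] at hη
  have h3 := hη v
  rw [dist_comm, dist_eq_norm] at h3
  have e : (algebraMap F ((v : InfinitePlace F) → WithAbs v.1) η) v - z v = WithAbs.toAbs v.1 (η - S v) := by
    simp [z]; rfl
  rw [e, WithAbs.norm_toAbs_eq] at h3
  exact h3

theorem finite_real : Finite (F →+* ℝ) := by
  refine Finite.of_injective (fun φ : F →+* ℝ => Complex.ofRealHom.comp φ) ?_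
  intro φ ψ h
  ext x
  have := RingHom.congr_fun h x
  simpa using this

theorem sign_fix (b c : F) : ∃ η : F, ∀ φ : F →+* ℝ, (0 < φ b ∨ 0 < φ c) → 0 < φ (b * η ^ 2 + c) := by
  have := finite_real (F := F)
  have h1 : ∀ᶠ N : ℕ in Filter.atTop, ∀ φ : F →+* ℝ, 0 < φ b → ∀ t : ℝ, |t - N| < 1 → 0 < φ b * t ^ 2 + φ c := by
    rw [Filter.eventually_all]
    intro φ
    by_cases hb : 0 < φ b
    swap
    · exact Filter.Eventually.of_forall fun N h => absurd h hb
    obtain ⟨N0, hN0⟩ := exists_nat_gt (|φ c| / φ b + 2)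
    filter_upwards [Filter.eventually_ge_atTop N0] with N hN _ t ht
    have hN' : (N0 : ℝ) ≤ N := by exact_mod_cast hN
    have h3 := (abs_lt.1 ht).1
    have h4 : |φ c| / φ b < t - 1 := by linarith
    have h5 : |φ c| < (t - 1) * φ b := by rwa [div_lt_iff₀ hb] at h4
    have h6 : 0 ≤ |φ c| / φ b := by positivity
    have h7 : t - 1 < t ^ 2 := by nlinarith
    have := neg_abs_le (φ c)
    nlinarith
  have h2 : ∀ᶠ ε : ℝ in 𝓝[>] 0, ∀ φ : F →+* ℝ, 0 < φ c → ∀ t : ℝ, |t| < ε → 0 < φ b * t ^ 2 + φ c := by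
    rw [Filter.eventually_all]
    intro φ
    by_cases hc : 0 < φ c
    swap
    · exact Filter.Eventually.of_forall fun N h => absurd h hc
    have hpos : 0 < min 1 (φ c / (|φ b| + 1)) := by positivity
    filter_upwards [Ioo_mem_nhdsGT hpos] with ε hε _ t ht
    have h3 : |t| < 1 := ht.trans (hε.2.trans_le (min_le_left _ _))
    have h4 : |t| < φ c / (|φ b| + 1) := ht.trans (hε.2.trans_le (min_le_right _ _))
    rw [lt_div_iff₀ (by positivity)] at h4
    have h5 : t ^ 2 ≤ |t| := by rw [← sq_abs]; nlinarith [abs_nonneg t]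
    have := neg_abs_le (φ b)
    have := abs_nonneg (φ b)
    have := abs_nonneg t
    nlinarith [sq_nonneg t]
  obtain ⟨N, hN⟩ := h1.exists
  obtain ⟨ε, hε, hε0⟩ := (h2.and self_mem_nhdsWithin).exists
  let pl : (F →+* ℝ) → InfinitePlace F := fun φ => InfinitePlace.mk (Complex.ofRealHom.comp φ)
  have plv : ∀ φ x, pl φ x = |φ x| := by
    intro φ x
    simp [pl, InfinitePlace.apply]
  have plinj : Function.Injective pl := by
    intro φ ψ h
    rw [InfinitePlace.mk_eq_iff] at h
    ext x
    rcases h with h | h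
    · simpa using RingHom.congr_fun h x
    · have := RingHom.congr_fun h x
      simpa using this
  obtain ⟨η, hη⟩ := approx_real (fun v => if ∃ φ, pl φ = v ∧ 0 < φ b then N else 0) (min 1 ε) (lt_min one_pos hε0)
  refine ⟨η, fun φ h => ?_⟩
  rw [map_add, map_mul, map_pow]
  have h3 := hη (pl φ)
  rw [plv] at h3
  by_cases hb : 0 < φ b
  · apply hN φ hb
    have h4 : (∃ ψ, pl ψ = pl φ ∧ 0 < ψ b) := ⟨φ, rfl, hb⟩
    simp only [if_pos h4, map_sub, map_natCast] at h3
    exact h3.trans_le (min_le_left _ _)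
  · apply hε φ (h.resolve_left hb)
    have h4 : ¬ (∃ ψ, pl ψ = pl φ ∧ 0 < ψ b) := by
      rintro ⟨ψ, h5, h6⟩
      rw [plinj h5] at h6; exact hb h6
    simp only [if_neg h4, Nat.cast_zero, sub_zero] at h3
    exact h3.trans_le (min_le_right _ _)

end sgn
end
end HL

namespace HL
open NumberField Module IsDedekindDomain
open scoped nonZeroDivisors Topology Pointwise

noncomputable section
open scoped Classical
set_option linter.unusedSectionVars false

section wa
variable {F : Type*} [Field F] [NumberField F]

theorem exists_exp_lt {γ : WithZero (Multiplicative ℤ)} (h : γ ≠ 0) : ∃ k : ℕ, WithZero.exp (-(k : ℤ)) < γ := by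
  refine ⟨(WithZero.log γ).natAbs + 1, ?_⟩
  rw [← WithZero.exp_log h, WithZero.exp_lt_exp, WithZero.log_exp]
  push_cast; have := neg_abs_le (WithZero.log γ); omega

theorem val_le_exp_of_mem (p : HeightOneSpectrum (𝓞 F)) {x : 𝓞 F} {k : ℕ} (h : x ∈ p.asIdeal ^ k) :
    p.valuation F (algebraMap (𝓞 F) F x) ≤ WithZero.exp (-(k : ℤ)) := by
  have := (p.intValuation_le_pow_iff_mem x k).2 h
  rwa [← p.valuation_of_algebraMap (K := F)] at this

/-- common denominator -/
theorem exists_den (S : Finset (HeightOneSpectrum (𝓞 F))) (u : HeightOneSpectrum (𝓞 F) → F) :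
    ∃ m : F, m ≠ 0 ∧ ∀ p ∈ S, p.valuation F (m * u p) ≤ 1 := by
  induction S using Finset.induction_on with
  | empty => exact ⟨1, one_ne_zero, by simp⟩
  | insert q S hq ih =>
    obtain ⟨m, hm, h⟩ := ih
    obtain ⟨n, d, hd, e⟩ := IsFractionRing.div_surjective (A := 𝓞 F) (m * u q)
    have hd0 : algebraMap (𝓞 F) F d ≠ 0 := by simpa using nonZeroDivisors.ne_zero hd
    refine ⟨algebraMap (𝓞 F) F d * m, mul_ne_zero hd0 hm, ?_⟩
    intro p hp
    rw [Finset.mem_insert] at hp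
    rcases hp with rfl | hp
    · rw [mul_assoc, ← e, mul_div_cancel₀ _ hd0]; exact p.valuation_le_one n
    · rw [mul_assoc, map_mul]
      exact mul_le_one' (p.valuation_le_one d) (h p hp)

theorem wapprox (S : Finset (HeightOneSpectrum (𝓞 F))) (u : HeightOneSpectrum (𝓞 F) → F) (γ : HeightOneSpectrum (𝓞 F) → WithZero (Multiplicative ℤ))
    (hγ : ∀ p, γ p ≠ 0) (B : (F →+* ℝ) → ℝ) :
    ∃ x : F, (∀ p ∈ S, p.valuation F (x - u p) < γ p) ∧ ∀ φ : F →+* ℝ, B φ < φ x := by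
  have := finite_real (F := F)
  obtain ⟨m, hm, h⟩ := exists_den S u
  have hmv : ∀ p : HeightOneSpectrum (𝓞 F), p.valuation F m ≠ 0 := fun p => by simpa using hm
  have hap : ∀ p : HeightOneSpectrum (𝓞 F), ∃ a : 𝓞 F, p ∈ S → p.valuation F (algebraMap (𝓞 F) F a - m * u p) < γ p * p.valuation F m := by
    intro p
    by_cases hp : p ∈ S
    · obtain ⟨a, ha⟩ := p.exists_valuation_sub_lt_of_integer (h p hp) (Units.mk0 _ (mul_ne_zero (hγ p) (hmv p)))
      exact ⟨a, fun _ => ha⟩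
    · exact ⟨0, fun h => absurd h hp⟩
  choose a ha using hap
  have hk : ∀ p : HeightOneSpectrum (𝓞 F), ∃ k : ℕ, WithZero.exp (-(k : ℤ)) < min (γ p * p.valuation F m) (γ p) := by
    intro p
    apply exists_exp_lt
    rcases min_choice (γ p * p.valuation F m) (γ p) with h | h <;> rw [h]
    · exact mul_ne_zero (hγ p) (hmv p)
    · exact hγ p
  choose k hk using hk
  obtain ⟨y, hy⟩ := IsDedekindDomain.exists_forall_sub_mem_ideal (s := S) (fun p => p.asIdeal) k (fun p _ => p.prime)
    (fun p _ q _ hpq h => hpq (HeightOneSpectrum.ext h)) (fun p => a p.1)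
  let I : Ideal (𝓞 F) := ∏ p ∈ S, p.asIdeal ^ k p
  have hI0 : I ≠ ⊥ := by
    rw [← Submodule.zero_eq_bot]
    exact Finset.prod_ne_zero_iff.2 fun p _ => pow_ne_zero _ p.ne_bot
  have hT0 : 0 < Ideal.absNorm I := Nat.pos_of_ne_zero (by rwa [Ne, Ideal.absNorm_eq_zero_iff])
  have hT : ∀ p ∈ S, p.valuation F ((Ideal.absNorm I : ℕ) : F) < γ p := by
    intro p hp
    have h1 : ((Ideal.absNorm I : ℕ) : 𝓞 F) ∈ p.asIdeal ^ k p :=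
      (Ideal.le_of_dvd (Finset.dvd_prod_of_mem (fun p : HeightOneSpectrum (𝓞 F) => p.asIdeal ^ k p) hp)) (Ideal.absNorm_mem I)
    have h2 := val_le_exp_of_mem p h1
    rw [map_natCast] at h2
    exact h2.trans_lt ((hk p).trans_le (min_le_right _ _))
  have hx0 : ∀ p ∈ S, p.valuation F (algebraMap (𝓞 F) F y / m - u p) < γ p := by
    intro p hp
    have e : algebraMap (𝓞 F) F y / m - u p = (algebraMap (𝓞 F) F (y - a p) + (algebraMap (𝓞 F) F (a p) - m * u p)) / m := by
      rw [map_sub]; field_simp; ring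
    rw [e, map_div₀, div_lt_iff₀ (by rw [zero_lt_iff]; exact hmv p)]
    refine Valuation.map_add_lt _ ?_ (ha p hp)
    exact (val_le_exp_of_mem p (hy p hp)).trans_lt ((hk p).trans_le (min_le_left _ _))
  have hev : ∀ᶠ s : ℕ in Filter.atTop, ∀ φ : F →+* ℝ, B φ < φ (algebraMap (𝓞 F) F y / m) + (Ideal.absNorm I : ℝ) * s := by
    rw [Filter.eventually_all]
    intro φ
    have hT' : (1 : ℝ) ≤ (Ideal.absNorm I : ℝ) := by exact_mod_cast hT0
    obtain ⟨N, hN⟩ := exists_nat_gt (B φ - φ (algebraMap (𝓞 F) F y / m))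
    filter_upwards [Filter.eventually_ge_atTop N] with s hs
    have hs' : (N : ℝ) ≤ s := by exact_mod_cast hs
    have : (0 : ℝ) ≤ s := by positivity
    nlinarith
  obtain ⟨s, hs⟩ := hev.exists
  refine ⟨algebraMap (𝓞 F) F y / m + (Ideal.absNorm I : F) * s, ?_, ?_⟩
  · intro p hp
    have e : algebraMap (𝓞 F) F y / m + (Ideal.absNorm I : F) * s - u p = (algebraMap (𝓞 F) F y / m - u p) + (Ideal.absNorm I : F) * s := by ring
    rw [e]
    refine Valuation.map_add_lt _ (hx0 p hp) ?_
    rw [map_mul]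
    exact lt_of_le_of_lt (mul_le_of_le_one_right' (val_nat_le p s)) (hT p hp)
  · intro φ
    have := hs φ
    simpa only [map_add, map_mul, map_natCast] using this

theorem cont_sq (p : HeightOneSpectrum (𝓞 F)) (a x0 : F) (δ : WithZero (Multiplicative ℤ)) (hδ : δ ≠ 0) :
    ∃ γ : WithZero (Multiplicative ℤ), γ ≠ 0 ∧ ∀ x, p.valuation F (x - x0) < γ → p.valuation F (a * x ^ 2 - a * x0 ^ 2) < δ := by
  have hA1 : (0 : WithZero (Multiplicative ℤ)) < max 1 (p.valuation F a) := lt_max_of_lt_left one_pos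
  have hA2 : (0 : WithZero (Multiplicative ℤ)) < max 1 (p.valuation F x0) := lt_max_of_lt_left one_pos
  have hA : (0 : WithZero (Multiplicative ℤ)) < max 1 (p.valuation F a) * max 1 (p.valuation F x0) := mul_pos hA1 hA2
  refine ⟨min 1 (δ / (max 1 (p.valuation F a) * max 1 (p.valuation F x0))), ?_, ?_⟩
  · rw [← zero_lt_iff]
    exact lt_min one_pos (div_pos (zero_lt_iff.2 hδ) hA)
  · intro x hx
    have h1 := hx.trans_le (min_le_left _ _)
    have h2 := hx.trans_le (min_le_right _ _)
    rw [lt_div_iff₀ hA] at h2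
    have e : a * x ^ 2 - a * x0 ^ 2 = (x - x0) * (a * ((x - x0) + (2 : ℕ) * x0)) := by push_cast; ring
    rw [e, map_mul, map_mul]
    refine lt_of_le_of_lt ?_ h2
    gcongr
    · exact le_max_right _ _
    · refine (Valuation.map_add _ _ _).trans (max_le (le_max_of_le_left h1.le) (le_max_of_le_right ?_))
      rw [map_mul]
      exact mul_le_of_le_one_left' (val_nat_le p 2)

end wa

end
end HL

namespace HL
open NumberField Module IsDedekindDomain
open scoped nonZeroDivisors Topology Pointwise

noncomputable section
open scoped Classical
set_option linter.unusedSectionVars false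

section glob
universe u
variable {F : Type u} [Field F] [NumberField F]

/-- Step 2: adjust `d` to be locally a square at the bad primes and totally positive. -/
theorem step2 (φ0 : F →+* ℝ) (S : Finset (HeightOneSpectrum (𝓞 F))) {b c d : F} (hb : b ≠ 0) (hc : c ≠ 0) (hd : d ≠ 0) (hpos : ∀ φ : F →+* ℝ, 0 < φ d) :
    ∃ n ∈ Nr b c, n ≠ 0 ∧ (∀ p ∈ S, SqAt p (d * n)) ∧ (∀ φ : F →+* ℝ, 0 < φ (d * n)) := by
  have h := fun p : HeightOneSpectrum (𝓞 F) => (local_univ p hb hc d hd).2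
  choose N hN hN0 hsq using h
  choose x y z w hx using hN
  have hδ : ∀ p : HeightOneSpectrum (𝓞 F), p.valuation F (N p) * p.valuation F 4 ≠ 0 := fun p => mul_ne_zero (by simpa using hN0 p) (by simp)
  choose g1 hg1 hg1' using fun p => cont_sq p 1 (x p) _ (hδ p)
  choose g2 hg2 hg2' using fun p => cont_sq p b (y p) _ (hδ p)
  choose g3 hg3 hg3' using fun p => cont_sq p c (z p) _ (hδ p)
  choose g4 hg4 hg4' using fun p => cont_sq p (b * c) (w p) _ (hδ p)
  obtain ⟨Y, hY, -⟩ := wapprox S y g2 hg2 0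
  obtain ⟨Z, hZ, -⟩ := wapprox S z g3 hg3 0
  obtain ⟨W, hW, -⟩ := wapprox S w g4 hg4 0
  obtain ⟨X, hX, hXp⟩ := wapprox S x g1 hg1 (fun φ => |φ (b * Y ^ 2 + c * (Z ^ 2 - b * W ^ 2))| + 1)
  have hn : (∀ φ : F →+* ℝ, 0 < φ ((X ^ 2 - b * Y ^ 2) - c * (Z ^ 2 - b * W ^ 2))) := by
    intro φ
    have h1 := hXp φ
    have e : φ ((X ^ 2 - b * Y ^ 2) - c * (Z ^ 2 - b * W ^ 2)) = φ X ^ 2 - φ (b * Y ^ 2 + c * (Z ^ 2 - b * W ^ 2)) := by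
      rw [← map_pow, ← map_sub]; congr 1; ring
    rw [e]
    have h2 := le_abs_self (φ (b * Y ^ 2 + c * (Z ^ 2 - b * W ^ 2)))
    have h3 := abs_nonneg (φ (b * Y ^ 2 + c * (Z ^ 2 - b * W ^ 2)))
    nlinarith
  refine ⟨_, ⟨X, Y, Z, W, rfl⟩, ?_, ?_, ?_⟩
  · intro h0
    have := hn φ0
    rw [h0, map_zero] at this
    exact this.false
  · intro p hp
    have e1 : d * ((X ^ 2 - b * Y ^ 2) - c * (Z ^ 2 - b * W ^ 2)) = (d * N p) * (((X ^ 2 - b * Y ^ 2) - c * (Z ^ 2 - b * W ^ 2)) / N p) := by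
      have := hN0 p; field_simp
    rw [e1]
    refine SqAt_mul p (hsq p) (SqAt_of_val p ?_)
    have e2 : ((X ^ 2 - b * Y ^ 2) - c * (Z ^ 2 - b * W ^ 2)) / N p - 1 =
        ((1 * X ^ 2 - 1 * x p ^ 2) - (b * Y ^ 2 - b * y p ^ 2) - (c * Z ^ 2 - c * z p ^ 2) + (b * c * W ^ 2 - b * c * w p ^ 2)) / N p := by
      have h0 := hN0 p
      field_simp
      rw [hx p]; ring
    rw [e2, map_div₀, div_lt_iff₀ (zero_lt_iff.2 (by simpa using hN0 p)), mul_comm (p.valuation F 4)]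
    refine Valuation.map_add_lt _ (Valuation.map_sub_lt _ (Valuation.map_sub_lt _ ?_ ?_) ?_) ?_
    · exact hg1' p X (hX p hp)
    · exact hg2' p Y (hY p hp)
    · exact hg3' p Z (hZ p hp)
    · exact hg4' p W (hW p hp)
  · intro φ
    rw [map_mul]
    exact mul_pos (hpos φ) (hn φ)

/-- Step 3: find `δ` with valuation exactly one at all primes in `R`. -/
theorem step3 (R : Finset (HeightOneSpectrum (𝓞 F))) {b c : F} (hc0 : c ≠ 0)
    (h2 : ∀ p ∈ R, p.valuation F 2 = 1) (hb : ∀ p ∈ R, p.valuation F b = 1) (hc : ∀ p ∈ R, p.valuation F c = 1) :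
    ∃ y z : F, ∀ p ∈ R, p.valuation F (1 - c * (y ^ 2 - b * z ^ 2)) = WithZero.exp (-1 : ℤ) := by
  have h : ∀ p : HeightOneSpectrum (𝓞 F), ∃ y z : F, p ∈ R → p.valuation F (1 - c * (y ^ 2 - b * z ^ 2)) = WithZero.exp (-1 : ℤ) := by
    intro p
    by_cases hp : p ∈ R
    swap
    · exact ⟨0, 0, fun h => absurd h hp⟩
    obtain ⟨π, hπ⟩ := p.valuation_exists_uniformizer F
    obtain ⟨y, z, -, -, h⟩ := odd_lemma p hπ (h2 p hp) (hb p hp) (c := 1 / c) (by rw [map_div₀, map_one, hc p hp, div_one])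
    refine ⟨y, z, fun _ => ?_⟩
    rw [← hπ, ← h]
    have e : 1 - c * (y ^ 2 - b * z ^ 2) = - c * (y ^ 2 - b * z ^ 2 - 1 / c) := by field_simp; ring
    rw [e, map_mul, Valuation.map_neg, hc p hp, one_mul]
  choose y z h using h
  choose g1 hg1 hg1' using fun p => cont_sq p c (y p) (WithZero.exp (-1 : ℤ)) WithZero.exp_ne_zero
  choose g2 hg2 hg2' using fun p => cont_sq p (b * c) (z p) (WithZero.exp (-1 : ℤ)) WithZero.exp_ne_zero
  obtain ⟨Y, hY, -⟩ := wapprox R y g1 hg1 0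
  obtain ⟨Z, hZ, -⟩ := wapprox R z g2 hg2 0
  refine ⟨Y, Z, fun p hp => ?_⟩
  have e : 1 - c * (Y ^ 2 - b * Z ^ 2) = (1 - c * (y p ^ 2 - b * z p ^ 2)) + (- (c * Y ^ 2 - c * y p ^ 2) + (b * c * Z ^ 2 - b * c * z p ^ 2)) := by ring
  rw [e, Valuation.map_add_eq_of_lt_left, h p hp]
  rw [h p hp]
  refine Valuation.map_add_lt _ ?_ (hg2' p Z (hZ p hp))
  rw [Valuation.map_neg]
  exact hg1' p Y (hY p hp)

theorem quad_decomp {M : Type*} [Field M] [NumberField M] [Algebra F M] [IsGalois F M] (σ : M ≃ₐ[F] M) (s : M) (hs0 : s ≠ 0) (hσ : σ s = - s)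
    (h2 : ∀ τ : M ≃ₐ[F] M, τ = 1 ∨ τ = σ) (α : M) : ∃ x x' : F, α = algebraMap F M x + s * algebraMap F M x' := by
  obtain ⟨x, hx⟩ := (fixed_iff σ h2 ((α + σ α) / 2)).1 (by
    rw [map_div₀, map_add, sg_sg σ h2, map_ofNat σ 2]; ring)
  obtain ⟨x', hx'⟩ := (fixed_iff σ h2 ((α - σ α) / (2 * s))).1 (by
    rw [map_div₀, map_sub, sg_sg σ h2, map_mul, hσ, map_ofNat σ 2]; field_simp; ring)
  refine ⟨x, x', ?_⟩
  rw [hx, hx']; field_simp; ring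

/-- Step 4. -/
theorem step4 {b c d : F} (δ : F) (hδ : ∀ r : F, r ^ 2 ≠ δ) (hc : c = 1 - δ) (hb0 : b ≠ 0) (hc0 : c ≠ 0) (hd0 : d ≠ 0)
    (hpos : ∀ φ : F →+* ℝ, 0 < φ d)
    (hg : ∀ p : HeightOneSpectrum (𝓞 F), SqAt p d ∨ (p.valuation F 2 = 1 ∧ EvAt p b ∧ (EvAt p d ∨ EvAt p (d * δ)))) : d ∈ Nr b c := by
  obtain ⟨M, _, _, _, _, σ, s, hs, hσ, hσ1, h2⟩ := exists_quad δ hδ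
  have hinj := (algebraMap F M).injective
  have hδ0 : δ ≠ 0 := by rintro rfl; exact hδ 0 (by simp)
  have hs0 : s ≠ 0 := by
    rintro rfl
    rw [zero_pow two_ne_zero] at hs
    exact hδ0 (hinj (by rw [← hs, map_zero]))
  have ne0 : ∀ x : F, x ≠ 0 → algebraMap F M x ≠ 0 := fun x hx => by simpa using hx
  have hE := star_E (algebraMap F M d) (algebraMap F M b) (ne0 d hd0) (fun φ => hpos (φ.comp (algebraMap F M))) (ne0 b hb0) (by
    intro P
    have hP : ∀ x : F, P.valuation M (algebraMap F M x) = (dn P).valuation F x ^ ((dn P).asIdeal.ramificationIdx' P.asIdeal) := dn_val P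
    have hev : ∀ x : F, EvAt (dn P) x → EvAt P (algebraMap F M x) := by
      rintro x ⟨t, ht, h⟩
      refine ⟨algebraMap F M t, ne0 t ht, ?_⟩
      rw [← map_pow, ← map_mul, hP, h, one_pow]
    rcases hg (dn P) with ⟨z, hz, h⟩ | ⟨h1, h3, h4⟩
    · left
      refine ⟨algebraMap F M z, ne0 z hz, ?_⟩
      have e1 : algebraMap F M d / algebraMap F M z ^ 2 - 1 = algebraMap F M (d / z ^ 2 - 1) := by simp
      have e2 : (4 : M) = algebraMap F M 4 := (map_ofNat (algebraMap F M) 4).symm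
      have he : (dn P : HeightOneSpectrum (𝓞 F)).asIdeal.ramificationIdx' P.asIdeal ≠ 0 :=
        Ideal.IsDedekindDomain.ramificationIdx'_ne_zero_of_liesOver P.asIdeal (dn P).ne_bot
      rw [e1, e2, hP, hP]
      exact pow_lt_pow_left₀ h zero_le he
    · right
      have e2 : (2 : M) = algebraMap F M 2 := (map_ofNat (algebraMap F M) 2).symm
      refine ⟨by rw [e2, hP, h1, one_pow], ?_, hev b h3⟩
      rcases h4 with h4 | h4
      · exact hev d h4
      · obtain ⟨t, ht, h5⟩ := hev _ h4
        refine ⟨s * t, mul_ne_zero hs0 ht, ?_⟩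
        rw [← h5, map_mul (algebraMap F M), ← hs]; congr 1; ring)
  obtain ⟨α, β, h⟩ := hE
  obtain ⟨x, x', rfl⟩ := quad_decomp σ s hs0 hσ h2 α
  obtain ⟨y, y', rfl⟩ := quad_decomp σ s hs0 hσ h2 β
  have h' := congrArg σ h
  simp only [map_sub, map_mul, map_add, map_pow, hσ, AlgEquiv.commutes] at h'
  have r1 : b = (x ^ 2 - d * y ^ 2) + δ * (x' ^ 2 - d * y' ^ 2) := by
    apply hinj
    simp only [map_sub, map_mul, map_add, map_pow]
    rw [← hs]
    linear_combination (1 / 2) * h + (1 / 2) * h'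
  have r2 : x * x' - d * (y * y') = 0 := by
    apply hinj
    simp only [map_sub, map_mul, map_zero]
    have : (4 * s) * (algebraMap F M x * algebraMap F M x' - algebraMap F M d * (algebraMap F M y * algebraMap F M y')) = 0 := by
      linear_combination h' - h
    exact (mul_eq_zero.1 this).resolve_left (mul_ne_zero (by norm_num) hs0)
  by_cases hq : x' ^ 2 - d * y' ^ 2 = 0
  · exact Nr_iso hb0 hc0 x y (by rw [r1, hq]; ring)
  · apply Nr_sym hb0 hc0
    have e : c = (((x + x') ^ 2 - d * (y + y') ^ 2) - b * (1 ^ 2 - d * 0 ^ 2)) / (x' ^ 2 - d * y' ^ 2) := by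
      rw [eq_div_iff hq, hc]
      linear_combination r1 - 2 * r2
    rw [e]
    exact Nr_div ⟨_, _, _, _, rfl⟩ ⟨x', y', 0, 0, by ring⟩

theorem EvAt_of_val_one (p : HeightOneSpectrum (𝓞 F)) {b : F} (h : p.valuation F b = 1) : EvAt p b := ⟨1, one_ne_zero, by simpa using h⟩

theorem EvAt_of_even (p : HeightOneSpectrum (𝓞 F)) {b : F} (hb : b ≠ 0) (h : Even (ord p b)) : EvAt p b := by
  obtain ⟨π, hπ⟩ := p.valuation_exists_uniformizer F
  obtain ⟨t, ht, h1 | h1⟩ := norm_ord p hπ b hb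
  · exact ⟨t, ht, h1⟩
  · exfalso
    have ht2 := pow_ne_zero 2 ht
    rw [hπ, val_eq_exp p (mul_ne_zero hb ht2), WithZero.exp_inj, ord_mul p hb ht2, pow_two, ord_mul p ht ht] at h1
    obtain ⟨k, hk⟩ := h
    omega

theorem key_pos (φ0 : F →+* ℝ) {b c d : F} (hb : b ≠ 0) (hc : c ≠ 0) (hd : d ≠ 0) (hpos : ∀ φ : F →+* ℝ, 0 < φ d) : d ∈ Nr b c := by
  have h20 : (2 : F) ≠ 0 := two_ne_zero
  have hS : ({p : HeightOneSpectrum (𝓞 F) | ord p (2 : F) ≠ 0} ∪ {p | ord p b ≠ 0} ∪ {p | ord p c ≠ 0}).Finite :=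
    ((ord_fin h20).union (ord_fin hb)).union (ord_fin hc)
  obtain ⟨n, hn, hn0, hsq, hp⟩ := step2 φ0 hS.toFinset hb hc hd hpos
  have hdn0 := mul_ne_zero hd hn0
  suffices hmain : d * n ∈ Nr b c by
    have := Nr_div hmain hn
    rwa [mul_div_cancel_right₀ _ hn0] at this
  have good : ∀ p : HeightOneSpectrum (𝓞 F), SqAt p (d * n) ∨ (p.valuation F 2 = 1 ∧ p.valuation F b = 1 ∧ p.valuation F c = 1) := by
    intro p
    by_cases h : p ∈ hS.toFinset
    · exact Or.inl (hsq p h)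
    · right
      simp only [Set.Finite.mem_toFinset, Set.mem_union, Set.mem_ofPred_eq, not_or, not_not] at h
      exact ⟨(ord_eq_zero_iff p h20).1 h.1.1, (ord_eq_zero_iff p hb).1 h.1.2, (ord_eq_zero_iff p hc).1 h.2⟩
  have hR : ({p : HeightOneSpectrum (𝓞 F) | ¬ Even (ord p (d * n)) ∧ ¬ SqAt p (d * n)}).Finite := by
    refine (ord_fin hdn0).subset ?_
    rintro p ⟨h, -⟩ h0
    rw [h0] at h; exact h Even.zero
  have hRm : ∀ p, p ∈ hR.toFinset ↔ ¬ Even (ord p (d * n)) ∧ ¬ SqAt p (d * n) := by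
    intro p; simp
  by_cases hne : hR.toFinset.Nonempty
  · obtain ⟨y, z, hyz⟩ := step3 hR.toFinset hc (fun p hp => ((good p).resolve_left ((hRm p).1 hp).2).1)
      (fun p hp => ((good p).resolve_left ((hRm p).1 hp).2).2.1) (fun p hp => ((good p).resolve_left ((hRm p).1 hp).2).2.2)
    obtain ⟨q, hq⟩ := hne
    have hc' : c * (y ^ 2 - b * z ^ 2) ≠ 0 := by
      intro h0
      have := hyz q hq
      rw [h0, sub_zero, map_one, ← WithZero.exp_zero, WithZero.exp_inj] at this
      omega
    have hN0 : y ^ 2 - b * z ^ 2 ≠ 0 := right_ne_zero_of_mul hc'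
    have hδ0 : ∀ p ∈ hR.toFinset, 1 - c * (y ^ 2 - b * z ^ 2) ≠ 0 := by
      intro p hp h0
      have := hyz p hp
      rw [h0, map_zero] at this
      exact WithZero.exp_ne_zero this.symm
    have hord : ∀ p ∈ hR.toFinset, ord p (1 - c * (y ^ 2 - b * z ^ 2)) = 1 := by
      intro p hp
      have := hyz p hp
      rw [val_eq_exp p (hδ0 p hp), WithZero.exp_inj] at this
      omega
    rw [← Nr_norm (b := b) (c := c) _ y z rfl hN0]
    refine step4 (1 - c * (y ^ 2 - b * z ^ 2)) ?_ (by ring) hb hc' hdn0 hp ?_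
    · intro r hr
      have hr0 : r ≠ 0 := by rintro rfl; exact hδ0 q hq (by rw [← hr]; simp)
      have := hord q hq
      rw [← hr, pow_two, ord_mul q hr0 hr0] at this
      omega
    · intro p
      by_cases hs : SqAt p (d * n)
      · exact Or.inl hs
      · obtain ⟨g1, g2, g3⟩ := (good p).resolve_left hs
        refine Or.inr ⟨g1, EvAt_of_val_one p g2, ?_⟩
        by_cases hev : Even (ord p (d * n))
        · exact Or.inl (EvAt_of_even p hdn0 hev)
        · right
          have hpR := (hRm p).2 ⟨hev, hs⟩
          apply EvAt_of_even p (mul_ne_zero hdn0 (hδ0 p hpR))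
          rw [ord_mul p hdn0 (hδ0 p hpR), hord p hpR]
          exact (Int.not_even_iff_odd.1 hev).add_odd odd_one
  · obtain ⟨x, y, h⟩ := star_E (d * n) b hdn0 hp hb (by
      intro p
      by_cases hs : SqAt p (d * n)
      · exact Or.inl hs
      · obtain ⟨g1, g2, g3⟩ := (good p).resolve_left hs
        refine Or.inr ⟨g1, EvAt_of_even p hdn0 ?_, EvAt_of_val_one p g2⟩
        by_contra hev
        exact hne ⟨p, (hRm p).2 ⟨hev, hs⟩⟩)
    exact Nr_iso hb hc x y h

/-- Key claim: `d` totally negative, `b` or `c` positive at each real place. -/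
theorem key_neg (φ0 : F →+* ℝ) {b c d : F} (hb : b ≠ 0) (hc : c ≠ 0) (hneg : ∀ φ : F →+* ℝ, φ d < 0)
    (hbc : ∀ φ : F →+* ℝ, 0 < φ b ∨ 0 < φ c) : d ∈ Nr b c := by
  obtain ⟨η, hη⟩ := sign_fix b c
  have hd : d ≠ 0 := by rintro rfl; have := hneg φ0; simp at this
  have hn : ∀ φ : F →+* ℝ, φ (-(b * η ^ 2 + c)) < 0 := by
    intro φ; rw [map_neg]; have := hη φ (hbc φ); linarith
  have hn0 : -(b * η ^ 2 + c) ≠ 0 := by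
    intro h0; have := hn φ0; rw [h0, map_zero] at this; exact this.false
  have h1 := key_pos φ0 hb hc (mul_ne_zero hd hn0) (fun φ => by rw [map_mul]; exact mul_pos_of_neg_of_neg (hneg φ) (hn φ))
  have h2 : -(b * η ^ 2 + c) ∈ Nr b c := ⟨0, η, 1, 0, by ring⟩
  have := Nr_div h1 h2
  rwa [mul_div_cancel_right₀ _ hn0] at this

end glob

end
end HL

namespace HL
open NumberField Module IsDedekindDomain
open scoped nonZeroDivisors Topology Pointwise

noncomputable section
open scoped Classical
set_option linter.unusedSectionVars false

section cong
variable {K : Type*} [Field K] (ι : K ≃+* K) (hinv : ∀ x, ι (ι x) = x)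

/-- congruence of sesquilinear Gram matrices -/
def Cg {m : ℕ} (A B : Matrix (Fin m) (Fin m) K) : Prop := ∃ P : Matrix (Fin m) (Fin m) K, IsUnit P ∧ A = Pᵀ * B * P.map ι

theorem map_mul_ι {m : ℕ} (A B : Matrix (Fin m) (Fin m) K) : (A * B).map ι = A.map ι * B.map ι := by
  ext i j; simp [Matrix.mul_apply]

theorem map_one_ι {m : ℕ} : (1 : Matrix (Fin m) (Fin m) K).map ι = 1 := by
  ext i j; simp [Matrix.one_apply, apply_ite ι]

theorem Cg_refl {m : ℕ} (A : Matrix (Fin m) (Fin m) K) : Cg ι A A := ⟨1, isUnit_one, by rw [map_one_ι]; simp⟩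

variable {ι} in
theorem Cg_trans {m : ℕ} {A B C : Matrix (Fin m) (Fin m) K} (h : Cg ι A B) (h' : Cg ι B C) : Cg ι A C := by
  obtain ⟨P, hP, rfl⟩ := h
  obtain ⟨Q, hQ, rfl⟩ := h'
  refine ⟨Q * P, hQ.mul hP, ?_⟩
  rw [map_mul_ι, Matrix.transpose_mul]
  simp only [Matrix.mul_assoc]

variable {ι} in
theorem Cg_symm {m : ℕ} {A B : Matrix (Fin m) (Fin m) K} (h : Cg ι A B) : Cg ι B A := by
  obtain ⟨P, hP, rfl⟩ := h
  obtain ⟨u, rfl⟩ := hP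
  refine ⟨(u⁻¹ : (Matrix (Fin m) (Fin m) K)ˣ), Units.isUnit _, ?_⟩
  have h1 : ((u : Matrix (Fin m) (Fin m) K)).map ι * ((u⁻¹ : (Matrix (Fin m) (Fin m) K)ˣ) : Matrix (Fin m) (Fin m) K).map ι = 1 := by
    rw [← map_mul_ι, Units.mul_inv, map_one_ι]
  have h2 : ((u⁻¹ : (Matrix (Fin m) (Fin m) K)ˣ) : Matrix (Fin m) (Fin m) K)ᵀ * (u : Matrix (Fin m) (Fin m) K)ᵀ = 1 := by
    rw [← Matrix.transpose_mul, Units.mul_inv, Matrix.transpose_one]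
  calc B = ((((u⁻¹ : (Matrix (Fin m) (Fin m) K)ˣ) : Matrix (Fin m) (Fin m) K)ᵀ * (u : Matrix (Fin m) (Fin m) K)ᵀ) * B) * (((u : Matrix (Fin m) (Fin m) K)).map ι * ((u⁻¹ : (Matrix (Fin m) (Fin m) K)ˣ) : Matrix (Fin m) (Fin m) K).map ι) := by
        rw [h1, h2, Matrix.one_mul, Matrix.mul_one]
    _ = _ := by simp only [Matrix.mul_assoc]

variable {ι} in
theorem Cg_det {m : ℕ} {A B : Matrix (Fin m) (Fin m) K} (h : Cg ι A B) : ∃ t : K, t ≠ 0 ∧ A.det = B.det * (t * ι t) := by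
  obtain ⟨P, hP, rfl⟩ := h
  refine ⟨P.det, ((Matrix.isUnit_iff_isUnit_det P).1 hP).ne_zero, ?_⟩
  rw [Matrix.det_mul, Matrix.det_mul, Matrix.det_transpose]
  have : (P.map ι).det = ι P.det := (RingHom.map_det (ι : K →+* K) P).symm
  rw [this]; ring

/-- block sum with a one-dimensional form -/
def bl {m : ℕ} (c : K) (A : Matrix (Fin m) (Fin m) K) : Matrix (Fin (m + 1)) (Fin (m + 1)) K :=
  Fin.cons (Fin.cons c 0) (fun i => Fin.cons 0 (A i))

section
variable {m : ℕ} (c : K) (A : Matrix (Fin m) (Fin m) K)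
@[simp] theorem bl_00 : bl c A 0 0 = c := rfl
@[simp] theorem bl_0s (j : Fin m) : bl c A 0 j.succ = 0 := rfl
@[simp] theorem bl_s0 (i : Fin m) : bl c A i.succ 0 = 0 := rfl
@[simp] theorem bl_ss (i j : Fin m) : bl c A i.succ j.succ = A i j := rfl

theorem ext_bl {M : Matrix (Fin (m + 1)) (Fin (m + 1)) K} (h00 : M 0 0 = c) (h0s : ∀ j : Fin m, M 0 j.succ = 0) (hs0 : ∀ i : Fin m, M i.succ 0 = 0)
    (hss : ∀ i j : Fin m, M i.succ j.succ = A i j) : M = bl c A := by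
  ext i j
  refine Fin.cases ?_ (fun i => ?_) i <;> refine Fin.cases ?_ (fun j => ?_) j
  · exact h00
  · exact h0s j
  · exact hs0 i
  · exact hss i j

theorem bl_mul (c' : K) (A' : Matrix (Fin m) (Fin m) K) : bl c A * bl c' A' = bl (c * c') (A * A') := by
  apply ext_bl <;> intros <;> simp [Matrix.mul_apply, Fin.sum_univ_succ]

theorem bl_one : bl (1 : K) (1 : Matrix (Fin m) (Fin m) K) = 1 := by
  symm
  apply ext_bl <;> intros <;> simp [Matrix.one_apply]
  rintro h; exact absurd h.symm (Fin.succ_ne_zero _)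

theorem bl_tr : (bl c A)ᵀ = bl c Aᵀ := by
  apply ext_bl <;> intros <;> simp

theorem bl_map : (bl c A).map ι = bl (ι c) (A.map ι) := by
  apply ext_bl <;> intros <;> simp

theorem bl_diag (a : Fin m → K) : bl c (Matrix.diagonal a) = Matrix.diagonal (Fin.cons c a : Fin (m + 1) → K) := by
  symm
  apply ext_bl <;> intros <;> simp [Matrix.diagonal_apply]
  rintro h; exact absurd h.symm (Fin.succ_ne_zero _)

variable {ι A} in
theorem Cg_bl {B : Matrix (Fin m) (Fin m) K} (h : Cg ι A B) : Cg ι (bl c A) (bl c B) := by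
  obtain ⟨P, hP, rfl⟩ := h
  obtain ⟨u, rfl⟩ := hP
  refine ⟨bl 1 u, ?_, ?_⟩
  · refine ⟨⟨bl 1 u, bl 1 (u⁻¹ : (Matrix (Fin m) (Fin m) K)ˣ), ?_, ?_⟩, rfl⟩
    · rw [bl_mul, Units.mul_inv, one_mul, bl_one]
    · rw [bl_mul, Units.inv_mul, one_mul, bl_one]
  · rw [bl_tr, bl_map, bl_mul, bl_mul, map_one]; simp
end

include hinv in
theorem herm_cg {m : ℕ} {M : Matrix (Fin m) (Fin m) K} (hM : Mᵀ = M.map ι) (P : Matrix (Fin m) (Fin m) K) :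
    (Pᵀ * M * P.map ι)ᵀ = (Pᵀ * M * P.map ι).map ι := by
  rw [map_mul_ι, map_mul_ι, Matrix.transpose_mul, Matrix.transpose_mul, Matrix.transpose_transpose, hM]
  have h1 : (P.map ι).map ι = P := by ext i j; simp [hinv]
  have h2 : (P.map ι)ᵀ = Pᵀ.map ι := rfl
  rw [h1, h2, Matrix.mul_assoc]

theorem exists_col {m : ℕ} (v : Fin (m + 1) → K) (hv : v ≠ 0) : ∃ P : Matrix (Fin (m + 1)) (Fin (m + 1)) K, IsUnit P ∧ ∀ i, P i 0 = v i := by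
  obtain ⟨i0, hi⟩ : ∃ i, v i ≠ 0 := by
    by_contra h; push Not at h; exact hv (funext h)
  let Q := (1 : Matrix (Fin (m + 1)) (Fin (m + 1)) K).updateCol i0 v
  refine ⟨Q.submatrix id (Equiv.swap 0 i0), ?_, ?_⟩
  · rw [Matrix.isUnit_iff_isUnit_det, Matrix.det_permute']
    have : Q.det = v i0 := by
      have h := Matrix.cramer_apply (1 : Matrix (Fin (m + 1)) (Fin (m + 1)) K) v i0
      rw [Matrix.cramer_one] at h
      exact h.symm
    rw [this, isUnit_iff_ne_zero]
    refine mul_ne_zero ?_ hi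
    rcases Int.units_eq_one_or (Equiv.Perm.sign (Equiv.swap 0 i0)) with h | h <;> rw [h] <;> simp
  · intro i
    simp [Q]

include hinv in
theorem split1 {m : ℕ} {M : Matrix (Fin (m + 1)) (Fin (m + 1)) K} (hM : Mᵀ = M.map ι) (hc : M 0 0 ≠ 0) :
    ∃ M' : Matrix (Fin m) (Fin m) K, M'ᵀ = M'.map ι ∧ Cg ι M (bl (M 0 0) M') := by
  let Q : Matrix (Fin (m + 1)) (Fin (m + 1)) K := fun i j => if i = j then 1 else if i = 0 then - (M j 0 / M 0 0) else 0
  have hQe : ∀ i j, Q i j = if i = j then 1 else if i = 0 then - (M j 0 / M 0 0) else 0 := fun _ _ => rfl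
  have hQdet : Q.det = 1 := by
    rw [Matrix.det_of_isUpperTriangular]
    · simp [hQe]
    · intro i j hij
      have h1 : j < i := hij
      rw [hQe, if_neg h1.ne', if_neg]
      rintro rfl; exact absurd h1 (by simp)
  have hQ : IsUnit Q := by rw [Matrix.isUnit_iff_isUnit_det, hQdet]; exact isUnit_one
  have hQ0 : ∀ i, Q.map ι i 0 = (1 : Matrix (Fin (m + 1)) (Fin (m + 1)) K) i 0 := by
    intro i
    rw [Matrix.map_apply, hQe, Matrix.one_apply]
    by_cases h : i = 0
    · rw [if_pos h, if_pos h, map_one]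
    · rw [if_neg h, if_neg h, if_neg h, map_zero]
  have hN := herm_cg ι hinv hM Q
  have hN0 : ∀ j, (Qᵀ * M * Q.map ι) j 0 = (Qᵀ * M) j 0 := by
    intro j
    rw [Matrix.mul_apply, Finset.sum_congr rfl (fun k _ => by rw [hQ0 k]), ← Matrix.mul_apply, Matrix.mul_one]
  have hN00 : (Qᵀ * M * Q.map ι) 0 0 = M 0 0 := by
    rw [hN0, Matrix.mul_apply, Fin.sum_univ_succ]
    simp only [Matrix.transpose_apply, hQe, Fin.succ_ne_zero, if_true, if_false, one_mul, zero_mul, Finset.sum_const_zero, add_zero]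
  have hNs0 : ∀ j : Fin m, (Qᵀ * M * Q.map ι) j.succ 0 = 0 := by
    intro j
    rw [hN0, Matrix.mul_apply, Fin.sum_univ_succ]
    simp only [Matrix.transpose_apply, hQe, Fin.succ_ne_zero, if_true, if_false, Fin.succ_inj, ite_mul, one_mul, zero_mul, Finset.sum_ite_eq', Finset.mem_univ]
    rw [if_neg (Fin.succ_ne_zero j).symm]
    field_simp; ring
  have hent : ∀ i j, (Qᵀ * M * Q.map ι) j i = ι ((Qᵀ * M * Q.map ι) i j) := by
    intro i j
    exact congrFun (congrFun hN i) j
  refine ⟨fun i j => (Qᵀ * M * Q.map ι) i.succ j.succ, ?_, ?_⟩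
  · ext i j; exact hent _ _
  · apply Cg_symm
    refine ⟨Q, hQ, ?_⟩
    symm
    apply ext_bl
    · exact hN00
    · intro j; rw [hent, hNs0, map_zero]
    · exact hNs0
    · intro i j; rfl

include hinv in
theorem split {m : ℕ} {M : Matrix (Fin (m + 1)) (Fin (m + 1)) K} (hM : Mᵀ = M.map ι) (v : Fin (m + 1) → K) (c : K) (hc : c ≠ 0)
    (hv : v ⬝ᵥ (M *ᵥ (fun i => ι (v i))) = c) :
    ∃ M' : Matrix (Fin m) (Fin m) K, M'ᵀ = M'.map ι ∧ Cg ι M (bl c M') := by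
  have hv0 : v ≠ 0 := by rintro rfl; simp at hv; exact hc hv.symm
  obtain ⟨P, hP, hP0⟩ := exists_col v hv0
  have h00 : (Pᵀ * M * P.map ι) 0 0 = c := by
    rw [← hv, Matrix.mul_assoc, Matrix.mul_apply]
    simp only [Matrix.transpose_apply, hP0, dotProduct]
    refine Finset.sum_congr rfl fun i _ => ?_
    congr 1
    rw [Matrix.mul_apply]
    simp only [Matrix.map_apply, hP0, Matrix.mulVec, dotProduct]
  obtain ⟨M', hM', h⟩ := split1 ι hinv (herm_cg ι hinv hM P) (by rw [h00]; exact hc)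
  rw [h00] at h
  refine ⟨M', hM', Cg_trans (Cg_symm ⟨P, hP, rfl⟩) h⟩

end cong
end
end HL

namespace HL
open NumberField Module IsDedekindDomain
open scoped nonZeroDivisors Topology Pointwise

noncomputable section
open scoped Classical
set_option linter.unusedSectionVars false

section cong2
variable {K : Type*} [Field K] (ι : K ≃+* K) (hinv : ∀ x, ι (ι x) = x)

theorem bl_det {m : ℕ} (c : K) (A : Matrix (Fin m) (Fin m) K) : (bl c A).det = c * A.det := by
  rw [Matrix.det_succ_row_zero, Fin.sum_univ_succ]
  have h : (bl c A).submatrix Fin.succ (Fin.succAbove 0) = A := by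
    ext i j; simp
  rw [h]
  simp

theorem herm_fix {m : ℕ} {M : Matrix (Fin m) (Fin m) K} (hinv : ∀ x, ι (ι x) = x) (hM : Mᵀ = M.map ι) (v : Fin m → K) :
    ι (v ⬝ᵥ (M *ᵥ (fun i => ι (v i)))) = v ⬝ᵥ (M *ᵥ (fun i => ι (v i))) := by
  have he : ∀ i j, ι (M i j) = M j i := fun i j => (congrFun (congrFun hM i) j).symm
  simp only [dotProduct, Matrix.mulVec, map_sum, map_mul, hinv, he, Finset.mul_sum]
  rw [Finset.sum_comm]
  refine Finset.sum_congr rfl fun i _ => Finset.sum_congr rfl fun j _ => by ring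

theorem exists_aniso [CharZero K] {m : ℕ} {M : Matrix (Fin (m + 1)) (Fin (m + 1)) K} (hM : Mᵀ = M.map ι) (hd : M.det ≠ 0) (hinv : ∀ x, ι (ι x) = x) :
    ∃ v : Fin (m + 1) → K, v ⬝ᵥ (M *ᵥ (fun i => ι (v i))) ≠ 0 := by
  by_contra hcon
  push Not at hcon
  have he : ∀ i j, ι (M i j) = M j i := fun i j => (congrFun (congrFun hM i) j).symm
  have key : ∀ i j (t : K), M i i + ι t * M i j + t * M j i + t * ι t * M j j = 0 := by
    intro i j t
    have h := hcon (Pi.single i 1 + Pi.single j t)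
    have h2 : (fun k => ι ((Pi.single i 1 + Pi.single j t : Fin (m + 1) → K) k)) = Pi.single i 1 + Pi.single j (ι t) := by
      funext k
      simp only [Pi.add_apply, map_add, Pi.single_apply, apply_ite ι, map_one, map_zero]
    rw [h2] at h
    simp only [Matrix.mulVec_add, add_dotProduct, dotProduct_add, single_dotProduct, Matrix.mulVec_single, Pi.smul_apply, Matrix.col_apply, MulOpposite.smul_eq_mul_unop, MulOpposite.unop_op] at h
    linear_combination h
  have hii : ∀ i, M i i = 0 := by
    intro i; have := key i i 0; simpa using this
  have hij : ∀ i j, M i j = 0 := by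
    intro i j
    by_contra hne
    have hne' : M j i ≠ 0 := by
      rw [← he i j]; simpa using hne
    have h := key i j (M j i)⁻¹
    rw [hii, hii, map_inv₀, he, inv_mul_cancel₀ hne, inv_mul_cancel₀ hne'] at h
    norm_num at h
  apply hd
  have : M = 0 := by ext i j; exact hij i j
  rw [this, Matrix.det_zero]
end cong2

section diag
variable {F K : Type*} [Field F] [Field K] [CharZero K] [Algebra F K] (ι : K ≃+* K) (hinv : ∀ x, ι (ι x) = x)
    (hfix : ∀ x : K, ι x = x ↔ ∃ y : F, algebraMap F K y = x)

/-- diagonal form with entries in F -/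
def dg (K : Type*) [Field K] {F : Type*} [Field F] [Algebra F K] {m : ℕ} (a : Fin m → F) : Matrix (Fin m) (Fin m) K :=
  Matrix.diagonal fun i => algebraMap F K (a i)

theorem bl_dg {m : ℕ} (c : F) (a : Fin m → F) : bl (algebraMap F K c) (dg K a) = dg K (Fin.cons c a : Fin (m + 1) → F) := by
  rw [dg, bl_diag, dg]
  congr 1
  funext i
  refine Fin.cases ?_ (fun i => ?_) i <;> simp

theorem det_dg {m : ℕ} (a : Fin m → F) : (dg K a).det = algebraMap F K (∏ i, a i) := by
  rw [dg, Matrix.det_diagonal, map_prod]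

include hfix in
theorem dg_herm {m : ℕ} (a : Fin m → F) : (dg K a)ᵀ = (dg K a).map ι := by
  rw [dg, Matrix.diagonal_transpose]
  ext i j
  simp only [Matrix.map_apply, Matrix.diagonal_apply, apply_ite ι, map_zero, (hfix _).2 ⟨_, rfl⟩]

include hinv hfix in
theorem diagz : ∀ (m : ℕ) (M : Matrix (Fin m) (Fin m) K), Mᵀ = M.map ι → M.det ≠ 0 →
    ∃ a : Fin m → F, (∀ i, a i ≠ 0) ∧ Cg ι M (dg K a) := by
  intro m
  induction m with
  | zero => 
    intro M _ _
    refine ⟨Fin.elim0, fun i => i.elim0, ?_⟩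
    rw [Subsingleton.elim (dg K _) M]
    exact Cg_refl ι M
  | succ m ih =>
    intro M hM hd
    obtain ⟨v, hv⟩ := exists_aniso ι hM hd hinv
    obtain ⟨c, hc⟩ := (hfix _).1 (herm_fix ι hinv hM v)
    obtain ⟨M', hM', h⟩ := split ι hinv hM v _ hv rfl
    rw [← hc] at h hv
    have hd' : M'.det ≠ 0 := by
      obtain ⟨t, ht, h1⟩ := Cg_det h
      rw [bl_det] at h1
      rintro h0
      rw [h0] at h1
      simp at h1; exact hd h1
    obtain ⟨a, ha, h2⟩ := ih M' hM' hd'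
    refine ⟨Fin.cons c a, ?_, ?_⟩
    · intro i
      refine Fin.cases ?_ (fun i => ?_) i
      · rintro h0
        simp only [Fin.cons_zero] at h0
        rw [h0, map_zero] at hv; exact hv rfl
      · simpa using ha i
    · rw [← bl_dg]
      exact Cg_trans h (Cg_bl _ h2)

/-- T-step: represent c by diag a, split off. -/
theorem split_dg {m : ℕ} (a : Fin (m + 1) → F) (ha : ∀ i, a i ≠ 0) (hinv : ∀ x, ι (ι x) = x) (hfix : ∀ x : K, ι x = x ↔ ∃ y : F, algebraMap F K y = x)
    (c : F) (hc : c ≠ 0) (v : Fin (m + 1) → K)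
    (hv : ∑ i, algebraMap F K (a i) * (v i * ι (v i)) = algebraMap F K c) :
    ∃ a' : Fin m → F, (∀ i, a' i ≠ 0) ∧ Cg ι (dg K a) (dg K (Fin.cons c a' : Fin (m + 1) → F)) := by
  have hc' : algebraMap F K c ≠ 0 := by simpa using hc
  obtain ⟨M', hM', h⟩ := split ι hinv (dg_herm ι hfix a) v _ hc' (by
    rw [← hv, dg, dotProduct]
    refine Finset.sum_congr rfl fun i _ => ?_
    rw [Matrix.mulVec_diagonal]
    ring)
  have hd' : M'.det ≠ 0 := by
    obtain ⟨t, ht, h1⟩ := Cg_det h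
    rw [bl_det, det_dg] at h1
    rintro h0
    rw [h0] at h1
    simp [Finset.prod_eq_zero_iff, ha] at h1
  obtain ⟨a', ha', h2⟩ := diagz ι hinv hfix m M' hM' hd'
  refine ⟨a', ha', ?_⟩
  rw [← bl_dg]
  exact Cg_trans h (Cg_bl _ h2)

end diag
end
end HL

namespace HL
open NumberField Module IsDedekindDomain
open scoped nonZeroDivisors Topology Pointwise

noncomputable section
open scoped Classical
set_option linter.unusedSectionVars false

section setup
variable {F K : Type*} [Field F] [Field K] [NumberField F] [NumberField K] [Algebra F K] (ι : K ≃+* K)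

theorem setup (hrank : Module.finrank F K = 2)
    (hCM : ∀ φ : K →+* ℂ, ∃ x, (φ x).im ≠ 0)
    (hinv : ∀ x, ι (ι x) = x)
    (hfix : ∀ x : K, ι x = x ↔ ∃ y : F, algebraMap F K y = x) :
    ∃ (s : K) (d : F), s * s = algebraMap F K d ∧ ι s = -s ∧ ∀ σ : F →+* ℝ, σ d < 0 ∧
      ∃ φ : K →+* ℂ, (∀ y, φ (algebraMap F K y) = (σ y : ℂ)) ∧ ∀ x, φ (ι x) = (starRingEnd ℂ) (φ x) := by
  have hx : ∃ x, ι x ≠ x := by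
    by_contra hcon
    push Not at hcon
    have hs : Function.Surjective (algebraMap F K) := fun x => (hfix x).1 (hcon x)
    have hb : Function.Bijective (algebraMap F K) := ⟨(algebraMap F K).injective, hs⟩
    have h1 := (LinearEquiv.ofBijective (Algebra.linearMap F K) hb).finrank_eq
    rw [hrank, Module.finrank_self] at h1
    omega
  obtain ⟨x0, hx0⟩ := hx
  have hs : ι (x0 - ι x0) = -(x0 - ι x0) := by rw [map_sub, hinv]; ring
  have hs0 : x0 - ι x0 ≠ 0 := sub_ne_zero.2 (Ne.symm hx0)
  generalize x0 - ι x0 = s at hs hs0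
  obtain ⟨d, hd⟩ := (hfix (s * s)).1 (by rw [map_mul, hs]; ring)
  have dec : ∀ x : K, ∃ y z : F, x = algebraMap F K y + s * algebraMap F K z := by
    intro x
    obtain ⟨y, hy⟩ := (hfix ((x + ι x) / 2)).1 (by rw [map_div₀, map_add, hinv, map_ofNat]; ring)
    obtain ⟨z, hz⟩ := (hfix ((x - ι x) / (2 * s))).1 (by
      rw [map_div₀, map_sub, hinv, map_mul, map_ofNat, hs]; field_simp; ring)
    refine ⟨y, z, ?_⟩
    rw [hy, hz]; field_simp; ring
  have hιF : ∀ y : F, ι (algebraMap F K y) = algebraMap F K y := fun y => (hfix _).2 ⟨y, rfl⟩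
  refine ⟨s, d, hd.symm, hs, fun σ => ?_⟩
  have : Module.Finite F K := Module.finite_of_finrank_pos (by omega)
  have hφ : ∃ φ : K →+* ℂ, ∀ y, φ (algebraMap F K y) = (σ y : ℂ) := by
    let _ : Algebra F ℂ := (Complex.ofRealHom.comp σ).toAlgebra
    let f : K →ₐ[F] ℂ := IsAlgClosed.lift
    exact ⟨f, fun y => f.commutes y⟩
  obtain ⟨φ, hφ⟩ := hφ
  have hsq : φ s * φ s = (σ d : ℂ) := by rw [← map_mul, ← hd, hφ]
  have hre := congrArg Complex.re hsq
  have him := congrArg Complex.im hsq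
  simp only [Complex.mul_re, Complex.mul_im, Complex.ofReal_re, Complex.ofReal_im] at hre him
  have him0 : (φ s).im ≠ 0 := by
    intro h0
    obtain ⟨x, hx⟩ := hCM φ
    apply hx
    obtain ⟨y, z, rfl⟩ := dec x
    rw [map_add, map_mul, hφ, hφ]
    simp [h0]
  have hre0 : (φ s).re = 0 := by
    have : (φ s).re * (φ s).im = 0 := by linarith
    exact (mul_eq_zero.1 this).resolve_right him0
  refine ⟨?_, φ, hφ, ?_⟩
  · rw [← hre, hre0]
    have := mul_self_pos.2 him0
    linarith
  · intro x
    have hcs : (starRingEnd ℂ) (φ s) = - φ s := by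
      apply Complex.ext <;> simp [hre0]
    obtain ⟨y, z, rfl⟩ := dec x
    rw [map_add ι, map_mul ι, hs, hιF, hιF, map_add φ, map_mul φ, map_add φ, map_mul φ, map_neg, hφ, hφ, map_add, map_mul, hcs]
    simp
end setup

section rep
universe u
variable {F : Type u} {K : Type*} [Field F] [Field K] [NumberField F] [NumberField K] [Algebra F K] (ι : K ≃+* K)
  (hι : ∀ y : F, ι (algebraMap F K y) = algebraMap F K y)
  {s : K} {d : F} (hsd : s * s = algebraMap F K d) (hs : ι s = -s)
  (hd : ∀ σ : F →+* ℝ, σ d < 0) (φ0 : F →+* ℝ)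

include hι hsd hs in
theorem norm_form (x y : F) : (algebraMap F K x + s * algebraMap F K y) * ι (algebraMap F K x + s * algebraMap F K y)
    = algebraMap F K (x ^ 2 - d * y ^ 2) := by
  rw [map_add ι, map_mul ι, hs, hι, hι]
  simp only [map_sub, map_mul, map_pow, ← hsd]
  ring

include hι hsd hs hd φ0 in
theorem rep2 {a0 a1 c : F} (h0 : a0 ≠ 0) (h1 : a1 ≠ 0) (hc : c ≠ 0) (hpos : ∀ σ : F →+* ℝ, 0 < σ (a0 * c) ∨ 0 < σ (a1 * c)) :
    ∃ v0 v1 : K, algebraMap F K a0 * (v0 * ι v0) + algebraMap F K a1 * (v1 * ι v1) = algebraMap F K c := by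
  have hk := key_neg φ0 (mul_ne_zero h0 hc) (mul_ne_zero h1 hc) hd hpos
  have hd0 : d ≠ 0 := by rintro rfl; have := hd φ0; simp at this
  -- d ∈ Nr (a0 c) (a1 c)  gives  a0 c ∈ Nr (a1 c) d
  have h2 := Nr_sym (mul_ne_zero h1 hc) hd0 hk
  rw [Nr_swap] at h2
  obtain ⟨x, y, z, w, h⟩ := h2
  have hn := norm_form ι hι hsd hs
  have hu := hn x y
  have hv := hn z w
  generalize algebraMap F K x + s * algebraMap F K y = u at hu
  generalize algebraMap F K z + s * algebraMap F K w = v at hv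
  have h' := congrArg (algebraMap F K) h
  rw [map_sub, ← hu, map_mul, map_mul, map_mul, ← hv] at h'
  have h0' : algebraMap F K a0 ≠ 0 := by simpa using h0
  have h1' : algebraMap F K a1 ≠ 0 := by simpa using h1
  have hc' : algebraMap F K c ≠ 0 := by simpa using hc
  by_cases hu0 : u = 0
  · have hv0 : v ≠ 0 := by
      rintro rfl
      rw [hu0] at h'; simp at h'; tauto
    have hιv : ι v ≠ 0 := by simpa using hv0
    rw [hu0, zero_mul] at h'
    have h'' : algebraMap F K a0 = - (algebraMap F K a1 * (v * ι v)) := by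
      apply mul_right_cancel₀ hc'
      linear_combination h'
    refine ⟨algebraMap F K ((c / a1 - 1) / 2) / v, algebraMap F K ((c / a1 + 1) / 2), ?_⟩
    rw [map_div₀ ι, hι, hι, h'']
    simp only [map_div₀, map_sub, map_add, map_one, map_ofNat]
    field_simp
    ring
  · have hιu : ι u ≠ 0 := by simpa using hu0
    refine ⟨algebraMap F K c / u, algebraMap F K c * v / u, ?_⟩
    rw [map_div₀ ι, map_div₀ ι, map_mul ι, hι]
    field_simp
    linear_combination h'

include hι hsd hs hd φ0 in
theorem rep : ∀ (m : ℕ) (a : Fin (m + 2) → F) (c : F), (∀ i, a i ≠ 0) → c ≠ 0 → (∀ σ : F →+* ℝ, ∃ i, 0 < σ (a i * c)) →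
    ∃ v : Fin (m + 2) → K, ∑ i, algebraMap F K (a i) * (v i * ι (v i)) = algebraMap F K c := by
  intro m
  induction m with
  | zero =>
    intro a c ha hc hpos
    obtain ⟨v0, v1, h⟩ := rep2 ι hι hsd hs hd φ0 (ha 0) (ha 1) hc (by
      intro σ
      obtain ⟨i, hi⟩ := hpos σ
      match i, hi with
      | 0, hi => exact Or.inl hi
      | 1, hi => exact Or.inr hi)
    refine ⟨![v0, v1], ?_⟩
    rw [Fin.sum_univ_two]
    simpa using h
  | succ m ih =>
    intro a c ha hc hpos
    obtain ⟨η, hη⟩ := sign_fix (a 0 * c) (a 1 * c)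
    have he : a 0 * η ^ 2 + a 1 ≠ 0 := by
      intro h0
      have h1 : a 0 * c * η ^ 2 + a 1 * c = 0 := by linear_combination c * h0
      have h2 := hη φ0
      rw [h1, map_zero] at h2
      have h3 : ¬ (0 < φ0 (a 0 * c) ∨ 0 < φ0 (a 1 * c)) := fun h => (h2 h).false
      push Not at h3
      have h4 : φ0 (a 1 * c) ≠ 0 := by simpa using ⟨ha 1, hc⟩
      have h5 := congrArg φ0 h1
      rw [map_add, map_mul φ0 (a 0 * c), map_pow, map_zero] at h5
      have h6 : φ0 (a 1 * c) < 0 := lt_of_le_of_ne h3.2 h4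
      nlinarith [mul_nonneg (neg_nonneg.2 h3.1) (sq_nonneg (φ0 η))]
    obtain ⟨v, hv⟩ := ih (Fin.cons (a 0 * η ^ 2 + a 1) (fun i => a i.succ.succ)) c (by
        intro i
        refine Fin.cases ?_ (fun i => ?_) i
        · simpa using he
        · simpa using ha _) hc (by
        intro σ
        by_cases h : 0 < σ (a 0 * c) ∨ 0 < σ (a 1 * c)
        · refine ⟨0, ?_⟩
          have := hη σ h
          rw [Fin.cons_zero]
          convert this using 2
          ring
        · push Not at h
          obtain ⟨i, hi⟩ := hpos σ
          induction i using Fin.cases with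
          | zero => exact absurd hi (not_lt.2 h.1)
          | succ i =>
            induction i using Fin.cases with
            | zero => exact absurd hi (not_lt.2 h.2)
            | succ i => exact ⟨i.succ, by simpa using hi⟩)
    refine ⟨Fin.cons (v 0 * algebraMap F K η) v, ?_⟩
    rw [Fin.sum_univ_succ] at hv ⊢
    rw [Fin.sum_univ_succ]
    simp only [Fin.cons_zero, Fin.cons_succ, map_mul ι, hι] at hv ⊢
    rw [← hv, map_add, map_mul, map_pow]
    have : Fin.succ (0 : Fin (m + 2)) = 1 := rfl
    rw [this]
    ring
end rep

end
end HL

namespace HL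
open NumberField Module IsDedekindDomain
open scoped nonZeroDivisors Topology Pointwise

noncomputable section
open scoped Classical
set_option linter.unusedSectionVars false

section sylv
/-- complex conjugation as a ring equivalence -/
def cc : ℂ ≃+* ℂ := starRingAut

theorem cc_apply (z : ℂ) : cc z = (starRingEnd ℂ) z := rfl

theorem form_eq {m : ℕ} {r s : Fin m → ℝ} {P : Matrix (Fin m) (Fin m) ℂ} (h : dg ℂ r = Pᵀ * dg ℂ s * P.map cc) (x : Fin m → ℂ) :
    ∑ i, r i * Complex.normSq (x i) = ∑ i, s i * Complex.normSq ((P *ᵥ x) i) := by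
  have h1 : ∀ (t : Fin m → ℝ) (y : Fin m → ℂ), y ⬝ᵥ (dg ℂ t *ᵥ (fun i => cc (y i))) = ((∑ i, t i * Complex.normSq (y i) : ℝ) : ℂ) := by
    intro t y
    rw [dotProduct, Complex.ofReal_sum]
    refine Finset.sum_congr rfl fun i _ => ?_
    rw [dg, Matrix.mulVec_diagonal, Complex.ofReal_mul, Complex.normSq_eq_conj_mul_self, cc_apply]
    change y i * ((t i : ℂ) * _) = _
    ring
  have h2 : (P.map cc) *ᵥ (fun i => cc (x i)) = fun i => cc ((P *ᵥ x) i) := by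
    funext i
    simp [Matrix.mulVec, dotProduct, map_sum]
  have h3 := h1 r x
  rw [h, ← Matrix.mulVec_mulVec, h2, ← Matrix.mulVec_mulVec, Matrix.dotProduct_mulVec, Matrix.vecMul_transpose, h1] at h3
  exact_mod_cast h3.symm

theorem sylv_le {m : ℕ} {r s : Fin m → ℝ} {P : Matrix (Fin m) (Fin m) ℂ} (h : dg ℂ r = Pᵀ * dg ℂ s * P.map cc) :
    Fintype.card {i // 0 < r i} ≤ Fintype.card {i // 0 < s i} := by
  let E : ({i // 0 < r i} → ℂ) →ₗ[ℂ] (Fin m → ℂ) :=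
    { toFun := fun x i => if hi : 0 < r i then x ⟨i, hi⟩ else 0
      map_add' := by intro x y; funext i; by_cases hi : 0 < r i <;> simp [hi]
      map_smul' := by intro x y; funext i; by_cases hi : 0 < r i <;> simp [hi] }
  let L : ({i // 0 < r i} → ℂ) →ₗ[ℂ] ({i // 0 < s i} → ℂ) :=
    (LinearMap.funLeft ℂ ℂ (Subtype.val : {i // 0 < s i} → Fin m)) ∘ₗ (Matrix.mulVecLin P) ∘ₗ E
  have hE : ∀ x i (hi : 0 < r i), E x i = x ⟨i, hi⟩ := fun x i hi => dif_pos hi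
  have hE0 : ∀ x i (hi : ¬ 0 < r i), E x i = 0 := fun x i hi => dif_neg hi
  have hL : Function.Injective L := by
    rw [← LinearMap.ker_eq_bot, LinearMap.ker_eq_bot']
    intro x hx
    have hx' : ∀ i, 0 < s i → (P *ᵥ E x) i = 0 := fun i hi => congrFun hx ⟨i, hi⟩
    have hf := form_eq h (E x)
    have hR : ∑ i, s i * Complex.normSq ((P *ᵥ E x) i) ≤ 0 := by
      refine Finset.sum_nonpos fun i _ => ?_
      by_cases hi : 0 < s i
      · rw [hx' i hi]; simp
      · exact mul_nonpos_of_nonpos_of_nonneg (not_lt.1 hi) (Complex.normSq_nonneg _)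
    have hpos : ∀ i ∈ Finset.univ, 0 ≤ r i * Complex.normSq (E x i) := by
      intro i _
      by_cases hi : 0 < r i
      · exact mul_nonneg hi.le (Complex.normSq_nonneg _)
      · rw [hE0 x i hi]; simp
    have hz := (Finset.sum_eq_zero_iff_of_nonneg hpos).1 (le_antisymm (hf.trans_le hR) (Finset.sum_nonneg hpos))
    funext ⟨i, hi⟩
    have := hz i (Finset.mem_univ i)
    rw [hE x i hi] at this
    simpa [hi.ne'] using this
  have := LinearMap.finrank_le_finrank_of_injective hL
  simpa using this

theorem sylv_eq {m : ℕ} {r s : Fin m → ℝ} (h : Cg cc (dg ℂ r) (dg ℂ s)) :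
    Fintype.card {i // 0 < r i} = Fintype.card {i // 0 < s i} := by
  obtain ⟨Q, _, hQ⟩ := Cg_symm h
  obtain ⟨P, _, hP⟩ := h
  exact le_antisymm (sylv_le hP) (sylv_le hQ)

theorem dg_neg {F K : Type*} [Field F] [Field K] [Algebra F K] {m : ℕ} (r : Fin m → F) : dg K (fun i => - r i) = - dg K r := by
  ext i j
  by_cases hij : i = j <;> simp [dg, hij]

theorem Cg_neg {K : Type*} [Field K] {ι : K ≃+* K} {m : ℕ} {A B : Matrix (Fin m) (Fin m) K} (h : Cg ι A B) : Cg ι (-A) (-B) := by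
  obtain ⟨P, hP, rfl⟩ := h
  exact ⟨P, hP, by simp⟩

theorem sylv_eq_neg {m : ℕ} {r s : Fin m → ℝ} (h : Cg cc (dg ℂ r) (dg ℂ s)) :
    Fintype.card {i // r i < 0} = Fintype.card {i // s i < 0} := by
  have h1 := Cg_neg h
  rw [← dg_neg, ← dg_neg] at h1
  have h2 := sylv_eq h1
  simpa using h2

theorem spec_cg {m : ℕ} {A : Matrix (Fin m) (Fin m) ℂ} (hA : A.IsHermitian) : Cg cc A (dg ℂ hA.eigenvalues) := by
  have h := hA.spectral_theorem
  rw [Unitary.conjStarAlgAut_apply] at h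
  refine ⟨(hA.eigenvectorUnitary : Matrix (Fin m) (Fin m) ℂ)ᵀ, ?_, ?_⟩
  · rw [Matrix.isUnit_transpose]
    exact (Unitary.toUnits hA.eigenvectorUnitary).isUnit
  · rw [Matrix.transpose_transpose]
    exact h

section
variable {F K : Type*} [Field F] [Field K] [Algebra F K] {ι : K ≃+* K} {φ : K →+* ℂ} {σ : F →+* ℝ}
  (hφσ : ∀ y, φ (algebraMap F K y) = (σ y : ℂ)) (hφ : ∀ x, φ (ι x) = (starRingEnd ℂ) (φ x))

include hφ in
theorem Cg_map {m : ℕ} {A B : Matrix (Fin m) (Fin m) K} (h : Cg ι A B) : Cg cc (A.map φ) (B.map φ) := by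
  obtain ⟨P, hP, rfl⟩ := h
  refine ⟨P.map φ, ?_, ?_⟩
  · exact hP.map φ.mapMatrix
  · have h1 : (P.map ι).map φ = (P.map φ).map cc := by
      ext i j; simp [hφ, cc_apply]
    rw [← h1]
    change φ.mapMatrix (Pᵀ * B * P.map ι) = _
    rw [map_mul, map_mul]
    rfl

include hφσ in
theorem dg_map {m : ℕ} (a : Fin m → F) : (dg K a).map φ = dg ℂ (fun i => σ (a i)) := by
  ext i j
  by_cases hij : i = j <;> simp [dg, hij, hφσ]

include hφ hφσ in
theorem sylv_F {m : ℕ} {a b : Fin m → F} (h : Cg ι (dg K a) (dg K b)) :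
    Fintype.card {i // 0 < σ (a i)} = Fintype.card {i // 0 < σ (b i)} := by
  have := Cg_map hφ h
  rw [dg_map hφσ, dg_map hφσ] at this
  exact sylv_eq this

include hφ hφσ in
theorem sig_eq {m : ℕ} {a : Fin m → F} {M : Matrix (Fin m) (Fin m) K} (h : Cg ι M (dg K a)) {p q : ℕ} (hpq : HermSig m (M.map φ) p q) :
    p = Fintype.card {i // 0 < σ (a i)} ∧ q = Fintype.card {i // σ (a i) < 0} := by
  obtain ⟨hA, rfl, rfl⟩ := hpq
  have h1 := Cg_map hφ h
  rw [dg_map hφσ] at h1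
  have h2 := Cg_trans (Cg_symm (spec_cg hA)) h1
  exact ⟨by convert sylv_eq h2, by convert sylv_eq_neg h2⟩
end
end sylv

end
end HL

namespace HL
open NumberField Module IsDedekindDomain
open scoped nonZeroDivisors Topology Pointwise

noncomputable section
open scoped Classical
set_option linter.unusedSectionVars false

section fin
theorem card_eq_sum {m : ℕ} (p : Fin m → Prop) : Fintype.card {i // p i} = ∑ i, if p i then 1 else 0 := by
  rw [Fintype.card_subtype, Finset.card_filter]

theorem card_cons {m : ℕ} (p : Fin (m + 1) → Prop) : Fintype.card {i // p i} = (if p 0 then 1 else 0) + Fintype.card {i : Fin m // p i.succ} := by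
  rw [card_eq_sum, card_eq_sum, Fin.sum_univ_succ]

theorem card_pos_neg {m : ℕ} (r : Fin m → ℝ) (hr : ∀ i, r i ≠ 0) : Fintype.card {i // 0 < r i} + Fintype.card {i // r i < 0} = m := by
  rw [card_eq_sum, card_eq_sum, ← Finset.sum_add_distrib]
  rw [Finset.sum_congr rfl (g := fun _ => 1)]
  · simp
  · intro i _
    rcases lt_or_gt_of_ne (hr i) with h | h
    · rw [if_neg (not_lt.2 h.le), if_pos h]
    · rw [if_pos h, if_neg (not_lt.2 h.le)]

theorem sign_prod {m : ℕ} (r : Fin m → ℝ) (hr : ∀ i, r i ≠ 0) : 0 < (∏ i, r i) * (-1) ^ Fintype.card {i // r i < 0} := by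
  rw [card_eq_sum, ← Finset.prod_pow_eq_pow_sum, ← Finset.prod_mul_distrib]
  refine Finset.prod_pos fun i _ => ?_
  rcases lt_or_gt_of_ne (hr i) with h | h
  · rw [if_pos h]; linarith
  · rw [if_neg (not_lt.2 h.le)]; linarith
end fin

section T
universe u
variable {F : Type u} {K : Type*} [Field F] [Field K] [NumberField F] [NumberField K] [Algebra F K] (ι : K ≃+* K)
  (hinv : ∀ x, ι (ι x) = x) (hfix : ∀ x : K, ι x = x ↔ ∃ y : F, algebraMap F K y = x)
  {s : K} {d : F} (hsd : s * s = algebraMap F K d) (hs : ι s = -s)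
  (hd : ∀ σ : F →+* ℝ, σ d < 0 ∧
      ∃ φ : K →+* ℂ, (∀ y, φ (algebraMap F K y) = (σ y : ℂ)) ∧ ∀ x, φ (ι x) = (starRingEnd ℂ) (φ x)) (φ0 : F →+* ℝ)

include hinv hfix hsd hs hd φ0 in
theorem landherr : ∀ (m : ℕ) (a b : Fin m → F), (∀ i, a i ≠ 0) → (∀ i, b i ≠ 0) →
    (∀ σ : F →+* ℝ, Fintype.card {i // 0 < σ (a i)} = Fintype.card {i // 0 < σ (b i)}) →
    (∃ t : K, t ≠ 0 ∧ algebraMap F K (∏ i, a i) = algebraMap F K (∏ i, b i) * (t * ι t)) →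
    Cg ι (dg K a) (dg K b) := by
  have hι : ∀ y : F, ι (algebraMap F K y) = algebraMap F K y := fun y => (hfix _).2 ⟨y, rfl⟩
  intro m
  induction m with
  | zero =>
    intro a b _ _ _ _
    rw [Subsingleton.elim (dg K a) (dg K b)]
    exact Cg_refl ι _
  | succ m ih =>
    intro a b ha hb hsg ⟨t, ht, hdet⟩
    cases m with
    | zero =>
      refine ⟨Matrix.diagonal fun _ => t, ?_, ?_⟩
      · rw [Matrix.isUnit_iff_isUnit_det, Matrix.det_diagonal]
        simpa using ht
      · ext i j
        have hi : i = 0 := Fin.ext (by omega)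
        have hj : j = 0 := Fin.ext (by omega)
        rw [hi, hj]
        simp only [Nat.reduceAdd, Finset.univ_unique, Fin.default_eq_zero, Finset.prod_singleton] at hdet
        simp [dg, Matrix.mul_apply]
        rw [hdet]; ring
    | succ m =>
      obtain ⟨v, hv⟩ := rep ι hι hsd hs (fun σ => (hd σ).1) φ0 m a (b 0) ha (hb 0) (by
        intro σ
        have h := hsg σ
        by_contra hcon
        push Not at hcon
        have hb0 : σ (b 0) ≠ 0 := by simpa using hb 0
        have hc' : ∀ i, σ (a i) * σ (b 0) ≤ 0 := by intro i; rw [← map_mul]; exact hcon i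
        rcases lt_or_gt_of_ne hb0 with h0 | h0
        · have h1 : ∀ i, 0 < σ (a i) := by
            intro i
            have hai : σ (a i) ≠ 0 := by simpa using ha i
            refine lt_of_le_of_ne ?_ hai.symm
            by_contra h2
            push Not at h2
            have := mul_pos_of_neg_of_neg h2 h0
            linarith [hc' i]
          have h2 : Fintype.card {i // 0 < σ (a i)} = m + 2 := by
            rw [card_eq_sum, Finset.sum_congr rfl (fun i _ => if_pos (h1 i))]; simp
          have h3 := card_pos_neg (fun i => σ (b i)) (by intro i; simpa using hb i)
          have h4 : 0 < Fintype.card {i // σ (b i) < 0} := Fintype.card_pos_iff.2 ⟨⟨0, h0⟩⟩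
          omega
        · have h1 : ∀ i, ¬ 0 < σ (a i) := by
            intro i h2
            have := mul_pos h2 h0
            linarith [hc' i]
          have h2 : Fintype.card {i // 0 < σ (a i)} = 0 := by
            rw [card_eq_sum, Finset.sum_congr rfl (fun i _ => if_neg (h1 i))]; simp
          have h4 : 0 < Fintype.card {i // 0 < σ (b i)} := Fintype.card_pos_iff.2 ⟨⟨0, h0⟩⟩
          omega)
      obtain ⟨a', ha', hcg⟩ := split_dg ι a ha hinv hfix (b 0) (hb 0) v hv
      have hbt : (Fin.cons (b 0) (fun i => b i.succ) : Fin (m + 2) → F) = b := Fin.cons_self_tail b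
      obtain ⟨t', ht', hdet'⟩ := Cg_det hcg
      have hιt' : ι t' ≠ 0 := by simpa using ht'
      have hb0 : algebraMap F K (b 0) ≠ 0 := by simpa using hb 0
      have := ih a' (fun i => b i.succ) ha' (fun i => hb _) (by
        intro σ
        obtain ⟨φ, hφσ, hφ⟩ := (hd σ).2
        have h1 := sylv_F hφσ hφ hcg
        rw [hsg σ, card_cons, card_cons (fun i => 0 < σ ((Fin.cons (b 0) a' : Fin (m + 2) → F) i))] at h1
        simp only [Fin.cons_zero, Fin.cons_succ] at h1
        omega) (by
        refine ⟨t / t', div_ne_zero ht ht', ?_⟩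
        rw [det_dg, det_dg, hdet, Fin.prod_univ_succ b, Fin.prod_univ_succ (Fin.cons (b 0) a' : Fin (m + 2) → F)] at hdet'
        simp only [Fin.cons_zero, Fin.cons_succ] at hdet'
        rw [map_mul, map_mul] at hdet'
        rw [map_div₀]
        field_simp
        apply mul_left_cancel₀ hb0
        linear_combination -hdet')
      refine Cg_trans hcg ?_
      rw [← hbt, ← bl_dg, ← bl_dg]
      exact Cg_bl _ this

theorem Cg_smul {m : ℕ} {A B : Matrix (Fin m) (Fin m) K} (c : K) (h : Cg ι A B) : Cg ι (c • A) (c • B) := by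
  obtain ⟨P, hP, rfl⟩ := h
  exact ⟨P, hP, by simp⟩

theorem final (hrank : Module.finrank F K = 2)
    (htotreal : ∀ φ : F →+* ℂ, ∀ x, (φ x).im = 0)
    (hCM : ∀ φ : K →+* ℂ, ∃ x, (φ x).im ≠ 0)
    (hinv : ∀ x, ι (ι x) = x)
    (hfix : ∀ x : K, ι x = x ↔ ∃ y : F, algebraMap F K y = x)
    (m : ℕ) (hm : Odd m)
    (M₁ M₂ : Matrix (Fin m) (Fin m) K)
    (hH₁ : M₁ᵀ = M₁.map ι) (hH₂ : M₂ᵀ = M₂.map ι)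
    (hnd₁ : M₁.det ≠ 0) (hnd₂ : M₂.det ≠ 0)
    (hsgn : ∀ φ : K →+* ℂ, (∀ x, φ (ι x) = (starRingEnd ℂ) (φ x)) →
      ∃ p q : ℕ, HermSig m (M₁.map φ) p q ∧
        (HermSig m (M₂.map φ) p q ∨ HermSig m (M₂.map φ) q p)) :
    ∃ (l : F) (P : Matrix (Fin m) (Fin m) K), l ≠ 0 ∧ IsUnit P.det ∧
      M₁ = algebraMap F K l • (Pᵀ * M₂ * P.map ι) := by
  have hι : ∀ y : F, ι (algebraMap F K y) = algebraMap F K y := fun y => (hfix _).2 ⟨y, rfl⟩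
  have φ0 : F →+* ℝ := by
    have ψ : F →+* ℂ := Classical.arbitrary _
    refine ComplexEmbedding.IsReal.embedding (φ := ψ) ?_
    rw [ComplexEmbedding.isReal_iff]
    ext x
    rw [ComplexEmbedding.conjugate_coe_eq]
    exact Complex.conj_eq_iff_im.2 (htotreal ψ x)
  obtain ⟨s, d, hsd, hs, hd⟩ := setup ι hrank hCM hinv hfix
  obtain ⟨a, ha, hMa⟩ := diagz ι hinv hfix m M₁ hH₁ hnd₁
  obtain ⟨b, hb, hMb⟩ := diagz ι hinv hfix m M₂ hH₂ hnd₂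
  have hA : ∏ i, a i ≠ 0 := Finset.prod_ne_zero_iff.2 fun i _ => ha i
  have hB : ∏ i, b i ≠ 0 := Finset.prod_ne_zero_iff.2 fun i _ => hb i
  obtain ⟨l, hl⟩ : ∃ l : F, l = (∏ i, a i) / ∏ i, b i := ⟨_, rfl⟩
  have hl0 : l ≠ 0 := by rw [hl]; exact div_ne_zero hA hB
  have hT : Cg ι (dg K a) (dg K (fun i => l * b i)) := by
    apply landherr ι hinv hfix hsd hs hd φ0 m a _ ha (fun i => mul_ne_zero hl0 (hb i))
    · intro σ
      obtain ⟨φ, hφσ, hφ⟩ := (hd σ).2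
      obtain ⟨p, q, h1, h2⟩ := hsgn φ hφ
      obtain ⟨hp, hq⟩ := sig_eq hφσ hφ hMa h1
      have ha' : ∀ i, σ (a i) ≠ 0 := fun i => by simpa using ha i
      have hb' : ∀ i, σ (b i) ≠ 0 := fun i => by simpa using hb i
      have hsa := sign_prod (fun i => σ (a i)) ha'
      have hsb := sign_prod (fun i => σ (b i)) hb'
      have hca := card_pos_neg (fun i => σ (a i)) ha'
      rw [← map_prod] at hsa hsb
      rw [← hq] at hsa hca
      rw [← hp] at hca
      have hlσ : σ l = σ (∏ i, a i) / σ (∏ i, b i) := by rw [hl, map_div₀]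
      simp only [map_mul σ l]
      rcases h2 with h2 | h2
      · obtain ⟨hp', hq'⟩ := sig_eq hφσ hφ hMb h2
        rw [← hq'] at hsb
        have hlp : 0 < σ l := by
          rw [hlσ]
          rcases Nat.even_or_odd q with h | h
          · rw [h.neg_one_pow, mul_one] at hsa hsb
            exact div_pos hsa hsb
          · rw [h.neg_one_pow, mul_neg_one] at hsa hsb
            exact div_pos_of_neg_of_neg (by linarith) (by linarith)
        rw [← hp, hp']
        simp only [mul_pos_iff_of_pos_left hlp]
      · obtain ⟨hp', hq'⟩ := sig_eq hφσ hφ hMb h2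
        rw [← hq'] at hsb
        have hln : σ l < 0 := by
          rw [hlσ]
          rw [← hca] at hm
          rcases Nat.even_or_odd q with h | h
          · have h3 : Odd p := by rw [Nat.odd_add] at hm; exact hm.2 h
            rw [h.neg_one_pow, mul_one] at hsa
            rw [h3.neg_one_pow, mul_neg_one] at hsb
            exact div_neg_of_pos_of_neg hsa (by linarith)
          · have h3 : Even p := by
              rw [Nat.odd_add'] at hm; exact hm.1 h
            rw [h.neg_one_pow, mul_neg_one] at hsa
            rw [h3.neg_one_pow, mul_one] at hsb
            exact div_neg_of_neg_of_pos (by linarith) hsb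
        rw [← hp, hq']
        simp only [mul_pos_iff, hln, not_lt.2 hln.le, false_and, true_and, false_or]
    · obtain ⟨k, rfl⟩ := hm
      refine ⟨algebraMap F K (l ^ k)⁻¹, by simpa using fun h => absurd h hl0, ?_⟩
      rw [hι, ← map_mul, ← map_mul]
      congr 1
      rw [Finset.prod_mul_distrib]
      have : ∏ i, a i = l * ∏ i, b i := by rw [hl]; field_simp
      rw [this]
      simp
      field_simp
      ring
  have hdg : dg K (fun i => l * b i) = algebraMap F K l • dg K b := by
    ext i j
    by_cases hij : i = j <;> simp [dg, hij]
  rw [hdg] at hT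
  obtain ⟨P, hP, h⟩ := Cg_trans (Cg_trans hMa hT) (Cg_smul ι (algebraMap F K l) (Cg_symm hMb))
  refine ⟨l, P, hl0, (Matrix.isUnit_iff_isUnit_det P).1 hP, ?_⟩
  rw [h]; simp
end T

end
end HL

/-- Let K/F be a CM quadratic extension of a totally real number field with Galois
    involution ι, and M₁, M₂ nondegenerate ι-Hermitian Gram matrices of odd size m.
    If at every complex embedding of K compatible with ι the signatures agree up to
    swap, then the two Hermitian spaces are F-conformal: M₁ = λ·(Pᵀ M₂ ι(P)) for some
    λ ∈ F^× and invertible P. -/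
theorem stmt3 (F K : Type*) [Field F] [Field K] [NumberField F] [NumberField K]
    [Algebra F K] (hrank : Module.finrank F K = 2)
    (htotreal : ∀ φ : F →+* ℂ, ∀ x, (φ x).im = 0)
    (hCM : ∀ φ : K →+* ℂ, ∃ x, (φ x).im ≠ 0)
    (ι : K ≃+* K)
    (hι : ∀ y : F, ι (algebraMap F K y) = algebraMap F K y)
    (hinv : ∀ x, ι (ι x) = x)
    (hfix : ∀ x : K, ι x = x ↔ ∃ y : F, algebraMap F K y = x)
    (m : ℕ) (hm : Odd m)
    (M₁ M₂ : Matrix (Fin m) (Fin m) K)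
    (hH₁ : M₁ᵀ = M₁.map ι) (hH₂ : M₂ᵀ = M₂.map ι)
    (hnd₁ : M₁.det ≠ 0) (hnd₂ : M₂.det ≠ 0)
    (hsgn : ∀ φ : K →+* ℂ, (∀ x, φ (ι x) = (starRingEnd ℂ) (φ x)) →
      ∃ p q : ℕ, HermSig m (M₁.map φ) p q ∧
        (HermSig m (M₂.map φ) p q ∨ HermSig m (M₂.map φ) q p)) :
    ∃ (l : F) (P : Matrix (Fin m) (Fin m) K), l ≠ 0 ∧ IsUnit P.det ∧
      M₁ = algebraMap F K l • (Pᵀ * M₂ * P.map ι) := by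
  exact HL.final ι hrank htotreal hCM hinv hfix m hm M₁ M₂ hH₁ hH₂ hnd₁ hnd₂ hsgn
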